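/- arXiv:2506.21306 — 3 statements merged into one kernel-verified Lean document; each statement's English description precedes it below -/
import Mathlib

section
/- Let w = exp(−Φ) : ℝ → (0, ∞) where Φ is even, Φ′ exists and is continuous on (0, ∞), and x ↦ x Φ′(x) is positive and strictly increasing on (0, ∞) with limits 0 at 0⁺ and ∞ at ∞. For n ≥ 1, let a = a_n > 0 be the unique solution of (2/π) ∫₀¹ a t Φ′(a t)/√(1 − t²) dt = n. Then for every real polynomial p_n of degree at most n, sup_{x ∈ ℝ} |p_n(x) w(x)| = sup_{x ∈ [−a, a]} |p_n(x) w(x)|. -/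
theorem rr_tanh_le (u : ℝ) (hu : 0 ≤ u) : Real.sinh u ≤ u * Real.cosh u := by
  have hm : MonotoneOn (fun v : ℝ => v * Real.cosh v - Real.sinh v) (Set.Ici 0) := by
    apply monotoneOn_of_hasDerivWithinAt_nonneg (f' := fun v => v * Real.sinh v) (convex_Ici 0)
    · fun_prop
    · intro x hx
      have := ((hasDerivAt_id x).mul (Real.hasDerivAt_cosh x)).sub (Real.hasDerivAt_sinh x)
      refine (this.congr_deriv ?_).hasDerivWithinAt
      simp
    · intro x hx
      simp only [interior_Ici, Set.mem_Ioi] at hx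
      have := Real.sinh_pos_iff.2 hx
      positivity
  have := hm (Set.mem_Ici.2 le_rfl) (Set.mem_Ici.2 hu) hu
  simp at this
  linarith

theorem rr_arctan_le (y : ℝ) (hy : 0 ≤ y) : Real.arctan y ≤ y := by
  rcases hy.eq_or_lt with rfl | h
  · simp
  · have := Real.lt_tan (x := Real.arctan y) (by simpa using h) (Real.arctan_lt_pi_div_two y)
    rw [Real.tan_arctan] at this
    exact this.le

/-- Poisson kernel in hyperbolic form. -/
noncomputable def rrPk (u θ : ℝ) : ℝ := Real.sinh u / (Real.cosh u - Real.cos θ)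

theorem rr_den_pos {u : ℝ} (hu : 0 < u) (θ : ℝ) : 0 < Real.cosh u - Real.cos θ := by
  have := Real.one_lt_cosh.2 hu.ne'
  have := Real.cos_le_one θ
  linarith

theorem rrPk_pos {u : ℝ} (hu : 0 < u) (θ : ℝ) : 0 < rrPk u θ :=
  div_pos (Real.sinh_pos_iff.2 hu) (rr_den_pos hu θ)

theorem rrPk_cont {u : ℝ} (hu : 0 < u) : Continuous (rrPk u) := by
  unfold rrPk
  exact continuous_const.div (by fun_prop) (fun θ => (rr_den_pos hu θ).ne')

theorem rr_kernel {u : ℝ} (hu : 0 < u) (θ : ℝ) :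
    (herglotzRieszKernel 0 ((Real.exp (-u) : ℝ) : ℂ) (circleMap 0 1 θ)).re = rrPk u θ := by
  have h := congrFun (poissonKernel_eq_re_herglotzRieszKernel (c := 0)
    (w := ((Real.exp (-u) : ℝ) : ℂ))) (circleMap 0 1 θ)
  rw [Function.comp_apply] at h
  rw [← h, poissonKernel_def]
  have h1 : ‖circleMap 0 1 θ - 0‖ = 1 := by simp
  have h2 : ‖((Real.exp (-u) : ℝ) : ℂ) - 0‖ = Real.exp (-u) := by
    rw [sub_zero, Complex.norm_real, Real.norm_eq_abs, abs_of_pos (Real.exp_pos _)]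
  have h3 : ‖circleMap 0 1 θ - 0 - (((Real.exp (-u) : ℝ) : ℂ) - 0)‖ ^ 2
      = 1 - 2 * Real.exp (-u) * Real.cos θ + Real.exp (-u) ^ 2 := by
    rw [← Complex.normSq_eq_norm_sq, Complex.normSq_apply]
    simp only [circleMap, Complex.ofReal_one, one_mul, zero_add, sub_zero, Complex.sub_re,
      Complex.sub_im, Complex.exp_ofReal_mul_I_re, Complex.exp_ofReal_mul_I_im,
      Complex.ofReal_re, Complex.ofReal_im]
    nlinarith [Real.sin_sq_add_cos_sq θ]
  rw [h1, h2, h3, rrPk]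
  have hd := rr_den_pos hu θ
  have he := Real.exp_pos (-u)
  have hee : Real.exp u * Real.exp (-u) = 1 := by rw [← Real.exp_add]; simp
  have hden : 1 - 2 * Real.exp (-u) * Real.cos θ + Real.exp (-u) ^ 2
      = 2 * Real.exp (-u) * (Real.cosh u - Real.cos θ) := by
    rw [Real.cosh_eq]; linear_combination (-1) * hee
  have hnum : 1 ^ 2 - Real.exp (-u) ^ 2 = 2 * Real.exp (-u) * Real.sinh u := by
    rw [Real.sinh_eq]; linear_combination (-1) * hee
  rw [hden, hnum, mul_div_mul_left _ _ (by positivity)]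

/-- The Poisson average. -/
noncomputable def rrA (u : ℝ) (f : ℝ → ℝ) : ℝ :=
  (2 * Real.pi)⁻¹ * ∫ θ in (0:ℝ)..(2 * Real.pi), rrPk u θ * f θ

theorem rr_avg {u : ℝ} (hu : 0 < u) (f : ℂ → ℝ) :
    Real.circleAverage (Complex.re ∘ herglotzRieszKernel 0 ((Real.exp (-u) : ℝ) : ℂ) • f) 0 1
      = rrA u (fun θ => f (circleMap 0 1 θ)) := by
  rw [Real.circleAverage_def, rrA, smul_eq_mul]
  congr 1
  apply intervalIntegral.integral_congr
  intro θ _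
  simp only [Pi.smul_apply', Function.comp_apply, smul_eq_mul, rr_kernel hu]

theorem rr_mem {u : ℝ} (hu : 0 < u) : ((Real.exp (-u) : ℝ) : ℂ) ∈ Metric.ball (0:ℂ) 1 := by
  rw [mem_ball_zero_iff, Complex.norm_real, Real.norm_eq_abs, abs_of_pos (Real.exp_pos _)]
  simpa using hu

theorem rrA_const {u : ℝ} (hu : 0 < u) (k : ℝ) : rrA u (fun _ => k) = k := by
  rw [← rr_avg hu (fun _ => k)]
  apply InnerProductSpace.HarmonicOnNhd.circleAverage_re_herglotzRieszKernel_smul _ (rr_mem hu)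
  intro z _
  exact InnerProductSpace.harmonicAt_const _

theorem rr_factor_eq {u : ℝ} (hu : 0 < u) (c : ℂ) (hc : 1 ≤ ‖c‖) :
    rrA u (fun θ => Real.log ‖circleMap 0 1 θ - c‖)
      = Real.log ‖((Real.exp (-u) : ℝ) : ℂ) - c‖ := by
  rw [← rr_avg hu (fun z => Real.log ‖z - c‖)]
  rcases hc.eq_or_lt with h | h
  · exact circleAverage_re_herglotzRieszKernel_mul_log (by simp [← h]) (rr_mem hu)
  · apply InnerProductSpace.HarmonicOnNhd.circleAverage_re_herglotzRieszKernel_smul _ (rr_mem hu)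
    intro z hz
    apply AnalyticAt.harmonicAt_log_norm (by fun_prop)
    rw [sub_ne_zero]
    rintro rfl
    simp at hz
    linarith

theorem rr_factor_le {u : ℝ} (hu : 0 < u) (c : ℂ) (hc : ((Real.exp (-u) : ℝ) : ℂ) ≠ c) :
    Real.log ‖((Real.exp (-u) : ℝ) : ℂ) - c‖ ≤
      rrA u (fun θ => Real.log ‖circleMap 0 1 θ - c‖) := by
  rcases le_or_gt 1 ‖c‖ with h | h
  · rw [rr_factor_eq hu c h]
  · have hsq : ∀ z : ℂ, ‖1 - (starRingEnd ℂ) c * z‖ ^ 2 - ‖z - c‖ ^ 2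
        = (1 - ‖c‖ ^ 2) * (1 - ‖z‖ ^ 2) := by
      intro z
      simp only [← Complex.normSq_eq_norm_sq, Complex.normSq_apply]
      simp
      ring
    have h1 : (fun θ => Real.log ‖circleMap 0 1 θ - c‖)
        = (fun θ => Real.log ‖1 - (starRingEnd ℂ) c * circleMap 0 1 θ‖) := by
      funext θ
      congr 1
      have := hsq (circleMap 0 1 θ)
      have h0 : ‖circleMap 0 1 θ‖ = 1 := by simp
      rw [h0] at this
      rw [← sq_eq_sq₀ (norm_nonneg _) (norm_nonneg _)]
      linarith
    rw [h1, ← rr_avg hu (fun z => Real.log ‖1 - (starRingEnd ℂ) c * z‖)]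
    rw [InnerProductSpace.HarmonicOnNhd.circleAverage_re_herglotzRieszKernel_smul _ (rr_mem hu)]
    · apply Real.log_le_log
      · rw [norm_pos_iff, sub_ne_zero]; exact hc
      · have := hsq ((Real.exp (-u) : ℝ) : ℂ)
        have hm := rr_mem hu
        rw [mem_ball_zero_iff] at hm
        rw [← sq_le_sq₀ (norm_nonneg _) (norm_nonneg _)]
        have : 0 ≤ (1 - ‖c‖ ^ 2) * (1 - ‖((Real.exp (-u) : ℝ) : ℂ)‖ ^ 2) := by
          apply mul_nonneg <;> nlinarith [norm_nonneg c, norm_nonneg ((Real.exp (-u) : ℝ) : ℂ)]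
        linarith
    · intro z hz
      apply AnalyticAt.harmonicAt_log_norm (by fun_prop)
      intro h0
      have : (starRingEnd ℂ) c * z = 1 := by linear_combination -h0
      have h2 := congrArg norm this
      simp at h2 hz
      nlinarith [norm_nonneg c, norm_nonneg z]

theorem rr_int_logfactor (a : ℝ) (b : ℂ) (s t : ℝ) :
    IntervalIntegrable (fun θ => Real.log ‖((a * Real.cos θ : ℝ) : ℂ) - b‖)
      MeasureTheory.volume s t := by
  apply MeromorphicOn.intervalIntegrable_log_norm
  intro x _
  apply AnalyticAt.meromorphicAt
  have h1 : AnalyticAt ℝ (fun θ : ℝ => a * Real.cos θ) x := by fun_prop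
  have h2 : AnalyticAt ℝ (Complex.ofRealCLM ∘ (fun θ : ℝ => a * Real.cos θ)) x :=
    AnalyticAt.comp (Complex.ofRealCLM.analyticAt _) h1
  exact h2.sub analyticAt_const

theorem rr_int_pk {u : ℝ} (hu : 0 < u) {f : ℝ → ℝ} {s t : ℝ}
    (hf : IntervalIntegrable f MeasureTheory.volume s t) :
    IntervalIntegrable (fun θ => rrPk u θ * f θ) MeasureTheory.volume s t :=
  hf.continuousOn_mul (rrPk_cont hu).continuousOn

theorem rrA_add {u : ℝ} (hu : 0 < u) {f g : ℝ → ℝ}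
    (hf : IntervalIntegrable f MeasureTheory.volume 0 (2 * Real.pi))
    (hg : IntervalIntegrable g MeasureTheory.volume 0 (2 * Real.pi)) :
    rrA u (fun θ => f θ + g θ) = rrA u f + rrA u g := by
  unfold rrA
  simp only [mul_add]
  rw [intervalIntegral.integral_add (rr_int_pk hu hf) (rr_int_pk hu hg), mul_add]

theorem rrA_mono {u : ℝ} (hu : 0 < u) {f g : ℝ → ℝ}
    (hf : IntervalIntegrable f MeasureTheory.volume 0 (2 * Real.pi))
    (hg : IntervalIntegrable g MeasureTheory.volume 0 (2 * Real.pi))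
    (h : ∀ᵐ θ, f θ ≤ g θ) : rrA u f ≤ rrA u g := by
  unfold rrA
  apply mul_le_mul_of_nonneg_left _ (by positivity)
  apply intervalIntegral.integral_mono_ae (by positivity) (rr_int_pk hu hf) (rr_int_pk hu hg)
  filter_upwards [h] with θ hθ
  exact mul_le_mul_of_nonneg_left hθ (rrPk_pos hu θ).le

theorem rrA_congr {u : ℝ} {f g : ℝ → ℝ} (h : ∀ᵐ θ, f θ = g θ) : rrA u f = rrA u g := by
  unfold rrA
  congr 1
  apply intervalIntegral.integral_congr_ae
  filter_upwards [h] with θ hθ _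
  rw [hθ]

theorem rr_ae_circle (c : ℂ) : ∀ᵐ θ : ℝ, circleMap 0 1 θ ≠ c := by
  have := ((Set.countable_singleton c).preimage_circleMap 0 (one_ne_zero)).measure_zero
    MeasureTheory.volume
  filter_upwards [MeasureTheory.measure_eq_zero_iff_ae_notMem.mp this] with θ hθ
  simpa using hθ

theorem rr_circ_int (c : ℂ) : IntervalIntegrable (fun θ => Real.log ‖circleMap 0 1 θ - c‖)
    MeasureTheory.volume 0 (2 * Real.pi) := circleIntegrable_log_norm_sub_const (a := c) (c := 0) 1

theorem rr_split (a : ℝ) (ha : 0 < a) (b c₁ c₂ z : ℂ) (hz : z ≠ 0) (hs : c₁ + c₂ = 2 * b / a)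
    (hp : c₁ * c₂ = 1) : (a : ℂ) * ((z + z⁻¹) / 2) - b = (a / 2) * ((z - c₁) * (z - c₂)) * z⁻¹ := by
  have ha' : (a : ℂ) ≠ 0 := by exact_mod_cast ha.ne'
  have hb : b = a * (c₁ + c₂) / 2 := by rw [hs]; field_simp
  rw [hb]
  field_simp
  linear_combination (-1) * hp

theorem rr_avg_split {u : ℝ} (hu : 0 < u) (a : ℝ) (ha : 0 < a) (b c₁ c₂ : ℂ)
    (hs : c₁ + c₂ = 2 * b / a) (hp : c₁ * c₂ = 1) :
    rrA u (fun θ => Real.log ‖((a * Real.cos θ : ℝ) : ℂ) - b‖) =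
      Real.log (a / 2) + rrA u (fun θ => Real.log ‖circleMap 0 1 θ - c₁‖)
        + rrA u (fun θ => Real.log ‖circleMap 0 1 θ - c₂‖) := by
  have h : rrA u (fun θ => Real.log ‖((a * Real.cos θ : ℝ) : ℂ) - b‖) =
      rrA u (fun θ => (Real.log (a / 2) + Real.log ‖circleMap 0 1 θ - c₁‖)
        + Real.log ‖circleMap 0 1 θ - c₂‖) := by
    apply rrA_congr
    filter_upwards [rr_ae_circle c₁, rr_ae_circle c₂] with θ h1 h2
    have h0 : circleMap 0 1 θ ≠ 0 := circleMap_ne_center one_ne_zero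
    have hsp := rr_split a ha b c₁ c₂ (circleMap 0 1 θ) h0 hs hp
    have hcos : (circleMap 0 1 θ + (circleMap 0 1 θ)⁻¹) / 2 = ((Real.cos θ : ℝ) : ℂ) := by
      simp only [circleMap, Complex.ofReal_one, one_mul, zero_add, ← Complex.exp_neg]
      rw [Complex.ofReal_cos, Complex.cos]
      ring_nf
    rw [hcos] at hsp
    rw [Complex.ofReal_mul, hsp]
    simp only [norm_mul, norm_inv]
    have hn : ‖circleMap 0 1 θ‖ = 1 := by simp
    rw [hn, inv_one, mul_one]
    have ha2 : ‖(a : ℂ) / 2‖ = a / 2 := by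
      rw [norm_div, Complex.norm_real, Real.norm_eq_abs, abs_of_pos ha]; simp
    rw [ha2, Real.log_mul (by positivity), Real.log_mul, add_assoc]
    · rw [norm_ne_zero_iff, sub_ne_zero]; exact h1
    · rw [norm_ne_zero_iff, sub_ne_zero]; exact h2
    · apply mul_ne_zero
      · rw [norm_ne_zero_iff, sub_ne_zero]; exact h1
      · rw [norm_ne_zero_iff, sub_ne_zero]; exact h2
  rw [h, rrA_add hu (intervalIntegrable_const.add (rr_circ_int c₁)) (rr_circ_int c₂),
    rrA_add hu intervalIntegrable_const (rr_circ_int c₁), rrA_const hu]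

theorem rr_pt_split {u : ℝ} (a : ℝ) (ha : 0 < a) (b c₁ c₂ : ℂ)
    (hs : c₁ + c₂ = 2 * b / a) (hp : c₁ * c₂ = 1)
    (hb : ((a * Real.cosh u : ℝ) : ℂ) ≠ b) :
    ((Real.exp (-u) : ℝ) : ℂ) ≠ c₁ ∧ ((Real.exp (-u) : ℝ) : ℂ) ≠ c₂ ∧
    Real.log ‖((a * Real.cosh u : ℝ) : ℂ) - b‖ =
      u + (Real.log (a / 2) + Real.log ‖((Real.exp (-u) : ℝ) : ℂ) - c₁‖
        + Real.log ‖((Real.exp (-u) : ℝ) : ℂ) - c₂‖) := by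
  have h0 : ((Real.exp (-u) : ℝ) : ℂ) ≠ 0 := by exact_mod_cast (Real.exp_pos _).ne'
  have hsp := rr_split a ha b c₁ c₂ _ h0 hs hp
  have hc : (((Real.exp (-u) : ℝ) : ℂ) + ((Real.exp (-u) : ℝ) : ℂ)⁻¹) / 2
      = ((Real.cosh u : ℝ) : ℂ) := by
    rw [Real.cosh_eq, Real.exp_neg]
    push_cast
    rw [inv_inv]; ring
  rw [hc, ← Complex.ofReal_mul] at hsp
  have hne : ((a * Real.cosh u : ℝ) : ℂ) - b ≠ 0 := sub_ne_zero.2 hb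
  have h1 : ((Real.exp (-u) : ℝ) : ℂ) ≠ c₁ := by
    intro h; apply hne; rw [hsp, h]; simp
  have h2 : ((Real.exp (-u) : ℝ) : ℂ) ≠ c₂ := by
    intro h; apply hne; rw [hsp, h]; simp
  refine ⟨h1, h2, ?_⟩
  have h1' : ‖((Real.exp (-u) : ℝ) : ℂ) - c₁‖ ≠ 0 := by
    rw [norm_ne_zero_iff, sub_ne_zero]; exact h1
  have h2' : ‖((Real.exp (-u) : ℝ) : ℂ) - c₂‖ ≠ 0 := by
    rw [norm_ne_zero_iff, sub_ne_zero]; exact h2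
  rw [hsp]
  simp only [norm_mul, norm_inv]
  have ha2 : ‖(a : ℂ) / 2‖ = a / 2 := by
    rw [norm_div, Complex.norm_real, Real.norm_eq_abs, abs_of_pos ha]; simp
  have hn : ‖((Real.exp (-u) : ℝ) : ℂ)‖ = Real.exp (-u) := by
    rw [Complex.norm_real, Real.norm_eq_abs, abs_of_pos (Real.exp_pos _)]
  rw [ha2, hn, Real.log_mul (by positivity) (by positivity), Real.log_mul (by positivity)
    (by positivity), Real.log_mul h1' h2', Real.log_inv, Real.log_exp]
  ring

theorem rr_linear_le {u : ℝ} (hu : 0 < u) (a : ℝ) (ha : 0 < a) (b : ℂ)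
    (hb : ((a * Real.cosh u : ℝ) : ℂ) ≠ b) :
    Real.log ‖((a * Real.cosh u : ℝ) : ℂ) - b‖ ≤
      u + rrA u (fun θ => Real.log ‖((a * Real.cos θ : ℝ) : ℂ) - b‖) := by
  obtain ⟨s, hs⟩ := IsAlgClosed.exists_pow_nat_eq ((b / a) ^ 2 - 1) (n := 2) (by norm_num)
  have h1 : (b / a + s) + (b / a - s) = 2 * b / a := by ring
  have h2 : (b / a + s) * (b / a - s) = 1 := by linear_combination (-1) * hs
  obtain ⟨n1, n2, h3⟩ := rr_pt_split a ha b _ _ h1 h2 hb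
  rw [h3, rr_avg_split hu a ha b _ _ h1 h2]
  have := rr_factor_le hu _ n1
  have := rr_factor_le hu _ n2
  linarith

theorem rr_log_eq {u : ℝ} (hu : 0 < u) (a : ℝ) (ha : 0 < a) :
    Real.log (a * Real.cosh u) = u + rrA u (fun θ => Real.log (a * Real.cos θ)) := by
  have h1 : Complex.I + (-Complex.I) = 2 * (0:ℂ) / a := by simp
  have h2 : Complex.I * (-Complex.I) = 1 := by simp
  have hx : 0 < a * Real.cosh u := mul_pos ha (Real.cosh_pos u)
  have hb : ((a * Real.cosh u : ℝ) : ℂ) ≠ 0 := by exact_mod_cast hx.ne'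
  obtain ⟨n1, n2, h3⟩ := rr_pt_split a ha 0 _ _ h1 h2 hb
  have h4 := rr_avg_split hu a ha 0 _ _ h1 h2
  rw [rr_factor_eq hu _ (by simp), rr_factor_eq hu _ (by simp)] at h4
  rw [← h4] at h3
  simpa only [sub_zero, Complex.norm_real, Real.norm_eq_abs, Real.log_abs] using h3

theorem rr_multiset {u : ℝ} (hu : 0 < u) (a : ℝ) (ha : 0 < a) (s : Multiset ℂ)
    (hs : ((a * Real.cosh u : ℝ) : ℂ) ∉ s) :
    IntervalIntegrable (fun θ => (s.map (fun b => Real.log ‖((a * Real.cos θ : ℝ) : ℂ) - b‖)).sum)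
      MeasureTheory.volume 0 (2 * Real.pi) ∧
    (s.map (fun b => Real.log ‖((a * Real.cosh u : ℝ) : ℂ) - b‖)).sum ≤ s.card * u +
      rrA u (fun θ => (s.map (fun b => Real.log ‖((a * Real.cos θ : ℝ) : ℂ) - b‖)).sum) := by
  induction s using Multiset.induction_on with
  | empty => simp [rrA]
  | cons b s ih =>
    simp only [Multiset.mem_cons, not_or] at hs
    obtain ⟨i1, i2⟩ := ih hs.2
    simp only [Multiset.map_cons, Multiset.sum_cons, Multiset.card_cons]
    refine ⟨(rr_int_logfactor a b _ _).add i1, ?_⟩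
    rw [rrA_add hu (rr_int_logfactor a b _ _) i1]
    have := rr_linear_le hu a ha b hs.1
    rw [Nat.cast_add, Nat.cast_one]
    linarith

theorem rr_poly_log (p : Polynomial ℝ) (y : ℝ) (hy : p.eval y ≠ 0) :
    Real.log |p.eval y| = Real.log |p.leadingCoeff| +
      ((p.map Complex.ofRealHom).roots.map (fun b => Real.log ‖(y : ℂ) - b‖)).sum := by
  set P := p.map Complex.ofRealHom with hP
  have hev : P.eval (y : ℂ) = ((p.eval y : ℝ) : ℂ) := by
    rw [hP]; exact Polynomial.eval_map_apply (f := Complex.ofRealHom) ..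
  have hsplit : P.eval (y : ℂ) = P.leadingCoeff * (P.roots.map (fun b => (y : ℂ) - b)).prod :=
    (IsAlgClosed.splits P).eval_eq_prod_roots _
  have hn : |p.eval y| = |p.leadingCoeff| * (P.roots.map (fun b => ‖(y : ℂ) - b‖)).prod := by
    have h := congrArg norm hsplit
    rw [hev, Complex.norm_real, Real.norm_eq_abs, norm_mul, hP, Polynomial.leadingCoeff_map] at h
    rw [h]
    congr 1
    · simp
    · rw [← hP]
      have := Multiset.prod_hom (P.roots.map (fun b => (y : ℂ) - b)) (normHom (α := ℂ))
      simp only [Multiset.map_map] at this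
      exact this.symm
  have hne : |p.eval y| ≠ 0 := abs_ne_zero.2 hy
  rw [hn] at hne ⊢
  have hr := right_ne_zero_of_mul hne
  rw [Real.log_mul (left_ne_zero_of_mul hne) hr]
  congr 1
  clear hn hne hsplit hev
  generalize P.roots = s at hr
  induction s using Multiset.induction_on with
  | empty => simp
  | cons b s ih =>
    simp only [Multiset.map_cons, Multiset.prod_cons, Multiset.sum_cons] at hr ⊢
    rw [Real.log_mul (left_ne_zero_of_mul hr) (right_ne_zero_of_mul hr),
      ih (right_ne_zero_of_mul hr)]

theorem rr_ae_cos (y : ℝ) : ∀ᵐ θ : ℝ, Real.cos θ ≠ y := by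
  have hc : {θ : ℝ | Real.cos θ = y}.Countable := by
    have : {θ : ℝ | Real.cos θ = y} ⊆ circleMap 0 1 ⁻¹' {z | z.re = y ∧ ‖z‖ = 1} := by
      intro θ hθ
      simpa [circleMap, Complex.exp_ofReal_mul_I_re] using hθ
    refine Set.Countable.mono this (Set.Countable.preimage_circleMap ?_ 0 one_ne_zero)
    have h2 : {z : ℂ | z.re = y ∧ ‖z‖ = 1} ⊆
        {(⟨y, √(1 - y ^ 2)⟩ : ℂ), (⟨y, -√(1 - y ^ 2)⟩ : ℂ)} := by
      rintro z ⟨h1, h2⟩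
      have h3 : z.re ^ 2 + z.im ^ 2 = 1 := by
        have := Complex.normSq_eq_norm_sq z
        rw [h2, Complex.normSq_apply] at this
        linarith
      have h4 : √(1 - y ^ 2) = |z.im| := by
        rw [← Real.sqrt_sq_eq_abs]; congr 1; rw [← h1]; linarith
      rw [h4]
      simp only [Set.mem_insert_iff, Set.mem_singleton_iff, Complex.ext_iff]
      rcases abs_cases z.im with ⟨h, _⟩ | ⟨h, _⟩
      · left; exact ⟨h1, h.symm⟩
      · right; exact ⟨h1, by simp [h]⟩
    exact (Set.toFinite _).countable.mono h2
  filter_upwards [MeasureTheory.measure_eq_zero_iff_ae_notMem.mp (hc.measure_zero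
    MeasureTheory.volume)] with θ hθ
  exact hθ

theorem rr_poly_le {u : ℝ} (hu : 0 < u) (a : ℝ) (ha : 0 < a) (p : Polynomial ℝ) (n : ℕ)
    (hp : p.degree ≤ n) (hx : p.eval (a * Real.cosh u) ≠ 0) (f : ℝ → ℝ)
    (hf : IntervalIntegrable f MeasureTheory.volume 0 (2 * Real.pi))
    (hpf : ∀ θ, Real.cos θ ≠ 0 → p.eval (a * Real.cos θ) ≠ 0 →
      Real.log |p.eval (a * Real.cos θ)| ≤ f θ) :
    Real.log |p.eval (a * Real.cosh u)| ≤ n * u + rrA u f := by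
  have hp0 : p ≠ 0 := by rintro rfl; simp at hx
  set P := p.map Complex.ofRealHom with hP
  have hnot : ((a * Real.cosh u : ℝ) : ℂ) ∉ P.roots := by
    intro h
    have := Polynomial.isRoot_of_mem_roots h
    rw [Polynomial.IsRoot, hP] at this
    have h2 : (p.map Complex.ofRealHom).eval ((a * Real.cosh u : ℝ) : ℂ)
      = ((p.eval (a * Real.cosh u) : ℝ) : ℂ) :=
      Polynomial.eval_map_apply (f := Complex.ofRealHom) ..
    rw [h2] at this
    exact hx (by exact_mod_cast this)
  obtain ⟨i1, i2⟩ := rr_multiset hu a ha P.roots hnot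
  rw [rr_poly_log p _ hx]
  have hcard : (P.roots.card : ℝ) ≤ n := by
    have h1 := Polynomial.card_roots' P
    have h2 : P.natDegree ≤ n := by
      rw [hP]
      exact Polynomial.natDegree_map_le.trans (Polynomial.natDegree_le_of_degree_le hp)
    exact_mod_cast h1.trans h2
  have hm : rrA u (fun θ => Real.log |p.leadingCoeff| +
      (P.roots.map (fun b => Real.log ‖((a * Real.cos θ : ℝ) : ℂ) - b‖)).sum) ≤ rrA u f := by
    apply rrA_mono hu (intervalIntegrable_const.add i1) hf
    have hroots : ∀ᵐ θ : ℝ, p.eval (a * Real.cos θ) ≠ 0 := by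
      have : ∀ᵐ θ : ℝ, ∀ y ∈ p.roots.toFinset, Real.cos θ ≠ y / a := by
        rw [Filter.eventually_all_finset]
        intro y _
        exact rr_ae_cos _
      filter_upwards [this] with θ hθ h0
      refine hθ (a * Real.cos θ) ?_ ?_
      · simp [hp0, h0]
      · field_simp
    filter_upwards [hroots, rr_ae_cos 0] with θ h1 h2
    rw [← rr_poly_log p _ h1]
    exact hpf θ h2 h1
  rw [rrA_add hu intervalIntegrable_const i1, rrA_const hu] at hm
  have := mul_le_mul_of_nonneg_right hcard hu.le
  linarith

theorem rr_symm (F : ℝ → ℝ) (hF : ∀ s t, IntervalIntegrable F MeasureTheory.volume s t)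
    (h2 : ∀ θ, F (2 * Real.pi - θ) = F θ) :
    ∫ θ in (0:ℝ)..(2 * Real.pi), F θ =
      2 * ∫ θ in (0:ℝ)..(Real.pi / 2), (F θ + F (Real.pi - θ)) := by
  have e1 : ∫ θ in Real.pi..(2 * Real.pi), F θ = ∫ θ in (0:ℝ)..Real.pi, F θ := by
    have := intervalIntegral.integral_comp_sub_left (a := 0) (b := Real.pi) F (2 * Real.pi)
    rw [show 2 * Real.pi - Real.pi = Real.pi by ring, sub_zero] at this
    rw [← this]
    simp only [h2]
  have e2 : ∫ θ in (Real.pi / 2)..Real.pi, F θ = ∫ θ in (0:ℝ)..(Real.pi / 2), F (Real.pi - θ) := by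
    have := intervalIntegral.integral_comp_sub_left (a := 0) (b := Real.pi / 2) F Real.pi
    rw [show Real.pi - Real.pi / 2 = Real.pi / 2 by ring, sub_zero] at this
    exact this.symm
  have hF' : IntervalIntegrable (fun θ => F (Real.pi - θ)) MeasureTheory.volume 0
      (Real.pi / 2) := by
    have := (hF (Real.pi - 0) (Real.pi - Real.pi / 2)).comp_sub_left Real.pi
    simpa using this
  rw [← intervalIntegral.integral_add_adjacent_intervals (hF 0 Real.pi) (hF Real.pi _), e1,
    ← intervalIntegral.integral_add_adjacent_intervals (hF 0 (Real.pi / 2)) (hF _ Real.pi), e2,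
    intervalIntegral.integral_add (hF _ _) hF']
  ring

/-- Symmetrised kernel. -/
noncomputable def rrK (u θ : ℝ) : ℝ :=
  Real.sinh u * Real.cosh u / (Real.cosh u ^ 2 - Real.cos θ ^ 2)

theorem rr_den2_pos {u : ℝ} (hu : 0 < u) (θ : ℝ) : 0 < Real.cosh u ^ 2 - Real.cos θ ^ 2 := by
  have := Real.one_lt_cosh.2 hu.ne'
  have := Real.cos_sq_le_one θ
  nlinarith

theorem rrK_cont {u : ℝ} (hu : 0 < u) : Continuous (rrK u) := by
  unfold rrK
  exact continuous_const.div (by fun_prop) (fun θ => (rr_den2_pos hu θ).ne')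

theorem rr_fold {u : ℝ} (hu : 0 < u) (G : ℝ → ℝ) (hG : ∀ x, G (-x) = G x)
    (hI : ∀ s t, IntervalIntegrable (fun θ => G (Real.cos θ)) MeasureTheory.volume s t) :
    rrA u (fun θ => G (Real.cos θ)) =
      (2 / Real.pi) * ∫ θ in (0:ℝ)..(Real.pi / 2), rrK u θ * G (Real.cos θ) := by
  unfold rrA
  rw [rr_symm (fun θ => rrPk u θ * G (Real.cos θ)) (fun s t => rr_int_pk hu (hI s t))]
  · have : ∀ θ, rrPk u θ * G (Real.cos θ) + rrPk u (Real.pi - θ) * G (Real.cos (Real.pi - θ))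
        = 2 * (rrK u θ * G (Real.cos θ)) := by
      intro θ
      rw [Real.cos_pi_sub, hG, ← add_mul, ← mul_assoc]
      congr 1
      unfold rrPk rrK
      rw [Real.cos_pi_sub]
      have h1 := (rr_den_pos hu θ).ne'
      have h2 := (rr_den_pos hu (Real.pi - θ)).ne'
      have h3 := (rr_den2_pos hu θ).ne'
      rw [Real.cos_pi_sub] at h2
      rw [div_add_div _ _ h1 h2, ← mul_div_assoc, div_eq_div_iff (mul_ne_zero h1 h2) h3]
      ring
    simp only [this, intervalIntegral.integral_const_mul]
    field_simp
  · intro θ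
    simp [rrPk, Real.cos_two_pi_sub]

theorem rr_mrs (h : ℝ → ℝ) :
    ∫ t in (0:ℝ)..1, h t / Real.sqrt (1 - t ^ 2) =
      ∫ θ in (0:ℝ)..(Real.pi / 2), h (Real.cos θ) := by
  have hpi := Real.pi_pos
  rw [intervalIntegral.integral_of_le zero_le_one, intervalIntegral.integral_of_le (by positivity),
    MeasureTheory.integral_Ioc_eq_integral_Ioo, MeasureTheory.integral_Ioc_eq_integral_Ioo]
  have himg : Real.cos '' Set.Ioo 0 (Real.pi / 2) = Set.Ioo 0 1 := by
    ext t
    constructor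
    · rintro ⟨θ, hθ, rfl⟩
      refine ⟨Real.cos_pos_of_mem_Ioo ⟨by linarith [hθ.1], hθ.2⟩, ?_⟩
      rw [← Real.cos_zero]
      exact Real.cos_lt_cos_of_nonneg_of_le_pi_div_two le_rfl hθ.2.le hθ.1
    · intro ht
      exact ⟨Real.arccos t, ⟨Real.arccos_pos.2 ht.2, Real.arccos_lt_pi_div_two.2 ht.1⟩,
        Real.cos_arccos (by linarith [ht.1]) ht.2.le⟩
  rw [← himg, MeasureTheory.integral_image_eq_integral_abs_deriv_smul measurableSet_Ioo
    (f' := fun θ => -Real.sin θ)]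
  · apply MeasureTheory.setIntegral_congr_fun measurableSet_Ioo
    intro θ hθ
    have hs : 0 < Real.sin θ := Real.sin_pos_of_pos_of_lt_pi hθ.1 (by linarith [hθ.2])
    have : 1 - Real.cos θ ^ 2 = Real.sin θ ^ 2 := by linarith [Real.sin_sq_add_cos_sq θ]
    simp only [this, Real.sqrt_sq hs.le, abs_neg, abs_of_pos hs, smul_eq_mul]
    field_simp
  · intro θ _
    exact (Real.hasDerivAt_cos θ).hasDerivWithinAt
  · apply Real.injOn_cos.mono
    intro θ hθ
    exact ⟨hθ.1.le, by linarith [hθ.2]⟩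

open Filter Topology in
theorem rr_ibp {u : ℝ} (hu : 0 < u) (a k B : ℝ) (ha : 0 < a) (ψ q Φ : ℝ → ℝ) (hk : 0 ≤ k)
    (hψ : ∀ x, 0 < x → HasDerivAt ψ ((q x - k) / x) x)
    (hq : ContinuousOn q (Set.Ioi 0))
    (hq0 : ∀ x, 0 < x → 0 ≤ q x) (hqk : ∀ x, 0 < x → x ≤ a → q x ≤ k)
    (hlow : ∀ x, 0 < x → x ≤ a → ψ a ≤ ψ x)
    (hup : ∀ x, 0 < x → x ≤ a → ψ x ≤ Φ a - k * Real.log x)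
    (hB : ψ a ≤ B)
    (hI : ∀ s t, IntervalIntegrable (fun θ => ψ (a * Real.cos θ)) MeasureTheory.volume s t) :
    u * ((∫ θ in (0:ℝ)..(Real.pi / 2), q (a * Real.cos θ)) - k * (Real.pi / 2)) ≤
      ∫ θ in (0:ℝ)..(Real.pi / 2), rrK u θ * (B - ψ (a * Real.cos θ)) := by
  have hpi := Real.pi_pos
  set τ := Real.sinh u / Real.cosh u with hτ
  have hS : 0 < Real.sinh u := Real.sinh_pos_iff.2 hu
  have hC : 0 < Real.cosh u := Real.cosh_pos u
  have hτ0 : 0 < τ := div_pos hS hC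
  have hτu : τ ≤ u := by rw [hτ, div_le_iff₀ hC]; exact rr_tanh_le u hu.le
  set W : ℝ → ℝ := fun θ => Real.arctan (τ * (Real.cos θ / Real.sin θ)) with hW
  set g : ℝ → ℝ := fun θ => B - ψ (a * Real.cos θ) with hg
  set E : ℝ → ℝ := fun θ => (k - q (a * Real.cos θ)) * (Real.sin θ / Real.cos θ) * W θ with hE
  have hcos : ∀ θ ∈ Set.Ioo 0 (Real.pi / 2), 0 < Real.cos θ := fun θ hθ =>
    Real.cos_pos_of_mem_Ioo ⟨by linarith [hθ.1], hθ.2⟩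
  have hsin : ∀ θ ∈ Set.Ioo 0 (Real.pi / 2), 0 < Real.sin θ := fun θ hθ =>
    Real.sin_pos_of_pos_of_lt_pi hθ.1 (by linarith [hθ.2])
  have hac : ∀ θ ∈ Set.Ioo 0 (Real.pi / 2), 0 < a * Real.cos θ ∧ a * Real.cos θ ≤ a :=
    fun θ hθ => ⟨mul_pos ha (hcos θ hθ), by nlinarith [Real.cos_le_one θ]⟩
  have hWnn : ∀ θ ∈ Set.Ioo 0 (Real.pi / 2), 0 ≤ W θ := fun θ hθ => by
    have := hcos θ hθ
    have := hsin θ hθ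
    exact Real.arctan_nonneg.2 (by positivity)
  have hWle : ∀ θ ∈ Set.Ioo 0 (Real.pi / 2), W θ ≤ τ * (Real.cos θ / Real.sin θ) := fun θ hθ => by
    have := hcos θ hθ
    have := hsin θ hθ
    exact rr_arctan_le _ (by positivity)
  have htW : ∀ θ ∈ Set.Ioo 0 (Real.pi / 2), (Real.sin θ / Real.cos θ) * W θ ≤ τ := fun θ hθ => by
    have h1 := hcos θ hθ
    have h2 := hsin θ hθ
    calc (Real.sin θ / Real.cos θ) * W θ
        ≤ (Real.sin θ / Real.cos θ) * (τ * (Real.cos θ / Real.sin θ)) :=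
          mul_le_mul_of_nonneg_left (hWle θ hθ) (by positivity)
      _ = τ := by field_simp
  have htW0 : ∀ θ ∈ Set.Ioo 0 (Real.pi / 2), 0 ≤ (Real.sin θ / Real.cos θ) * W θ := fun θ hθ => by
    have h1 := hcos θ hθ
    have h2 := hsin θ hθ
    exact mul_nonneg (by positivity) (hWnn θ hθ)
  have hqc : ContinuousOn (fun θ => q (a * Real.cos θ)) (Set.Ioo 0 (Real.pi / 2)) :=
    hq.comp (by fun_prop) (fun θ hθ => (hac θ hθ).1)
  have hWc : ContinuousOn W (Set.Ioo 0 (Real.pi / 2)) := by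
    apply Real.continuous_arctan.comp_continuousOn
    exact continuousOn_const.mul (Real.continuous_cos.continuousOn.div
      Real.continuous_sin.continuousOn (fun θ hθ => (hsin θ hθ).ne'))
  have hEc : ContinuousOn E (Set.Ioo 0 (Real.pi / 2)) :=
    ((continuousOn_const.sub hqc).mul (Real.continuous_sin.continuousOn.div
      Real.continuous_cos.continuousOn (fun θ hθ => (hcos θ hθ).ne'))).mul hWc
  have hint : ∀ f : ℝ → ℝ, ContinuousOn f (Set.Ioo 0 (Real.pi / 2)) → ∀ c,
      (∀ θ ∈ Set.Ioo 0 (Real.pi / 2), |f θ| ≤ c) →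
      IntervalIntegrable f MeasureTheory.volume 0 (Real.pi / 2) := by
    intro f hf c hc
    rw [intervalIntegrable_iff_integrableOn_Ioo_of_le (by positivity)]
    refine MeasureTheory.IntegrableOn.of_bound (by simp)
      (hf.aestronglyMeasurable measurableSet_Ioo) c ?_
    filter_upwards [MeasureTheory.ae_restrict_mem measurableSet_Ioo] with θ hθ
    exact hc θ hθ
  have hqI : IntervalIntegrable (fun θ => q (a * Real.cos θ)) MeasureTheory.volume 0
      (Real.pi / 2) := by
    apply hint _ hqc k
    intro θ hθ
    rw [abs_of_nonneg (hq0 _ (hac θ hθ).1)]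
    exact hqk _ (hac θ hθ).1 (hac θ hθ).2
  have hEb : ∀ θ ∈ Set.Ioo 0 (Real.pi / 2), 0 ≤ E θ ∧ E θ ≤ u * (k - q (a * Real.cos θ)) := by
    intro θ hθ
    have h1 := hqk _ (hac θ hθ).1 (hac θ hθ).2
    have h2 := htW θ hθ
    have h3 := htW0 θ hθ
    have h4 : E θ = (k - q (a * Real.cos θ)) * ((Real.sin θ / Real.cos θ) * W θ) := by
      simp only [hE]; ring
    rw [h4]
    exact ⟨mul_nonneg (by linarith) h3, by nlinarith⟩
  have hEI : IntervalIntegrable E MeasureTheory.volume 0 (Real.pi / 2) := by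
    apply hint _ hEc (u * k)
    intro θ hθ
    rw [abs_of_nonneg (hEb θ hθ).1]
    have := hq0 _ (hac θ hθ).1
    have := (hEb θ hθ).2
    nlinarith
  have hgI : IntervalIntegrable (fun θ => rrK u θ * g θ) MeasureTheory.volume 0 (Real.pi / 2) :=
    (intervalIntegrable_const.sub (hI _ _)).continuousOn_mul (rrK_cont hu).continuousOn
  -- the derivative
  have hder : ∀ θ ∈ Set.Ioo 0 (Real.pi / 2),
      HasDerivAt (fun θ => -(g θ * W θ)) (rrK u θ * g θ + E θ) θ := by
    intro θ hθ
    have h1 := hcos θ hθ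
    have h2 := hsin θ hθ
    have d1 : HasDerivAt g (-((q (a * Real.cos θ) - k) / (a * Real.cos θ) *
        (a * (-Real.sin θ)))) θ :=
      ((hψ _ (hac θ hθ).1).comp θ ((Real.hasDerivAt_cos θ).const_mul a)).const_sub B
    have d2 := (((Real.hasDerivAt_cos θ).div (Real.hasDerivAt_sin θ) h2.ne').const_mul τ).arctan
    have d3 := (d1.mul d2).neg
    refine d3.congr_deriv ?_
    have hKK : 1 / (1 + (τ * (Real.cos θ / Real.sin θ)) ^ 2) *
        (τ * ((-Real.sin θ * Real.sin θ - Real.cos θ * Real.cos θ) / Real.sin θ ^ 2))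
        = - rrK u θ := by
      have hcs : Real.cos θ ^ 2 = 1 - Real.sin θ ^ 2 := by linarith [Real.sin_sq_add_cos_sq θ]
      have hch : Real.cosh u ^ 2 = Real.sinh u ^ 2 + 1 := by linarith [Real.cosh_sq u]
      have hd := rr_den2_pos hu θ
      have n1 : -Real.sin θ * Real.sin θ - Real.cos θ * Real.cos θ = -1 := by
        linarith [Real.sin_sq_add_cos_sq θ]
      have n2 : 1 + (τ * (Real.cos θ / Real.sin θ)) ^ 2
          = (Real.cosh u ^ 2 - Real.cos θ ^ 2) / (Real.cosh u ^ 2 * Real.sin θ ^ 2) := by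
        rw [hτ]
        field_simp
        rw [hch, hcs]; ring
      rw [n1, n2, rrK, hτ]
      field_simp
    simp only [Pi.div_apply]
    rw [hKK]
    simp only [hE, hg, hW]
    field_simp
    ring
  have hlim0 : Tendsto (fun θ => -(g θ * W θ)) (𝓝[>] 0) (𝓝 (-((B - ψ a) * (Real.pi / 2)))) := by
    apply Tendsto.neg
    apply Tendsto.mul
    · have : ContinuousAt g 0 := by
        have h1 : ContinuousAt ψ (a * Real.cos 0) := by
          simpa using (hψ a ha).continuousAt
        have h2 : ContinuousAt (fun θ => ψ (a * Real.cos θ)) 0 :=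
          ContinuousAt.comp (f := fun θ => a * Real.cos θ) h1 (by fun_prop)
        exact continuousAt_const.sub h2
      have h3 := this.tendsto.mono_left (nhdsWithin_le_nhds (s := Set.Ioi 0))
      simpa [hg] using h3
    · have h1 : Tendsto Real.sin (𝓝[>] 0) (𝓝[>] 0) := by
        apply tendsto_nhdsWithin_of_tendsto_nhds_of_eventually_within
        · have := Real.continuous_sin.tendsto 0
          rw [Real.sin_zero] at this
          exact this.mono_left nhdsWithin_le_nhds
        · filter_upwards [Ioo_mem_nhdsGT (show (0:ℝ) < Real.pi / 2 by positivity)] with θ hθ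
          exact hsin θ hθ
      have h2 : Tendsto Real.cos (𝓝[>] 0) (𝓝 1) := by
        have := Real.continuous_cos.tendsto 0
        rw [Real.cos_zero] at this
        exact this.mono_left nhdsWithin_le_nhds
      have h3 : Tendsto (fun θ => τ * (Real.cos θ / Real.sin θ)) (𝓝[>] 0) atTop := by
        simp only [div_eq_mul_inv]
        exact (h2.pos_mul_atTop one_pos (tendsto_inv_nhdsGT_zero.comp h1)).const_mul_atTop hτ0
      exact (Real.tendsto_arctan_atTop.mono_right nhdsWithin_le_nhds).comp h3
  have hlim1 : Tendsto (fun θ => -(g θ * W θ)) (𝓝[<] (Real.pi / 2)) (𝓝 0) := by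
    set c0 := |B - Φ a| + |B - ψ a| with hc0
    set b : ℝ → ℝ := fun θ => (c0 * Real.cos θ + k / a *
      |(a * Real.cos θ) * Real.log (a * Real.cos θ)|) * (τ / Real.sin θ) with hb
    have hbc : ContinuousAt b (Real.pi / 2) := by
      have h1 : Continuous (fun θ => (a * Real.cos θ) * Real.log (a * Real.cos θ)) :=
        Real.continuous_mul_log.comp (f := fun θ => a * Real.cos θ) (by fun_prop)
      apply ContinuousAt.mul
      · fun_prop
      · exact continuousAt_const.div (by fun_prop) (by simp)
    have hb0 : b (Real.pi / 2) = 0 := by simp [hb]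
    have hbt : Tendsto b (𝓝[<] (Real.pi / 2)) (𝓝 0) := by
      have := hbc.tendsto
      rw [hb0] at this
      exact this.mono_left nhdsWithin_le_nhds
    apply squeeze_zero_norm' _ hbt
    filter_upwards [Ioo_mem_nhdsLT (show (0:ℝ) < Real.pi / 2 by positivity)] with θ hθ
    have h1 := hcos θ hθ
    have h2 := hsin θ hθ
    have h3 := hac θ hθ
    have hgb : |g θ| ≤ c0 + k * |Real.log (a * Real.cos θ)| := by
      have u1 := hlow _ h3.1 h3.2
      have u2 := hup _ h3.1 h3.2
      have a1 := neg_abs_le (B - Φ a)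
      have a2 := le_abs_self (B - ψ a)
      have a3 := abs_nonneg (B - Φ a)
      have a4 := abs_nonneg (B - ψ a)
      have a5 := mul_le_mul_of_nonneg_left (neg_abs_le (Real.log (a * Real.cos θ))) hk
      have a6 := mul_nonneg hk (abs_nonneg (Real.log (a * Real.cos θ)))
      rw [abs_le]
      simp only [hg, hc0]
      constructor <;> linarith
    rw [norm_neg, norm_mul, Real.norm_eq_abs, Real.norm_eq_abs, abs_of_nonneg (hWnn θ hθ)]
    calc |g θ| * W θ ≤ (c0 + k * |Real.log (a * Real.cos θ)|) * (τ * (Real.cos θ / Real.sin θ)) :=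
          mul_le_mul hgb (hWle θ hθ) (hWnn θ hθ) ((abs_nonneg _).trans hgb)
      _ = b θ := by
          simp only [hb]
          rw [abs_mul, abs_of_pos h3.1]
          field_simp
  have hFTC := intervalIntegral.integral_eq_sub_of_hasDerivAt_of_tendsto (by positivity) hder
    (hgI.add hEI) hlim0 hlim1
  have hkq : IntervalIntegrable (fun θ => u * (k - q (a * Real.cos θ))) MeasureTheory.volume 0
      (Real.pi / 2) := (intervalIntegrable_const.sub hqI).const_mul u
  have hmono : ∫ θ in (0:ℝ)..(Real.pi / 2), (rrK u θ * g θ + E θ) ≤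
      ∫ θ in (0:ℝ)..(Real.pi / 2), (rrK u θ * g θ + u * (k - q (a * Real.cos θ))) := by
    apply intervalIntegral.integral_mono_on_of_le_Ioo (by positivity) (hgI.add hEI) (hgI.add hkq)
    intro θ hθ
    have := (hEb θ hθ).2
    linarith
  rw [hFTC, intervalIntegral.integral_add hgI hkq, intervalIntegral.integral_const_mul,
    intervalIntegral.integral_sub intervalIntegrable_const hqI,
    intervalIntegral.integral_const] at hmono
  have hpos : 0 ≤ (B - ψ a) * (Real.pi / 2) := mul_nonneg (by linarith) (by positivity)
  simp only [sub_zero, smul_eq_mul] at hmono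
  linarith

theorem rr_main (Φ Φ' : ℝ → ℝ)
    (heven : ∀ x, Φ (-x) = Φ x)
    (hderiv : ∀ x ∈ Set.Ioi (0:ℝ), HasDerivAt Φ (Φ' x) x)
    (hcont : ContinuousOn Φ' (Set.Ioi 0))
    (hpos : ∀ x ∈ Set.Ioi (0:ℝ), 0 < x * Φ' x)
    (hmono : StrictMonoOn (fun x => x * Φ' x) (Set.Ioi 0))
    (n : ℕ) (a : ℝ) (ha : 0 < a)
    (hmrs : (2/Real.pi) * ∫ t in (0:ℝ)..1,
        a * t * Φ' (a * t) / Real.sqrt (1 - t ^ 2) = n) {u : ℝ} (hu : 0 < u) :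
    IntervalIntegrable (fun θ => Φ (a * Real.cos θ)) MeasureTheory.volume 0 (2 * Real.pi) ∧
    n * u + rrA u (fun θ => Φ (a * Real.cos θ)) ≤ Φ (a * Real.cosh u) := by
  have hpi := Real.pi_pos
  set q : ℝ → ℝ := fun x => x * Φ' x with hq
  set k := q a with hk
  set ψ : ℝ → ℝ := fun x => Φ x - k * Real.log x with hψ
  have hkpos : 0 < k := hpos a ha
  have hψd : ∀ x, 0 < x → HasDerivAt ψ ((q x - k) / x) x := by
    intro x hx
    refine ((hderiv x hx).sub ((Real.hasDerivAt_log hx.ne').const_mul k)).congr_deriv ?_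
    simp only [hq]
    field_simp
  have hqk : ∀ x, 0 < x → x ≤ a → q x ≤ k := fun x hx hxa =>
    hmono.monotoneOn hx ha hxa
  have hanti : AntitoneOn ψ (Set.Ioc 0 a) := by
    apply antitoneOn_of_hasDerivWithinAt_nonpos (convex_Ioc 0 a) (f' := fun x => (q x - k) / x)
    · exact fun x hx => (hψd x hx.1).continuousAt.continuousWithinAt
    · intro x hx
      rw [interior_Ioc] at hx
      exact (hψd x hx.1).hasDerivWithinAt
    · intro x hx
      rw [interior_Ioc] at hx
      exact div_nonpos_of_nonpos_of_nonneg (by linarith [hqk x hx.1 hx.2.le]) hx.1.le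
  have hmon : MonotoneOn ψ (Set.Ici a) := by
    apply monotoneOn_of_hasDerivWithinAt_nonneg (convex_Ici a) (f' := fun x => (q x - k) / x)
    · exact fun x hx => (hψd x (ha.trans_le hx)).continuousAt.continuousWithinAt
    · intro x hx
      rw [interior_Ici] at hx
      exact (hψd x (ha.trans hx)).hasDerivWithinAt
    · intro x hx
      rw [interior_Ici] at hx
      have h0 : 0 < x := ha.trans hx
      have : k ≤ q x := hmono.monotoneOn ha h0 (le_of_lt hx)
      exact div_nonneg (by linarith) h0.le
  have hΦm : MonotoneOn Φ (Set.Ioi 0) := by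
    apply monotoneOn_of_hasDerivWithinAt_nonneg (convex_Ioi 0) (f' := Φ')
    · exact fun x hx => (hderiv x hx).continuousAt.continuousWithinAt
    · intro x hx
      rw [interior_Ioi] at hx
      exact (hderiv x hx).hasDerivWithinAt
    · intro x hx
      rw [interior_Ioi] at hx
      exact (pos_of_mul_pos_right (hpos x hx) (le_of_lt hx)).le
  have hlow : ∀ x, 0 < x → x ≤ a → ψ a ≤ ψ x := fun x hx hxa =>
    hanti ⟨hx, hxa⟩ ⟨ha, le_rfl⟩ hxa
  have hΦup : ∀ x, 0 < x → x ≤ a → Φ x ≤ Φ a := fun x hx hxa => hΦm hx ha hxa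
  have hup : ∀ x, 0 < x → x ≤ a → ψ x ≤ Φ a - k * Real.log x := by
    intro x hx hxa
    have := hΦup x hx hxa
    simp only [hψ]
    linarith
  -- measurability and integrability
  have hΦmeas : Measurable Φ := by
    apply measurable_of_continuousOn_compl_singleton 0
    intro x hx
    apply ContinuousAt.continuousWithinAt
    rcases lt_or_gt_of_ne (show x ≠ 0 from hx) with h | h
    · have h1 : ContinuousAt Φ (-x) := (hderiv (-x) (by simpa using h)).continuousAt
      have h2 : ContinuousAt (fun y => Φ (-y)) x :=
        ContinuousAt.comp (f := fun y : ℝ => -y) h1 (by fun_prop)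
      simpa only [heven] using h2
    · exact (hderiv x h).continuousAt
  have hlogI : ∀ s t, IntervalIntegrable (fun θ => Real.log (a * Real.cos θ))
      MeasureTheory.volume s t := by
    intro s t
    have := rr_int_logfactor a 0 s t
    simpa only [sub_zero, Complex.norm_real, Real.norm_eq_abs, Real.log_abs] using this
  have hΦI : ∀ s t, IntervalIntegrable (fun θ => Φ (a * Real.cos θ))
      MeasureTheory.volume s t := by
    intro s t
    have hb : IntervalIntegrable (fun θ => (|Φ a| + |ψ a|) + k * |Real.log (a * Real.cos θ)|)
        MeasureTheory.volume s t := intervalIntegrable_const.add ((hlogI s t).abs.const_mul k)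
    refine hb.mono_fun ((hΦmeas.comp (by fun_prop)).aestronglyMeasurable) ?_
    apply MeasureTheory.ae_restrict_of_ae
    filter_upwards [rr_ae_cos 0] with θ hθ
    have key : ∀ x, 0 < x → x ≤ a → |Φ x| ≤ (|Φ a| + |ψ a|) + k * |Real.log x| := by
      intro x hx hxa
      have h1 := hlow x hx hxa
      have h2 := hΦup x hx hxa
      have a1 := le_abs_self (Φ a)
      have a2 := neg_abs_le (ψ a)
      have a3 := mul_le_mul_of_nonneg_left (neg_abs_le (Real.log x)) hkpos.le
      have a4 := mul_nonneg hkpos.le (abs_nonneg (Real.log x))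
      have a5 := abs_nonneg (Φ a)
      have a6 := abs_nonneg (ψ a)
      have a7 : Φ x = ψ x + k * Real.log x := by simp only [hψ]; ring
      rw [abs_le]
      constructor <;> linarith
    have hk2 := key (a * |Real.cos θ|) (by positivity)
      (by nlinarith [Real.abs_cos_le_one θ])
    have e1 : Φ (a * |Real.cos θ|) = Φ (a * Real.cos θ) := by
      rcases abs_cases (Real.cos θ) with ⟨h, _⟩ | ⟨h, _⟩ <;> rw [h]
      rw [mul_neg, heven]
    have e2 : Real.log (a * |Real.cos θ|) = Real.log (a * Real.cos θ) := by
      rcases abs_cases (Real.cos θ) with ⟨h, _⟩ | ⟨h, _⟩ <;> rw [h]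
      rw [mul_neg, Real.log_neg_eq_log]
    rw [e1, e2] at hk2
    rw [Real.norm_eq_abs, Real.norm_eq_abs]
    exact hk2.trans (le_abs_self _)
  refine ⟨hΦI _ _, ?_⟩
  have hψI : ∀ s t, IntervalIntegrable (fun θ => ψ (a * Real.cos θ))
      MeasureTheory.volume s t := fun s t => (hΦI s t).sub ((hlogI s t).const_mul k)
  have hC1 : a ≤ a * Real.cosh u := by nlinarith [Real.one_le_cosh u]
  have hB : ψ a ≤ ψ (a * Real.cosh u) := hmon (Set.mem_Ici.2 le_rfl) hC1 hC1
  have hibp := rr_ibp hu a k (ψ (a * Real.cosh u)) ha ψ q Φ hkpos.le hψd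
    (continuousOn_id.mul hcont) (fun x hx => (hpos x hx).le) hqk hlow hup hB hψI
  have hm := rr_mrs (fun t => q (a * t))
  have hmrs' : (2 / Real.pi) * ∫ θ in (0:ℝ)..(Real.pi / 2), q (a * Real.cos θ) = n := by
    rw [← hm]; exact hmrs
  have hfold := rr_fold hu (fun y => ψ (a * Real.cosh u) - ψ (a * y)) (by
    intro x
    simp only [hψ, mul_neg, heven, Real.log_neg_eq_log])
    (fun s t => intervalIntegrable_const.sub (hψI s t))
  have hlog := rr_log_eq hu a ha
  have hkl : rrA u (fun θ => k * Real.log (a * Real.cos θ))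
      = k * rrA u (fun θ => Real.log (a * Real.cos θ)) := by
    unfold rrA
    simp only [mul_left_comm _ k, intervalIntegral.integral_const_mul]
  have e1 : rrA u (fun θ => Φ (a * Real.cos θ)) = rrA u (fun θ => ψ (a * Real.cos θ))
      + k * rrA u (fun θ => Real.log (a * Real.cos θ)) := by
    rw [← hkl, ← rrA_add hu (hψI _ _) ((hlogI _ _).const_mul k)]
    congr 1
    funext θ
    simp only [hψ]; ring
  have e2 : ψ (a * Real.cosh u) = rrA u (fun θ => ψ (a * Real.cosh u) - ψ (a * Real.cos θ))
      + rrA u (fun θ => ψ (a * Real.cos θ)) := by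
    rw [← rrA_add hu (intervalIntegrable_const.sub (hψI _ _)) (hψI _ _)]
    simp only [sub_add_cancel]
    rw [rrA_const hu]
  have e3 : Φ (a * Real.cosh u) = ψ (a * Real.cosh u) + k * Real.log (a * Real.cosh u) := by
    simp only [hψ]; ring
  have h4 := mul_le_mul_of_nonneg_left hibp (show 0 ≤ 2 / Real.pi by positivity)
  rw [← hfold] at h4
  have e5 : 2 / Real.pi * (u * ((∫ θ in (0:ℝ)..(Real.pi / 2), q (a * Real.cos θ))
      - k * (Real.pi / 2))) = n * u - k * u := by
    rw [← hmrs']; field_simp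
  rw [e5] at h4
  rw [e3, hlog, e1, mul_add]
  linarith

theorem rr_bound_pos (Φ Φ' : ℝ → ℝ)
    (heven : ∀ x, Φ (-x) = Φ x)
    (hderiv : ∀ x ∈ Set.Ioi (0:ℝ), HasDerivAt Φ (Φ' x) x)
    (hcont : ContinuousOn Φ' (Set.Ioi 0))
    (hpos : ∀ x ∈ Set.Ioi (0:ℝ), 0 < x * Φ' x)
    (hmono : StrictMonoOn (fun x => x * Φ' x) (Set.Ioi 0))
    (n : ℕ) (a : ℝ) (ha : 0 < a)
    (hmrs : (2/Real.pi) * ∫ t in (0:ℝ)..1,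
        a * t * Φ' (a * t) / Real.sqrt (1 - t ^ 2) = n)
    (p : Polynomial ℝ) (hp : p.degree ≤ n) (M : ℝ) (hM : 0 < M)
    (hb : ∀ y ∈ Set.Icc (-a) a, |p.eval y * Real.exp (-Φ y)| ≤ M) (x : ℝ) (hx : a < x) :
    |p.eval x * Real.exp (-Φ x)| ≤ M := by
  have h1x : 1 < x / a := by rw [one_lt_div ha]; exact hx
  have hxu : a * Real.cosh (Real.arcosh (x / a)) = x := by
    rw [Real.cosh_arcosh h1x.le]; field_simp
  have hu : 0 < Real.arcosh (x / a) := Real.arcosh_pos h1x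
  set u := Real.arcosh (x / a)
  by_cases h0 : p.eval x = 0
  · simp [h0, hM.le]
  obtain ⟨hI, hle⟩ := rr_main Φ Φ' heven hderiv hcont hpos hmono n a ha hmrs hu
  have h := rr_poly_le hu a ha p n hp (by rwa [hxu])
    (fun θ => Real.log M + Φ (a * Real.cos θ)) (intervalIntegrable_const.add hI) (by
      intro θ _ hθ
      have h1 := hb (a * Real.cos θ) ⟨by nlinarith [Real.neg_one_le_cos θ],
        by nlinarith [Real.cos_le_one θ]⟩
      rw [abs_mul, abs_of_pos (Real.exp_pos _)] at h1
      have h2 := Real.log_le_log (by positivity) h1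
      rw [Real.log_mul (by positivity) (by positivity), Real.log_exp] at h2
      linarith)
  rw [rrA_add hu intervalIntegrable_const hI, rrA_const hu, hxu] at h
  rw [hxu] at hle
  rw [abs_mul, abs_of_pos (Real.exp_pos _)]
  have h0' : 0 < |p.eval x| := abs_pos.2 h0
  rw [← Real.log_le_log_iff (by positivity) hM, Real.log_mul (by positivity) (by positivity),
    Real.log_exp]
  linarith

open Filter in
/-- **Restricted range (infinite–finite range) equality.**
Let `w = exp(−Φ)` where `Φ` is even, `Φ′` exists and is continuous on
`(0,∞)`, and `x ↦ x Φ′(x)` is positive and strictly increasing on `(0,∞)`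
with limits `0` at `0⁺` and `∞` at `∞`. For `n ≥ 1`, let `a > 0` solve the
Mhaskar–Rakhmanov–Saff equation `(2/π) ∫₀¹ a t Φ′(a t)/√(1 − t²) dt = n`.
Then for every real polynomial `p` of degree at most `n`,
`sup_{x ∈ ℝ} |p(x) w(x)| = sup_{x ∈ [−a,a]} |p(x) w(x)|`. -/
theorem restricted_range_equality (Φ Φ' : ℝ → ℝ)
    (heven : ∀ x, Φ (-x) = Φ x)
    (hderiv : ∀ x ∈ Set.Ioi (0:ℝ), HasDerivAt Φ (Φ' x) x)
    (hcont : ContinuousOn Φ' (Set.Ioi 0))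
    (hpos : ∀ x ∈ Set.Ioi (0:ℝ), 0 < x * Φ' x)
    (hmono : StrictMonoOn (fun x => x * Φ' x) (Set.Ioi 0))
    (h0 : Tendsto (fun x => x * Φ' x) (nhdsWithin 0 (Set.Ioi 0)) (nhds 0))
    (hinf : Tendsto (fun x => x * Φ' x) atTop atTop)
    (n : ℕ) (hn : 1 ≤ n) (a : ℝ) (ha : 0 < a)
    (hmrs : (2/Real.pi) * ∫ t in (0:ℝ)..1,
        a * t * Φ' (a * t) / Real.sqrt (1 - t ^ 2) = n) :
    ∀ p : Polynomial ℝ, p.degree ≤ n →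
      (⨆ x : ℝ, |p.eval x * Real.exp (-Φ x)|) =
        ⨆ x : Set.Icc (-a) a, |p.eval (x : ℝ) * Real.exp (-Φ (x : ℝ))| := by
  intro p hp
  have key : ∀ M : ℝ, (∀ y ∈ Set.Icc (-a) a, |p.eval y * Real.exp (-Φ y)| ≤ M) →
      ∀ x, |p.eval x * Real.exp (-Φ x)| ≤ M := by
    intro M hb x
    have hM : 0 ≤ M := (abs_nonneg _).trans (hb 0 ⟨by linarith, ha.le⟩)
    by_cases hx : x ∈ Set.Icc (-a) a
    · exact hb x hx
    apply le_of_forall_pos_le_add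
    intro ε hε
    have hb' : ∀ y ∈ Set.Icc (-a) a, |p.eval y * Real.exp (-Φ y)| ≤ M + ε := fun y hy =>
      (hb y hy).trans (by linarith)
    rcases lt_or_ge a x with h | h
    · exact rr_bound_pos Φ Φ' heven hderiv hcont hpos hmono n a ha hmrs p hp (M + ε)
        (by linarith) hb' x h
    · have hxa : a < -x := by
        by_contra hc
        exact hx ⟨by linarith, h⟩
      have hdeg : (p.comp (-Polynomial.X)).degree ≤ n := by
        apply Polynomial.degree_le_of_natDegree_le
        rw [Polynomial.natDegree_comp, Polynomial.natDegree_neg, Polynomial.natDegree_X, mul_one]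
        exact Polynomial.natDegree_le_of_degree_le hp
      have := rr_bound_pos Φ Φ' heven hderiv hcont hpos hmono n a ha hmrs
        (p.comp (-Polynomial.X)) hdeg (M + ε) (by linarith) (by
          intro y hy
          have := hb' (-y) ⟨by linarith [hy.2], by linarith [hy.1]⟩
          simpa [heven] using this) (-x) hxa
      simpa [heven] using this
  have hne : Nonempty (Set.Icc (-a) a) := ⟨⟨0, by constructor <;> linarith⟩⟩
  by_cases hbdd : BddAbove (Set.range fun x : Set.Icc (-a) a =>
      |p.eval (x : ℝ) * Real.exp (-Φ (x : ℝ))|)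
  · have hall := key _ (fun y hy => le_ciSup hbdd ⟨y, hy⟩)
    apply le_antisymm (ciSup_le hall)
    apply ciSup_le
    intro y
    exact le_ciSup (f := fun x : ℝ => |p.eval x * Real.exp (-Φ x)|)
      ⟨_, by rintro _ ⟨x, rfl⟩; exact hall x⟩ (y : ℝ)
  · have hbdd2 : ¬ BddAbove (Set.range fun x : ℝ => |p.eval x * Real.exp (-Φ x)|) := by
      rintro ⟨M, hM⟩
      exact hbdd ⟨M, by rintro _ ⟨x, rfl⟩; exact hM ⟨x, rfl⟩⟩
    rw [Real.iSup_of_not_bddAbove hbdd, Real.iSup_of_not_bddAbove hbdd2]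
end

section
/- Let λ ≥ 1, let w_λ(x) = exp(−|x|^λ), and set γ_λ := √π · Γ(λ/2) / (2 Γ((λ+1)/2)) and a_n := (n γ_λ)^{1/λ}. Then for every n ≥ 1 and every real polynomial p_n of degree at most n, sup_{x ∈ ℝ} |p_n(x) w_λ(x)| = sup_{x ∈ [−a_n, a_n]} |p_n(x) w_λ(x)|. In particular, sup_{x∈ℝ} |p_n(x) e^{−x²}| = sup_{x∈[−√n, √n]} |p_n(x) e^{−x²}| and sup_{x∈ℝ} |p_n(x) e^{−|x|}| = sup_{x∈[−πn/2, πn/2]} |p_n(x) e^{−|x|}|. -/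
open MeasureTheory Set Filter Topology

/-- Green function of the complement of `[-1,1]`, on the real line. -/
noncomputable def gg (y : ℝ) : ℝ := Real.arcosh (max 1 y)

lemma gg_nonneg (y : ℝ) : 0 ≤ gg y := Real.arcosh_nonneg (le_max_left _ _)

lemma gg_mono : Monotone gg := by
  intro x y h
  unfold gg
  rw [Real.arcosh_le_arcosh (by positivity) (by positivity)]
  exact max_le_max le_rfl h

lemma gg_continuous : Continuous gg := by
  unfold gg
  exact Real.continuousOn_arcosh.comp_continuous (by fun_prop) (fun x => le_max_left (1:ℝ) x)

lemma gg_le_log (b y s : ℝ) (hy : 0 ≤ y) (hs : 0 < s) (hsb : s ≤ b) :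
    gg (y / s) ≤ Real.log (2 * (b + y)) - Real.log s := by
  have hb : 0 < b := hs.trans_le hsb
  rw [← Real.log_div (by positivity) (by positivity)]
  unfold gg Real.arcosh
  set m := max 1 (y / s) with hm
  have h1 : 1 ≤ m := le_max_left _ _
  have h2 : m ≤ (b + y) / s := by
    apply max_le
    · rw [le_div_iff₀ hs]; linarith
    · gcongr; linarith
  apply Real.log_le_log (by positivity)
  have : √(m ^ 2 - 1) ≤ m := by
    apply Real.sqrt_le_iff.mpr; constructor <;> nlinarith
  rw [mul_div_assoc]; linarith

lemma gg_int (lam : ℝ) (hlam : 1 ≤ lam) (b y : ℝ) (hb : 0 < b) (hy : 0 ≤ y) :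
    IntervalIntegrable (fun s : ℝ => s ^ (lam - 1) * gg (y / s)) volume 0 b := by
  have hi : IntervalIntegrable (fun s : ℝ => b ^ (lam - 1) * (Real.log (2 * (b + y)) - Real.log s))
      volume 0 b :=
    (intervalIntegrable_const.sub intervalIntegral.intervalIntegrable_log').const_mul _
  refine hi.mono_fun ?_ ?_
  · apply Measurable.aestronglyMeasurable
    have := gg_continuous.measurable
    fun_prop
  · rw [EventuallyLE, ae_restrict_iff' measurableSet_uIoc]
    refine Eventually.of_forall fun s hs => ?_
    rw [uIoc_of_le hb.le] at hs
    have h1 := gg_nonneg (y / s)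
    have h2 := gg_le_log b y s hy hs.1 hs.2
    have h3 : 0 ≤ s ^ (lam - 1) := Real.rpow_nonneg hs.1.le _
    rw [Real.norm_of_nonneg (by positivity)]
    refine le_trans ?_ (le_abs_self _)
    have h4 : s ^ (lam - 1) ≤ b ^ (lam - 1) :=
      Real.rpow_le_rpow hs.1.le hs.2 (by linarith)
    gcongr

/-- the constant -/
noncomputable def KK (lam : ℝ) : ℝ := ∫ s in (0:ℝ)..1, s ^ (lam - 1) * gg (1 / s)

lemma gg_scale (lam : ℝ) (y : ℝ) (hy : 0 < y) :
    ∫ s in (0:ℝ)..y, s ^ (lam - 1) * gg (y / s) = y ^ lam * KK lam := by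
  have h := intervalIntegral.integral_comp_mul_left (a := 0) (b := 1)
    (fun s : ℝ => s ^ (lam - 1) * gg (y / s)) hy.ne'
  simp only [mul_zero, mul_one, smul_eq_mul] at h
  rw [eq_comm, inv_mul_eq_iff_eq_mul₀ hy.ne'] at h
  rw [h, KK, ← intervalIntegral.integral_const_mul, ← intervalIntegral.integral_const_mul]
  apply intervalIntegral.integral_congr_ae
  refine Eventually.of_forall fun s hs => ?_
  rw [uIoc_of_le zero_le_one] at hs
  rw [Real.mul_rpow hy.le hs.1.le, Real.rpow_sub_one hy.ne']
  have : y / (y * s) = 1 / s := by field_simp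
  rw [this]; field_simp

lemma gg_V_ge (lam : ℝ) (hlam : 1 ≤ lam) (y : ℝ) (hy : 0 ≤ y) (hy1 : y ≤ 1) :
    y ^ lam * KK lam ≤ ∫ s in (0:ℝ)..1, s ^ (lam - 1) * gg (y / s) := by
  have hnn : ∀ s : ℝ, 0 ≤ s → 0 ≤ s ^ (lam - 1) * gg (y / s) := fun s hs =>
    mul_nonneg (Real.rpow_nonneg hs _) (gg_nonneg _)
  rcases hy.eq_or_lt with rfl | hy0
  · rw [Real.zero_rpow (by linarith), zero_mul]
    exact intervalIntegral.integral_nonneg zero_le_one (fun s hs => hnn s hs.1)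
  · rw [← gg_scale lam y hy0]
    apply intervalIntegral.integral_mono_interval le_rfl hy hy1 _ (gg_int lam hlam 1 y one_pos hy)
    rw [EventuallyLE, ae_restrict_iff' measurableSet_Ioc]
    exact Eventually.of_forall fun s hs => hnn s hs.1.le

lemma gg_V_le (lam : ℝ) (hlam : 1 ≤ lam) (y : ℝ) (hy1 : 1 ≤ y) :
    ∫ s in (0:ℝ)..1, s ^ (lam - 1) * gg (y / s) ≤ y ^ lam * KK lam := by
  have hy0 : 0 < y := by linarith
  rw [← gg_scale lam y hy0]
  apply intervalIntegral.integral_mono_interval le_rfl zero_le_one hy1 _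
    (gg_int lam hlam y y hy0 hy0.le)
  rw [EventuallyLE, ae_restrict_iff' measurableSet_Ioc]
  exact Eventually.of_forall fun s hs =>
    mul_nonneg (Real.rpow_nonneg hs.1.le _) (gg_nonneg _)

lemma beta_aux (lam : ℝ) (hlam : 1 ≤ lam) :
    IntervalIntegrable (fun s : ℝ => s ^ (lam - 1) * (√(1 - s ^ 2))⁻¹) volume 0 1 ∧
    ∫ s in (0:ℝ)..1, s ^ (lam - 1) * (√(1 - s ^ 2))⁻¹ =
      √Real.pi * Real.Gamma (lam / 2) / (2 * Real.Gamma ((lam + 1) / 2)) := by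
  have hl : 0 < lam / 2 := by linarith
  set φ : ℝ → ℝ := fun t => t ^ (lam / 2 - 1) * (1 - t) ^ ((1:ℝ) / 2 - 1) with hφ
  have hc := Complex.betaIntegral_convergent (u := ((lam / 2 : ℝ) : ℂ)) (v := ((1 / 2 : ℝ) : ℂ))
    (by simpa using hl) (by norm_num)
  have hb := ProbabilityTheory.beta_eq_betaIntegralReal (lam / 2) (1 / 2) hl (by norm_num)
  have hcast : ∀ t : ℝ, t ∈ Ioc (0:ℝ) 1 → (t : ℂ) ^ (((lam / 2 : ℝ) : ℂ) - 1) *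
      (1 - (t : ℂ)) ^ (((1 / 2 : ℝ) : ℂ) - 1) = ((φ t : ℝ) : ℂ) := by
    intro t ht
    rw [hφ]
    simp only
    rw [Complex.ofReal_mul, Complex.ofReal_cpow ht.1.le, Complex.ofReal_cpow (by linarith [ht.2])]
    push_cast
    rfl
  have hφint : IntegrableOn φ (Ioc 0 1) := by
    rw [intervalIntegrable_iff_integrableOn_Ioc_of_le zero_le_one] at hc
    have h2 := (hc.congr_fun hcast measurableSet_Ioc).re
    exact h2
  have hφval : ∫ t in Ioc (0:ℝ) 1, φ t = ProbabilityTheory.beta (lam / 2) (1 / 2) := by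
    rw [hb, Complex.betaIntegral, intervalIntegral.integral_of_le zero_le_one,
      setIntegral_congr_fun measurableSet_Ioc hcast, integral_complex_ofReal, Complex.ofReal_re]
  set g : ℝ → ℝ := indicator (Ioc 0 1) φ with hg
  have hgint : IntegrableOn g (Ioi 0) := by
    rw [hg]
    exact ((integrable_indicator_iff measurableSet_Ioc).mpr hφint).integrableOn
  have hgval : ∫ t in Ioi (0:ℝ), g t = ∫ t in Ioc (0:ℝ) 1, φ t := by
    rw [hg, setIntegral_indicator measurableSet_Ioc]
    congr 2
    ext x; simp
  have hI := (integrableOn_Ioi_comp_rpow_iff g (p := 2) (by norm_num)).mpr hgint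
  have hV := integral_comp_rpow_Ioi g (p := 2) (by norm_num)
  set ψ : ℝ → ℝ := fun s => 2 * (s ^ (lam - 1) * (√(1 - s ^ 2))⁻¹) with hψ
  have heq : ∀ x ∈ Ioi (0:ℝ), (|(2:ℝ)| * x ^ ((2:ℝ) - 1)) • g (x ^ (2:ℝ)) =
      indicator (Ioc 0 1) ψ x := by
    intro x hx
    have hx : 0 < x := hx
    by_cases h1 : x ≤ 1
    · have hm : x ∈ Ioc (0:ℝ) 1 := ⟨hx, h1⟩
      have hm2 : x ^ (2:ℝ) ∈ Ioc (0:ℝ) 1 :=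
        ⟨by positivity, Real.rpow_le_one hx.le h1 (by norm_num)⟩
      rw [hg, indicator_of_mem hm2, indicator_of_mem hm, hφ, hψ]
      simp only [smul_eq_mul]
      rw [← Real.rpow_mul hx.le, show (2:ℝ) * (lam / 2 - 1) = lam - 1 - 1 by ring,
        Real.rpow_sub_one hx.ne' (lam - 1)]
      have : (1 - x ^ (2:ℝ)) ^ ((1:ℝ) / 2 - 1) = (√(1 - x ^ 2))⁻¹ := by
        rw [Real.rpow_two, Real.sqrt_eq_rpow, ← Real.rpow_neg (by nlinarith)]
        norm_num
      rw [this]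
      norm_num
      field_simp
    · have hm : x ∉ Ioc (0:ℝ) 1 := fun h => h1 h.2
      have hm2 : x ^ (2:ℝ) ∉ Ioc (0:ℝ) 1 := fun h => by
        have := Real.one_lt_rpow (not_le.mp h1) (by norm_num : (0:ℝ) < 2)
        linarith [h.2]
      rw [hg, indicator_of_notMem hm2, indicator_of_notMem hm, smul_zero]
  have hψint : IntegrableOn ψ (Ioc 0 1) := by
    have h1 := hI.congr_fun heq measurableSet_Ioi
    have h2 : IntegrableOn (indicator (Ioc 0 1) ψ) (Ioc 0 1) := h1.mono_set Ioc_subset_Ioi_self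
    exact h2.congr_fun (fun x hx => indicator_of_mem hx _) measurableSet_Ioc
  have hψval : ∫ x in Ioc (0:ℝ) 1, ψ x = ProbabilityTheory.beta (lam / 2) (1 / 2) := by
    rw [← hφval, ← hgval, ← hV, setIntegral_congr_fun measurableSet_Ioi heq,
      setIntegral_indicator measurableSet_Ioc]
    congr 2
    ext x; simp
  constructor
  · rw [intervalIntegrable_iff_integrableOn_Ioc_of_le zero_le_one]
    have := hψint.const_mul (1 / 2)
    refine this.congr (Eventually.of_forall fun x => ?_)
    simp [hψ]
  · rw [intervalIntegral.integral_of_le zero_le_one]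
    have h3 : ∫ x in Ioc (0:ℝ) 1, ψ x = 2 * ∫ s in Ioc (0:ℝ) 1, s ^ (lam - 1) * (√(1 - s ^ 2))⁻¹ :=
      integral_const_mul _ _
    rw [h3, ProbabilityTheory.beta, Real.Gamma_one_half_eq, ← add_div] at hψval
    rw [← mul_right_inj' (two_ne_zero (α := ℝ)), hψval]
    have : Real.Gamma ((lam + 1) / 2) ≠ 0 := (Real.Gamma_pos_of_pos (by linarith)).ne'
    field_simp

lemma KK_eq (lam : ℝ) (hlam : 1 ≤ lam) :
    lam * KK lam = √Real.pi * Real.Gamma (lam / 2) / (2 * Real.Gamma ((lam + 1) / 2)) := by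
  obtain ⟨hbi, hbv⟩ := beta_aux lam hlam
  rw [← hbv]
  have hlam0 : 0 < lam := by linarith
  have hgi := gg_int lam hlam 1 1 one_pos zero_le_one
  have key := intervalIntegral.integral_eq_sub_of_hasDerivAt_of_tendsto (a := 0) (b := 1)
    (f := fun s : ℝ => s ^ lam * gg (1 / s))
    (f' := fun s : ℝ => lam * (s ^ (lam - 1) * gg (1 / s)) - s ^ (lam - 1) * (√(1 - s ^ 2))⁻¹)
    (fa := 0) (fb := 0) one_pos ?_ ((hgi.const_mul lam).sub hbi) ?_ ?_
  · rw [intervalIntegral.integral_sub (hgi.const_mul lam) hbi,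
      intervalIntegral.integral_const_mul] at key
    rw [KK]; linarith
  · intro s hs
    have hs0 : 0 < s := hs.1
    have hs1 : 1 < 1 / s := by rw [lt_div_iff₀ hs0]; linarith [hs.2]
    have h1 : HasDerivAt (fun s : ℝ => 1 / s) (-(s ^ 2)⁻¹) s := by
      simpa using hasDerivAt_inv hs0.ne'
    have h2 : HasDerivAt gg (√((1 / s) ^ 2 - 1))⁻¹ (1 / s) := by
      refine (Real.hasDerivAt_arcosh (x := 1 / s) hs1).congr_of_eventuallyEq ?_
      filter_upwards [lt_mem_nhds hs1] with y hy
      rw [gg, max_eq_right hy.le]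
    have h3 := (Real.hasDerivAt_rpow_const (p := lam) (Or.inl hs0.ne')).mul (h2.comp s h1)
    refine h3.congr_deriv ?_
    have h4 : √((1 / s) ^ 2 - 1) = √(1 - s ^ 2) / s := by
      rw [show (1 / s) ^ 2 - 1 = (1 - s ^ 2) / s ^ 2 by field_simp, Real.sqrt_div' _ (sq_nonneg s),
        Real.sqrt_sq hs0.le]
    have h5 : √(1 - s ^ 2) ≠ 0 := (Real.sqrt_pos.mpr (by nlinarith [hs.2])).ne'
    rw [h4, Real.rpow_sub_one hs0.ne']
    simp only [Function.comp]
    field_simp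
    ring
  · have h1 : Tendsto (fun s : ℝ => Real.log (2 * (1 + 1)) * s ^ lam - Real.log s * s ^ lam)
        (𝓝[>] 0) (𝓝 0) := by
      have h2 := tendsto_log_mul_rpow_nhdsGT_zero hlam0
      have h3 : Tendsto (fun s : ℝ => s ^ lam) (𝓝[>] 0) (𝓝 0) := by
        have := (Real.continuous_rpow_const hlam0.le).tendsto 0
        rw [Real.zero_rpow hlam0.ne'] at this
        exact this.mono_left nhdsWithin_le_nhds
      simpa using (h3.const_mul (Real.log (2 * (1 + 1)))).sub h2
    refine tendsto_of_tendsto_of_tendsto_of_le_of_le' tendsto_const_nhds h1 ?_ ?_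
    · filter_upwards [self_mem_nhdsWithin] with s hs
      exact mul_nonneg (Real.rpow_nonneg (le_of_lt hs) _) (gg_nonneg _)
    · filter_upwards [Ioc_mem_nhdsGT one_pos] with s hs
      have := gg_le_log 1 1 s zero_le_one hs.1 hs.2
      have h3 : 0 ≤ s ^ lam := Real.rpow_nonneg hs.1.le _
      nlinarith
  · have h1 : ContinuousAt (fun s : ℝ => s ^ lam * gg (1 / s)) 1 := by
      apply ContinuousAt.mul
      · exact Real.continuousAt_rpow_const _ _ (Or.inl one_ne_zero)
      · exact gg_continuous.continuousAt.comp (by fun_prop (disch := norm_num))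
    have h2 := h1.tendsto
    simp only [div_one, gg, max_self, Real.arcosh_zero, mul_zero] at h2
    exact h2.mono_left nhdsWithin_le_nhds

/-- the square root -/
noncomputable def QQ (u : ℂ) (s : ℝ) : ℂ := (1 - (s:ℂ) ^ 2 + (s:ℂ) ^ 2 * u ^ 2) ^ (1 / 2 : ℂ)

lemma slit_aux (u : ℂ) (hu : 0 < u.re) (s : ℝ) (hs0 : 0 ≤ s) (hs1 : s ≤ 1) :
    (1 - (s:ℂ) ^ 2 + (s:ℂ) ^ 2 * u ^ 2) ∈ Complex.slitPlane := by
  rw [Complex.mem_slitPlane_iff]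
  have hre : (1 - (s:ℂ) ^ 2 + (s:ℂ) ^ 2 * u ^ 2).re = 1 - s ^ 2 + s ^ 2 * (u.re ^ 2 - u.im ^ 2) := by
    simp [pow_two]
  have him : (1 - (s:ℂ) ^ 2 + (s:ℂ) ^ 2 * u ^ 2).im = s ^ 2 * (2 * u.re * u.im) := by
    simp [pow_two]; left; ring
  rw [hre, him]
  rcases hs0.eq_or_lt with rfl | hs
  · left; norm_num
  by_cases h : u.im = 0
  · left
    rw [h]
    have : 0 < s ^ 2 * u.re ^ 2 := by positivity
    nlinarith
  · right
    positivity

lemma QQ_sq (u : ℂ) (s : ℝ) : QQ u s ^ 2 = 1 - (s:ℂ) ^ 2 + (s:ℂ) ^ 2 * u ^ 2 := by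
  unfold QQ
  rw [one_div]
  exact_mod_cast Complex.cpow_nat_inv_pow _ two_ne_zero

lemma QQ_re_pos (u : ℂ) (hu : 0 < u.re) (s : ℝ) (hs0 : 0 ≤ s) (hs1 : s ≤ 1) :
    0 < (QQ u s).re := by
  have h := slit_aux u hu s hs0 hs1
  unfold QQ
  rw [Complex.cpow_def_of_ne_zero (Complex.slitPlane_ne_zero h), Complex.exp_re]
  apply mul_pos (Real.exp_pos _)
  have h1 : ∀ w : ℂ, (Complex.log w * (1 / 2 : ℂ)).im = w.arg / 2 := by
    intro w
    rw [show (1 / 2 : ℂ) = ((1 / 2 : ℝ) : ℂ) by push_cast; rfl, Complex.im_mul_ofReal, Complex.log_im]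
    ring
  rw [h1]
  apply Real.cos_pos_of_mem_Ioo
  have h2 := Complex.arg_le_pi (1 - (s:ℂ) ^ 2 + (s:ℂ) ^ 2 * u ^ 2)
  have h3 := Complex.neg_pi_lt_arg (1 - (s:ℂ) ^ 2 + (s:ℂ) ^ 2 * u ^ 2)
  have h4 := (Complex.mem_slitPlane_iff_arg.mp h).1
  have h5 := lt_of_le_of_ne h2 h4
  constructor <;> linarith

lemma QQ_contOn : ContinuousOn (fun q : ℂ × ℝ => QQ q.1 q.2) ({u : ℂ | 0 < u.re} ×ˢ Icc 0 1) := by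
  unfold QQ
  apply ContinuousOn.cpow
  · fun_prop
  · fun_prop
  · rintro ⟨u, s⟩ ⟨hu, hs⟩
    exact slit_aux u hu s hs.1 hs.2

lemma one_add_QQ (u : ℂ) (hu : 0 < u.re) (s : ℝ) (hs0 : 0 ≤ s) (hs1 : s ≤ 1) :
    1 + QQ u s ∈ Complex.slitPlane := by
  left
  have := QQ_re_pos u hu s hs0 hs1
  simp only [Complex.add_re, Complex.one_re]; linarith

lemma QQ_deriv (u : ℂ) (hu : 0 < u.re) (s : ℝ) (hs0 : 0 ≤ s) (hs1 : s ≤ 1) :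
    HasDerivAt (fun v => QQ v s) ((QQ u s)⁻¹ * ((s:ℂ) ^ 2 * u)) u := by
  have h := slit_aux u hu s hs0 hs1
  have h1 : HasDerivAt (fun v : ℂ => 1 - (s:ℂ) ^ 2 + (s:ℂ) ^ 2 * v ^ 2) ((s:ℂ) ^ 2 * (2 * u)) u := by
    have := ((hasDerivAt_pow 2 u).const_mul ((s:ℂ) ^ 2)).const_add (1 - (s:ℂ) ^ 2)
    simpa using this
  have h2 := h1.cpow_const (c := (1 / 2 : ℂ)) h
  refine h2.congr_deriv ?_
  unfold QQ
  rw [show (1 / 2 : ℂ) - 1 = -(1 / 2) by norm_num, Complex.cpow_neg]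
  ring

/-- integrand -/
noncomputable def HF (lam : ℝ) (u : ℂ) (s : ℝ) : ℂ :=
  ((s ^ (lam - 1) : ℝ) : ℂ) * Complex.log (1 + QQ u s)

noncomputable def HF' (lam : ℝ) (u : ℂ) (s : ℝ) : ℂ :=
  ((s ^ (lam - 1) : ℝ) : ℂ) * ((1 + QQ u s)⁻¹ * ((QQ u s)⁻¹ * ((s:ℂ) ^ 2 * u)))

lemma rpow_cont (lam : ℝ) (hlam : 1 ≤ lam) :
    Continuous (fun s : ℝ => ((s ^ (lam - 1) : ℝ) : ℂ)) :=
  Complex.continuous_ofReal.comp (Real.continuous_rpow_const (by linarith))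

lemma HF_contOn (lam : ℝ) (hlam : 1 ≤ lam) :
    ContinuousOn (fun q : ℂ × ℝ => HF lam q.1 q.2) ({u : ℂ | 0 < u.re} ×ˢ Icc 0 1) := by
  unfold HF
  apply ContinuousOn.mul
  · exact ((rpow_cont lam hlam).comp continuous_snd).continuousOn
  · apply ContinuousOn.clog
    · exact continuousOn_const.add QQ_contOn
    · rintro ⟨u, s⟩ ⟨hu, hs⟩
      exact one_add_QQ u hu s hs.1 hs.2

lemma HF'_contOn (lam : ℝ) (hlam : 1 ≤ lam) :
    ContinuousOn (fun q : ℂ × ℝ => HF' lam q.1 q.2) ({u : ℂ | 0 < u.re} ×ˢ Icc 0 1) := by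
  unfold HF'
  apply ContinuousOn.mul
  · exact ((rpow_cont lam hlam).comp continuous_snd).continuousOn
  apply ContinuousOn.mul
  · apply ContinuousOn.inv₀
    · exact continuousOn_const.add QQ_contOn
    · rintro ⟨u, s⟩ ⟨hu, hs⟩
      exact Complex.slitPlane_ne_zero (one_add_QQ u hu s hs.1 hs.2)
  apply ContinuousOn.mul
  · apply ContinuousOn.inv₀ QQ_contOn
    rintro ⟨u, s⟩ ⟨hu, hs⟩ h0
    have := QQ_re_pos u hu s hs.1 hs.2
    simp only at h0
    rw [h0] at this
    simp at this
  · fun_prop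

lemma HF_contOn_s (lam : ℝ) (hlam : 1 ≤ lam) (u : ℂ) (hu : 0 < u.re) :
    ContinuousOn (fun s : ℝ => HF lam u s) (Icc 0 1) :=
  (HF_contOn lam hlam).comp (f := fun s : ℝ => (u, s)) (by fun_prop) (fun s hs => ⟨hu, hs⟩)

lemma HF_int (lam : ℝ) (hlam : 1 ≤ lam) (u : ℂ) (hu : 0 < u.re) :
    IntervalIntegrable (fun s : ℝ => HF lam u s) volume 0 1 := by
  apply ContinuousOn.intervalIntegrable
  rw [uIcc_of_le zero_le_one]
  exact HF_contOn_s lam hlam u hu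

lemma H_diff (lam : ℝ) (hlam : 1 ≤ lam) (u : ℂ) (hu : 0 < u.re) :
    DifferentiableAt ℂ (fun v => ∫ s in (0:ℝ)..1, HF lam v s) u := by
  have hopen : IsOpen {u : ℂ | 0 < u.re} := isOpen_lt continuous_const Complex.continuous_re
  obtain ⟨ε, hε, hball⟩ := Metric.nhds_basis_closedBall.mem_iff.mp (hopen.mem_nhds hu)
  have hcomp : IsCompact (Metric.closedBall u ε ×ˢ Icc (0:ℝ) 1) :=
    (isCompact_closedBall u ε).prod isCompact_Icc
  obtain ⟨C, hC⟩ := hcomp.exists_bound_of_continuousOn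
    ((HF'_contOn lam hlam).mono (prod_mono hball subset_rfl))
  have hsub : uIoc (0:ℝ) 1 ⊆ Icc 0 1 := by
    rw [uIoc_of_le zero_le_one]; exact Ioc_subset_Icc_self
  have key := intervalIntegral.hasDerivAt_integral_of_dominated_loc_of_deriv_le
    (μ := volume) (a := 0) (b := 1) (F := HF lam) (F' := HF' lam) (x₀ := u)
    (s := Metric.closedBall u ε) (bound := fun _ => C) (Metric.closedBall_mem_nhds u hε)
    ?_ (HF_int lam hlam u hu) ?_ ?_ intervalIntegrable_const ?_
  · exact key.2.differentiableAt
  · filter_upwards [hopen.mem_nhds hu] with v hv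
    exact ((HF_contOn_s lam hlam v hv).mono hsub).aestronglyMeasurable measurableSet_uIoc
  · have : ContinuousOn (fun s : ℝ => HF' lam u s) (Icc 0 1) :=
      (HF'_contOn lam hlam).comp (f := fun s : ℝ => (u, s)) (by fun_prop) (fun s hs => ⟨hu, hs⟩)
    exact (this.mono hsub).aestronglyMeasurable measurableSet_uIoc
  · exact Eventually.of_forall fun t ht v hv => hC (v, t) ⟨hv, hsub ht⟩
  · refine Eventually.of_forall fun t ht v hv => ?_
    have ht := hsub ht
    have hv : 0 < v.re := hball hv
    have h1 := ((QQ_deriv v hv t ht.1 ht.2).const_add 1).clog (one_add_QQ v hv t ht.1 ht.2)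
    have h2 := h1.const_mul ((t ^ (lam - 1) : ℝ) : ℂ)
    refine h2.congr_deriv ?_
    unfold HF'
    ring

noncomputable def uu (ζ : ℂ) : ℂ := (1 - ζ ^ 2) / (1 + ζ ^ 2)

lemma one_add_sq_re (ζ : ℂ) (h : ‖ζ‖ < 1) : 0 < (1 + ζ ^ 2).re := by
  have h1 : ‖ζ ^ 2‖ < 1 := by rw [norm_pow]; exact pow_lt_one₀ (norm_nonneg _) h two_ne_zero
  have h2 := (abs_le.mp (Complex.abs_re_le_norm (ζ ^ 2))).1
  simp only [Complex.add_re, Complex.one_re]; linarith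

lemma one_add_sq_ne (ζ : ℂ) (h : ‖ζ‖ < 1) : 1 + ζ ^ 2 ≠ 0 := by
  intro h0
  have := one_add_sq_re ζ h
  rw [h0] at this; simp at this

lemma uu_re (ζ : ℂ) (h : ‖ζ‖ < 1) : 0 < (uu ζ).re := by
  have h1 : ‖ζ ^ 2‖ < 1 := by rw [norm_pow]; exact pow_lt_one₀ (norm_nonneg _) h two_ne_zero
  have h2 : Complex.normSq (ζ ^ 2) < 1 := by
    rw [Complex.normSq_eq_norm_sq]; exact pow_lt_one₀ (norm_nonneg _) h1 two_ne_zero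
  have h3 : 0 < Complex.normSq (1 + ζ ^ 2) := Complex.normSq_pos.mpr (one_add_sq_ne ζ h)
  unfold uu
  generalize ζ ^ 2 = q at *
  rw [Complex.div_re, ← add_div]
  apply div_pos _ h3
  rw [Complex.normSq_apply] at h2
  simp
  nlinarith

noncomputable def FF (lam : ℝ) (ζ : ℂ) : ℂ :=
  Complex.log (1 + ζ ^ 2) / lam - ((∫ s in (0:ℝ)..1, s ^ (lam - 1) * Real.log (2 * s) : ℝ) : ℂ) +
    ∫ s in (0:ℝ)..1, HF lam (uu ζ) s

lemma FF_diff (lam : ℝ) (hlam : 1 ≤ lam) (ζ : ℂ) (h : ‖ζ‖ < 1) :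
    DifferentiableAt ℂ (FF lam) ζ := by
  unfold FF
  apply DifferentiableAt.add
  · apply DifferentiableAt.sub_const
    apply DifferentiableAt.div_const
    apply DifferentiableAt.clog (by fun_prop)
    left; exact one_add_sq_re ζ h
  · refine DifferentiableAt.comp (f := uu) (g := fun v => ∫ s in (0:ℝ)..1, HF lam v s) ζ
      (H_diff lam hlam _ (uu_re ζ h)) ?_
    unfold uu
    have := one_add_sq_ne ζ h
    fun_prop (disch := assumption)

lemma log2s_int (lam : ℝ) (hlam : 1 ≤ lam) :
    IntervalIntegrable (fun s : ℝ => s ^ (lam - 1) * Real.log (2 * s)) volume 0 1 := by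
  have h0 : IntervalIntegrable (fun s : ℝ => Real.log 2 + Real.log s) volume 0 1 :=
    intervalIntegrable_const.add intervalIntegral.intervalIntegrable_log'
  have h1 := h0.continuousOn_mul
    (Real.continuous_rpow_const (q := lam - 1) (by linarith)).continuousOn
  refine h1.congr ?_
  intro s hs
  rw [uIoc_of_le zero_le_one] at hs
  simp only
  rw [Real.log_mul two_ne_zero hs.1.ne']

lemma rpow_int (lam : ℝ) (hlam : 1 ≤ lam) (c : ℝ) :
    IntervalIntegrable (fun s : ℝ => s ^ (lam - 1) * c) volume 0 1 :=
  ((Real.continuous_rpow_const (by linarith)).mul continuous_const).intervalIntegrable _ _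

lemma rpow_val (lam : ℝ) (hlam : 1 ≤ lam) (c : ℝ) :
    ∫ s in (0:ℝ)..1, s ^ (lam - 1) * c = c / lam := by
  rw [intervalIntegral.integral_mul_const, integral_rpow (Or.inl (by linarith))]
  simp only [sub_add_cancel, Real.one_rpow]
  rw [Real.zero_rpow (by linarith)]
  ring

/-- integrand of the real part -/
noncomputable def RR (lam : ℝ) (ζ : ℂ) (s : ℝ) : ℝ :=
  s ^ (lam - 1) * Real.log ‖1 + ζ ^ 2‖ - s ^ (lam - 1) * Real.log (2 * s) +
    s ^ (lam - 1) * Real.log ‖1 + QQ (uu ζ) s‖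

lemma HF_re (lam : ℝ) (u : ℂ) (s : ℝ) :
    (HF lam u s).re = s ^ (lam - 1) * Real.log ‖1 + QQ u s‖ := by
  rw [HF, Complex.re_ofReal_mul, Complex.log_re]

lemma HF_re_int (lam : ℝ) (hlam : 1 ≤ lam) (u : ℂ) (hu : 0 < u.re) :
    IntervalIntegrable (fun s : ℝ => s ^ (lam - 1) * Real.log ‖1 + QQ u s‖) volume 0 1 := by
  apply ContinuousOn.intervalIntegrable
  rw [uIcc_of_le zero_le_one]
  have := Complex.continuous_re.comp_continuousOn (HF_contOn_s lam hlam u hu)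
  refine this.congr fun s _ => (HF_re lam u s).symm

lemma RR_int (lam : ℝ) (hlam : 1 ≤ lam) (ζ : ℂ) (h : ‖ζ‖ < 1) :
    IntervalIntegrable (RR lam ζ) volume 0 1 :=
  ((rpow_int lam hlam _).sub (log2s_int lam hlam)).add (HF_re_int lam hlam _ (uu_re ζ h))

lemma FF_re (lam : ℝ) (hlam : 1 ≤ lam) (ζ : ℂ) (h : ‖ζ‖ < 1) :
    (FF lam ζ).re = ∫ s in (0:ℝ)..1, RR lam ζ s := by
  unfold FF RR
  rw [intervalIntegral.integral_add ((rpow_int lam hlam _).sub (log2s_int lam hlam))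
    (HF_re_int lam hlam _ (uu_re ζ h)), intervalIntegral.integral_sub (rpow_int lam hlam _)
    (log2s_int lam hlam), rpow_val lam hlam]
  rw [Complex.add_re, Complex.sub_re, Complex.ofReal_re, Complex.div_ofReal_re, Complex.log_re]
  congr 1
  have := Complex.reCLM.intervalIntegral_comp_comm (HF_int lam hlam _ (uu_re ζ h))
  simp only [Complex.reCLM_apply, HF_re] at this
  exact this.symm

/-- Joukowski -/
noncomputable def zz (ζ : ℂ) : ℂ := (ζ + ζ⁻¹) / 2

lemma zz_sq_aux (ζ : ℂ) (h0 : ζ ≠ 0) (h : ‖ζ‖ < 1) (s : ℝ) :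
    zz ζ ^ 2 * (1 - QQ (uu ζ) s ^ 2) = (s:ℂ) ^ 2 := by
  have := one_add_sq_ne ζ h
  rw [QQ_sq, uu, zz]
  have h2 : ζ + ζ⁻¹ = (1 + ζ ^ 2) / ζ := by field_simp; ring
  rw [h2]
  field_simp
  ring

lemma AA_norm (ζ : ℂ) (h0 : ζ ≠ 0) (s : ℝ) (hs : 0 < s) :
    ‖zz ζ * (1 + QQ (uu ζ) s) / s‖ = ‖1 + ζ ^ 2‖ * ‖1 + QQ (uu ζ) s‖ / (2 * s) / ‖ζ‖ := by
  have h2 : zz ζ = (1 + ζ ^ 2) / ζ / 2 := by rw [zz]; field_simp; ring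
  rw [h2]
  simp only [norm_div, norm_mul, Complex.norm_real, Real.norm_of_nonneg hs.le, RCLike.norm_ofNat]
  field_simp

lemma RR_eq (lam : ℝ) (ζ : ℂ) (h0 : ζ ≠ 0) (h : ‖ζ‖ < 1) (s : ℝ) (hs : 0 < s) (hs1 : s ≤ 1) :
    RR lam ζ s = s ^ (lam - 1) *
      (Real.log ‖ζ‖ + Real.log ‖zz ζ * (1 + QQ (uu ζ) s) / s‖) := by
  have h1 : ‖1 + ζ ^ 2‖ ≠ 0 := norm_ne_zero_iff.mpr (one_add_sq_ne ζ h)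
  have h2 : ‖1 + QQ (uu ζ) s‖ ≠ 0 := norm_ne_zero_iff.mpr
    (Complex.slitPlane_ne_zero (one_add_QQ _ (uu_re ζ h) s hs.le hs1))
  have h3 : ‖ζ‖ ≠ 0 := norm_ne_zero_iff.mpr h0
  rw [AA_norm ζ h0 s hs, Real.log_div (by positivity) h3, Real.log_div (by positivity) (by positivity),
    Real.log_mul h1 h2, RR]
  ring

lemma AA_facts (ζ : ℂ) (h0 : ζ ≠ 0) (h : ‖ζ‖ < 1) (s : ℝ) (hs : 0 < s) (hs1 : s ≤ 1) :
    1 ≤ ‖zz ζ * (1 + QQ (uu ζ) s) / s‖ ∧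
    ‖zz ζ * (1 + QQ (uu ζ) s) / s‖⁻¹ = ‖zz ζ * (1 - QQ (uu ζ) s) / s‖ := by
  have hsC : (s:ℂ) ≠ 0 := by exact_mod_cast hs.ne'
  have hprod : (zz ζ * (1 + QQ (uu ζ) s) / s) * (zz ζ * (1 - QQ (uu ζ) s) / s) = 1 := by
    have := zz_sq_aux ζ h0 h s
    field_simp
    linear_combination this
  have hn := congrArg norm hprod
  rw [norm_mul, norm_one] at hn
  have hle : ‖zz ζ * (1 - QQ (uu ζ) s) / s‖ ≤ ‖zz ζ * (1 + QQ (uu ζ) s) / s‖ := by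
    rw [norm_div, norm_div, norm_mul, norm_mul]
    gcongr
    have hq := QQ_re_pos _ (uu_re ζ h) s hs.le hs1
    rw [← sq_le_sq₀ (norm_nonneg _) (norm_nonneg _), ← Complex.normSq_eq_norm_sq,
      ← Complex.normSq_eq_norm_sq, Complex.normSq_apply, Complex.normSq_apply]
    simp
    nlinarith
  constructor
  · have := norm_nonneg (zz ζ * (1 + QQ (uu ζ) s) / s)
    nlinarith
  · exact inv_eq_of_mul_eq_one_right hn

lemma AA_ge (ζ : ℂ) (h0 : ζ ≠ 0) (h : ‖ζ‖ < 1) (s : ℝ) (hs : 0 < s) (hs1 : s ≤ 1) :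
    gg (|(zz ζ).re| / s) ≤ Real.log ‖zz ζ * (1 + QQ (uu ζ) s) / s‖ := by
  obtain ⟨h1, h2⟩ := AA_facts ζ h0 h s hs hs1
  have hsC : (s:ℂ) ≠ 0 := by exact_mod_cast hs.ne'
  rw [← Real.arcosh_cosh (Real.log_nonneg h1), gg,
    Real.arcosh_le_arcosh (by positivity) (Real.cosh_pos _)]
  apply max_le (Real.one_le_cosh _)
  rw [Real.cosh_log (by linarith), h2]
  have h3 : ‖2 * zz ζ / s‖ ≤ ‖zz ζ * (1 + QQ (uu ζ) s) / s‖ + ‖zz ζ * (1 - QQ (uu ζ) s) / s‖ := by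
    refine le_trans (le_of_eq ?_) (norm_add_le _ _)
    congr 1; ring
  have h4 : ‖2 * zz ζ / s‖ = 2 * ‖zz ζ‖ / s := by
    simp [Real.norm_of_nonneg hs.le]
  have h5 : |(zz ζ).re| / s ≤ ‖zz ζ‖ / s := by gcongr; exact Complex.abs_re_le_norm _
  rw [h4, mul_div_assoc] at h3
  linarith

lemma AA_le (r : ℝ) (h0 : 0 < r) (h : r < 1) (s : ℝ) (hs : 0 < s) (hs1 : s ≤ 1) :
    Real.log ‖zz (r:ℂ) * (1 + QQ (uu (r:ℂ)) s) / s‖ ≤ gg (((r + r⁻¹) / 2) / s) := by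
  have h0' : (r:ℂ) ≠ 0 := by exact_mod_cast h0.ne'
  have h' : ‖(r:ℂ)‖ < 1 := by rw [Complex.norm_real, Real.norm_of_nonneg h0.le]; exact h
  obtain ⟨h1, h2⟩ := AA_facts (r:ℂ) h0' h' s hs hs1
  have hz : zz (r:ℂ) = (((r + r⁻¹) / 2 : ℝ) : ℂ) := by rw [zz]; push_cast; rfl
  have hu : uu (r:ℂ) = (((1 - r ^ 2) / (1 + r ^ 2) : ℝ) : ℂ) := by rw [uu]; push_cast; rfl
  have hnn : 0 ≤ 1 - s ^ 2 + s ^ 2 * ((1 - r ^ 2) / (1 + r ^ 2)) ^ 2 := by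
    have : 0 ≤ s ^ 2 * ((1 - r ^ 2) / (1 + r ^ 2)) ^ 2 := by positivity
    nlinarith
  obtain ⟨q, hq⟩ : ∃ q : ℝ, QQ (uu (r:ℂ)) s = (q : ℂ) := by
    refine ⟨(1 - s ^ 2 + s ^ 2 * ((1 - r ^ 2) / (1 + r ^ 2)) ^ 2) ^ (1 / 2 : ℝ), ?_⟩
    rw [Complex.ofReal_cpow hnn, QQ, hu]
    push_cast
    rfl
  have hq0 : 0 < q := by
    have := QQ_re_pos _ (uu_re _ h') s hs.le hs1
    rw [hq] at this; simpa using this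
  set x := (r + r⁻¹) / 2 with hx
  have hx0 : 0 < x := by positivity
  have hxq : x ^ 2 * (1 - q ^ 2) = s ^ 2 := by
    have := zz_sq_aux (r:ℂ) h0' h' s
    rw [hz, hq] at this
    exact_mod_cast this
  have hq1 : q ≤ 1 := by
    by_contra hc
    push Not at hc
    have : 0 < x ^ 2 * (q ^ 2 - 1) := by
      apply mul_pos (by positivity); nlinarith
    nlinarith
  have hA : ‖zz (r:ℂ) * (1 + QQ (uu (r:ℂ)) s) / s‖ = x * (1 + q) / s := by
    rw [hz, hq]
    norm_cast
    exact Real.norm_of_nonneg (by positivity)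
  have hB : ‖zz (r:ℂ) * (1 - QQ (uu (r:ℂ)) s) / s‖ = x * (1 - q) / s := by
    rw [hz, hq]
    norm_cast
    exact Real.norm_of_nonneg (div_nonneg (mul_nonneg hx0.le (by linarith)) hs.le)
  rw [← Real.arcosh_cosh (Real.log_nonneg h1), gg,
    Real.arcosh_le_arcosh (Real.cosh_pos _) (by positivity), Real.cosh_log (by linarith), h2, hA, hB]
  refine le_trans (le_of_eq ?_) (le_max_right _ _)
  ring

lemma FF_ge (lam : ℝ) (hlam : 1 ≤ lam) (ζ : ℂ) (h0 : ζ ≠ 0) (h : ‖ζ‖ < 1) :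
    Real.log ‖ζ‖ / lam + ∫ s in (0:ℝ)..1, s ^ (lam - 1) * gg (|(zz ζ).re| / s) ≤ (FF lam ζ).re := by
  have hi := gg_int lam hlam 1 _ one_pos (abs_nonneg (zz ζ).re)
  rw [FF_re lam hlam ζ h, ← rpow_val lam hlam, ← intervalIntegral.integral_add (rpow_int lam hlam _) hi]
  refine intervalIntegral.integral_mono_on_of_le_Ioo zero_le_one ((rpow_int lam hlam _).add hi)
    (RR_int lam hlam ζ h) fun s hs => ?_
  rw [RR_eq lam ζ h0 h s hs.1 hs.2.le, ← mul_add]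
  have h1 := AA_ge ζ h0 h s hs.1 hs.2.le
  have h2 : 0 ≤ s ^ (lam - 1) := Real.rpow_nonneg hs.1.le _
  gcongr

lemma FF_le (lam : ℝ) (hlam : 1 ≤ lam) (r : ℝ) (h0 : 0 < r) (h : r < 1) :
    (FF lam (r:ℂ)).re ≤
      Real.log r / lam + ∫ s in (0:ℝ)..1, s ^ (lam - 1) * gg (((r + r⁻¹) / 2) / s) := by
  have h0' : (r:ℂ) ≠ 0 := by exact_mod_cast h0.ne'
  have hn : ‖(r:ℂ)‖ = r := by rw [Complex.norm_real, Real.norm_of_nonneg h0.le]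
  have h' : ‖(r:ℂ)‖ < 1 := by rw [hn]; exact h
  have hi := gg_int lam hlam 1 ((r + r⁻¹) / 2) one_pos (by positivity)
  rw [FF_re lam hlam _ h', ← rpow_val lam hlam,
    ← intervalIntegral.integral_add (rpow_int lam hlam _) hi]
  refine intervalIntegral.integral_mono_on_of_le_Ioo zero_le_one
    (RR_int lam hlam _ h') ((rpow_int lam hlam _).add hi) fun s hs => ?_
  rw [RR_eq lam _ h0' h' s hs.1 hs.2.le, ← mul_add, hn]
  have h1 := AA_le r h0 h s hs.1 hs.2.le
  have h2 : 0 ≤ s ^ (lam - 1) := Real.rpow_nonneg hs.1.le _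
  gcongr

noncomputable def PP (p : Polynomial ℝ) (n : ℕ) (ζ : ℂ) : ℂ :=
  ∑ k ∈ Finset.range (n + 1), (p.coeff k : ℂ) * (ζ ^ (n - k) * ((1 + ζ ^ 2) / 2) ^ k)

lemma PP_eq (p : Polynomial ℝ) (n : ℕ) (hp : p.natDegree ≤ n) (ζ : ℂ) (h0 : ζ ≠ 0) :
    PP p n ζ = ζ ^ n * Polynomial.aeval (zz ζ) p := by
  rw [Polynomial.aeval_eq_sum_range' (Nat.lt_succ_of_le hp), Finset.mul_sum, PP]
  refine Finset.sum_congr rfl fun k hk => ?_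
  have hk : k ≤ n := Nat.lt_succ_iff.mp (Finset.mem_range.mp hk)
  have h1 : (1 + ζ ^ 2) / 2 = ζ * zz ζ := by rw [zz]; field_simp; ring
  rw [h1, mul_pow, ← mul_assoc (ζ ^ (n - k)), ← pow_add, Nat.sub_add_cancel hk,
    Algebra.smul_def]
  simp only [Complex.coe_algebraMap]
  ring

lemma zz_near (ζ : ℂ) (h0 : ζ ≠ 0) (h : ‖ζ‖ < 1) :
    ‖zz ζ - ((ζ.re / ‖ζ‖ : ℝ) : ℂ)‖ ≤ (‖ζ‖⁻¹ - ‖ζ‖) / 2 := by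
  have hn : 0 < ‖ζ‖ := norm_pos_iff.mpr h0
  have hn1 : 1 ≤ ‖ζ‖⁻¹ := (one_le_inv₀ hn).mpr h.le
  set ρ := ‖ζ‖ with hρ
  have hinv : ζ⁻¹ = (starRingEnd ℂ) ζ * ((ρ ^ 2)⁻¹ : ℝ) := by
    rw [Complex.inv_def, Complex.normSq_eq_norm_sq]
  have hre : (ζ.re : ℂ) = (ζ + (starRingEnd ℂ) ζ) / 2 := by
    rw [Complex.re_eq_add_conj]
  have hρC : (ρ : ℂ) ≠ 0 := by exact_mod_cast hn.ne'
  have h1 : zz ζ - ((ζ.re / ρ : ℝ) : ℂ) =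
      ζ * (((1 - ρ⁻¹) / 2 : ℝ) : ℂ) + (starRingEnd ℂ) ζ * (((ρ⁻¹ - 1) * ρ⁻¹ / 2 : ℝ) : ℂ) := by
    rw [zz, hinv, Complex.ofReal_div, hre]
    push_cast
    field_simp
    ring
  rw [h1]
  refine (norm_add_le _ _).trans ?_
  rw [norm_mul, norm_mul, Complex.norm_conj, Complex.norm_real, Complex.norm_real, ← hρ,
    Real.norm_of_nonpos (by linarith), Real.norm_of_nonneg (by
      have : 0 ≤ (ρ⁻¹ - 1) * ρ⁻¹ := mul_nonneg (by linarith) (by positivity)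
      linarith)]
  apply le_of_eq
  field_simp
  ring

lemma zz_re_ge (ζ : ℂ) (h0 : ζ ≠ 0) : |ζ.re / ‖ζ‖| ≤ |(zz ζ).re| := by
  have hn : 0 < ‖ζ‖ := norm_pos_iff.mpr h0
  have h1 : (zz ζ).re = ζ.re / ‖ζ‖ * ((‖ζ‖ + ‖ζ‖⁻¹) / 2) := by
    rw [zz, show (2:ℂ) = ((2:ℝ):ℂ) by norm_num, Complex.div_ofReal_re, Complex.add_re, Complex.inv_re,
      Complex.normSq_eq_norm_sq]
    field_simp
  rw [h1, abs_mul]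
  apply le_mul_of_one_le_right (abs_nonneg _)
  refine le_trans ?_ (le_abs_self _)
  rw [le_div_iff₀ two_pos]
  have : ‖ζ‖ * ‖ζ‖⁻¹ = 1 := mul_inv_cancel₀ hn.ne'
  nlinarith [sq_nonneg (‖ζ‖ - ‖ζ‖⁻¹), inv_pos.mpr hn]

lemma KK_nonneg (lam : ℝ) : 0 ≤ KK lam :=
  intervalIntegral.integral_nonneg zero_le_one (fun _ hs =>
    mul_nonneg (Real.rpow_nonneg hs.1 _) (gg_nonneg _))

lemma V_ge (lam : ℝ) (hlam : 1 ≤ lam) (y t : ℝ) (hy : 0 ≤ y) (hy1 : y ≤ 1) (hyt : y ≤ t) :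
    y ^ lam * KK lam ≤ ∫ s in (0:ℝ)..1, s ^ (lam - 1) * gg (t / s) := by
  refine (gg_V_ge lam hlam y hy hy1).trans ?_
  refine intervalIntegral.integral_mono_on_of_le_Ioo zero_le_one (gg_int lam hlam 1 y one_pos hy)
    (gg_int lam hlam 1 t one_pos (hy.trans hyt)) fun s hs => ?_
  have hs0 := hs.1
  have h2 : 0 ≤ s ^ (lam - 1) := Real.rpow_nonneg hs.1.le _
  have h3 : gg (y / s) ≤ gg (t / s) := gg_mono (by gcongr)
  gcongr

lemma PP_diff (p : Polynomial ℝ) (n : ℕ) : Differentiable ℂ (PP p n) := by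
  unfold PP
  fun_prop

lemma core (lam : ℝ) (hlam : 1 ≤ lam) (n : ℕ) (p : Polynomial ℝ) (hp : p.natDegree ≤ n) (M : ℝ)
    (hM : ∀ t : ℝ, |t| ≤ 1 → |p.eval t| ≤ M * Real.exp (n * lam * (|t| ^ lam * KK lam)))
    (x : ℝ) (hx : 1 < x) : |p.eval x| ≤ M * Real.exp (n * lam * (x ^ lam * KK lam)) := by
  have hlam0 : 0 < lam := by linarith
  set G : ℂ → ℂ := fun ζ => PP p n ζ * Complex.exp (-((n * lam : ℝ) : ℂ) * FF lam ζ) with hG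
  have hGn : ∀ ζ : ℂ, ζ ≠ 0 → ‖G ζ‖ = ‖ζ‖ ^ n * ‖Polynomial.aeval (zz ζ) p‖ *
      Real.exp (-(n * lam * (FF lam ζ).re)) := by
    intro ζ h0
    rw [hG]
    simp only
    rw [norm_mul, PP_eq p n hp ζ h0, norm_mul, norm_pow, Complex.norm_exp, neg_mul, Complex.neg_re,
      Complex.re_ofReal_mul]
  -- the preimage of x
  obtain ⟨r, hr0, hr1, hrx⟩ : ∃ r : ℝ, 0 < r ∧ r < 1 ∧ (r + r⁻¹) / 2 = x := by
    have hsq : √(x ^ 2 - 1) ^ 2 = x ^ 2 - 1 := Real.sq_sqrt (by nlinarith)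
    have hs0 : 0 < √(x ^ 2 - 1) := Real.sqrt_pos.mpr (by nlinarith)
    have hinv : (x + √(x ^ 2 - 1))⁻¹ = x - √(x ^ 2 - 1) := Real.add_sqrt_self_sq_sub_one_inv hx.le
    refine ⟨(x + √(x ^ 2 - 1))⁻¹, by positivity, inv_lt_one_of_one_lt₀ (by linarith), ?_⟩
    rw [inv_inv, hinv]; ring
  have hr0C : (r:ℂ) ≠ 0 := by exact_mod_cast hr0.ne'
  have hrn : ‖(r:ℂ)‖ = r := by rw [Complex.norm_real, Real.norm_of_nonneg hr0.le]
  -- the maximum principle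
  have hmax : ‖G r‖ ≤ M := by
    refine le_of_forall_pos_le_add fun ε hε => ?_
    have huc : UniformContinuousOn (fun z : ℂ => Polynomial.aeval z p) (Metric.closedBall 0 2) :=
      (isCompact_closedBall _ _).uniformContinuousOn_of_continuous
        (Polynomial.continuous_aeval p).continuousOn
    obtain ⟨δ, hδ, hunif⟩ := Metric.uniformContinuousOn_iff.mp huc ε hε
    obtain ⟨ρ, ⟨hρr, hρ1⟩, hρδ⟩ : ∃ ρ : ℝ, ρ ∈ Ioo r 1 ∧ (ρ⁻¹ - ρ) / 2 < min δ 1 := by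
      have h1 : ContinuousAt (fun ρ : ℝ => (ρ⁻¹ - ρ) / 2) 1 := by fun_prop (disch := norm_num)
      have h2 : Tendsto (fun ρ : ℝ => (ρ⁻¹ - ρ) / 2) (𝓝[<] 1) (𝓝 0) := by
        have := h1.tendsto
        norm_num at this
        exact this.mono_left nhdsWithin_le_nhds
      have h3 : ∀ᶠ ρ in 𝓝[<] (1:ℝ), ρ ∈ Ioo r 1 := Ioo_mem_nhdsLT hr1
      exact (h3.and
        (h2.eventually_lt_const (lt_min hδ one_pos))).exists
    have hρ0 : 0 < ρ := hr0.trans hρr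
    have hdiff : DiffContOnCl ℂ G (Metric.ball 0 ρ) := by
      apply DifferentiableOn.diffContOnCl
      intro ζ hζ
      rw [closure_ball _ hρ0.ne', mem_closedBall_zero_iff] at hζ
      apply DifferentiableAt.differentiableWithinAt
      apply DifferentiableAt.mul (PP_diff p n ζ)
      exact ((FF_diff lam hlam ζ (by linarith)).const_mul _).cexp
    refine Complex.norm_le_of_forall_mem_frontier_norm_le Metric.isBounded_ball hdiff ?_
      (subset_closure (by rw [mem_ball_zero_iff, hrn]; exact hρr))
    intro ζ hζ
    rw [frontier_ball _ hρ0.ne', mem_sphere_zero_iff_norm] at hζ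
    have hζ0 : ζ ≠ 0 := norm_pos_iff.mp (by linarith)
    have hζ1 : ‖ζ‖ < 1 := by linarith
    have hy1 : |ζ.re / ‖ζ‖| ≤ 1 := by
      rw [abs_div, abs_norm]
      exact div_le_one_of_le₀ (Complex.abs_re_le_norm _) (norm_nonneg _)
    have hFF := FF_ge lam hlam ζ hζ0 hζ1
    have hV := V_ge lam hlam _ _ (abs_nonneg _) hy1 (zz_re_ge ζ hζ0)
    have hnear := zz_near ζ hζ0 hζ1
    set y := ζ.re / ‖ζ‖ with hy
    rw [hζ] at hnear
    have hyC : ‖(y:ℂ)‖ ≤ 1 := by rw [Complex.norm_real]; exact hy1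
    have hz2 : ‖zz ζ‖ ≤ 2 := by
      have := norm_sub_norm_le (zz ζ) (y:ℂ)
      have := min_le_right δ 1
      linarith
    have hd := hunif (zz ζ) (mem_closedBall_zero_iff.mpr hz2) (y:ℂ)
      (mem_closedBall_zero_iff.mpr (by linarith))
      (by rw [dist_eq_norm]; linarith [min_le_left δ 1])
    have hpy : ‖Polynomial.aeval (y:ℂ) p‖ = |p.eval y| := by
      rw [show (y:ℂ) = algebraMap ℝ ℂ y from rfl, Polynomial.aeval_algebraMap_apply,
        Polynomial.coe_aeval_eq_eval, Complex.coe_algebraMap, Complex.norm_real, Real.norm_eq_abs]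
    have hpz : ‖Polynomial.aeval (zz ζ) p‖ ≤ |p.eval y| + ε := by
      rw [dist_eq_norm] at hd
      have := norm_sub_norm_le (Polynomial.aeval (zz ζ) p) (Polynomial.aeval (y:ℂ) p)
      linarith
    rw [hGn ζ hζ0]
    have hE : -(n * lam * (FF lam ζ).re) ≤ -(n * Real.log ‖ζ‖) + -(n * lam * (|y| ^ lam * KK lam)) := by
      have h1 : (n * lam : ℝ) * (Real.log ‖ζ‖ / lam + |y| ^ lam * KK lam) ≤
          n * lam * (FF lam ζ).re := by
        apply mul_le_mul_of_nonneg_left _ (by positivity)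
        linarith
      have h2 : (n * lam : ℝ) * (Real.log ‖ζ‖ / lam + |y| ^ lam * KK lam) =
          n * Real.log ‖ζ‖ + n * lam * (|y| ^ lam * KK lam) := by field_simp
      linarith
    have hexp : ‖ζ‖ ^ n * Real.exp (-(n * Real.log ‖ζ‖)) = 1 := by
      rw [Real.exp_neg, Real.exp_nat_mul, Real.exp_log (by linarith)]
      exact mul_inv_cancel₀ (pow_ne_zero _ (by linarith))
    have hE2 : 0 ≤ n * lam * (|y| ^ lam * KK lam) := by
      have := KK_nonneg lam
      have := Real.rpow_nonneg (abs_nonneg y) lam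
      positivity
    calc ‖ζ‖ ^ n * ‖Polynomial.aeval (zz ζ) p‖ * Real.exp (-(n * lam * (FF lam ζ).re))
        ≤ ‖ζ‖ ^ n * ‖Polynomial.aeval (zz ζ) p‖ *
          (Real.exp (-(n * Real.log ‖ζ‖)) * Real.exp (-(n * lam * (|y| ^ lam * KK lam)))) := by
          rw [← Real.exp_add]
          gcongr
      _ = (‖ζ‖ ^ n * Real.exp (-(n * Real.log ‖ζ‖))) * (‖Polynomial.aeval (zz ζ) p‖ *
          Real.exp (-(n * lam * (|y| ^ lam * KK lam)))) := by ring
      _ = ‖Polynomial.aeval (zz ζ) p‖ * Real.exp (-(n * lam * (|y| ^ lam * KK lam))) := by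
          rw [hexp, one_mul]
      _ ≤ (M * Real.exp (n * lam * (|y| ^ lam * KK lam)) + ε) *
          Real.exp (-(n * lam * (|y| ^ lam * KK lam))) := by
          gcongr
          linarith [hM y hy1]
      _ = M * (Real.exp (n * lam * (|y| ^ lam * KK lam)) *
          Real.exp (-(n * lam * (|y| ^ lam * KK lam)))) +
          ε * Real.exp (-(n * lam * (|y| ^ lam * KK lam))) := by ring
      _ = M + ε * Real.exp (-(n * lam * (|y| ^ lam * KK lam))) := by
          rw [← Real.exp_add, add_neg_cancel, Real.exp_zero, mul_one]
      _ ≤ M + ε := by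
          have : Real.exp (-(n * lam * (|y| ^ lam * KK lam))) ≤ 1 := by
            rw [Real.exp_le_one_iff]; linarith
          nlinarith
  -- conclusion at x
  have hzx : zz (r:ℂ) = (x:ℂ) := by rw [zz, ← hrx]; push_cast; rfl
  have hpx : ‖Polynomial.aeval (zz (r:ℂ)) p‖ = |p.eval x| := by
    rw [hzx, show (x:ℂ) = algebraMap ℝ ℂ x from rfl, Polynomial.aeval_algebraMap_apply,
      Polynomial.coe_aeval_eq_eval, Complex.coe_algebraMap, Complex.norm_real, Real.norm_eq_abs]
  have hF := FF_le lam hlam r hr0 hr1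
  rw [hrx] at hF
  have hF2 := gg_V_le lam hlam x hx.le
  rw [hGn _ hr0C, hpx, hrn, Real.exp_neg, ← div_eq_mul_inv, div_le_iff₀ (Real.exp_pos _)] at hmax
  have hM0 : 0 ≤ M := by
    have h1 := hM 0 (by simp)
    have h2 := (abs_nonneg _).trans h1
    exact nonneg_of_mul_nonneg_left h2 (Real.exp_pos _)
  have hE : n * lam * (FF lam (r:ℂ)).re ≤ n * Real.log r + n * lam * (x ^ lam * KK lam) := by
    have h1 : n * lam * (FF lam (r:ℂ)).re ≤ (n * lam : ℝ) * (Real.log r / lam + x ^ lam * KK lam) := by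
      apply mul_le_mul_of_nonneg_left _ (by positivity)
      linarith
    have h2 : (n * lam : ℝ) * (Real.log r / lam + x ^ lam * KK lam) =
        n * Real.log r + n * lam * (x ^ lam * KK lam) := by field_simp
    linarith
  have h3 : r ^ n * |p.eval x| ≤ M * (r ^ n * Real.exp (n * lam * (x ^ lam * KK lam))) := by
    refine hmax.trans ?_
    apply mul_le_mul_of_nonneg_left _ hM0
    rw [← Real.exp_log hr0, ← Real.exp_nat_mul, ← Real.exp_add, Real.exp_le_exp, Real.exp_log hr0]
    exact hE
  have hrn0 : 0 < r ^ n := by positivity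
  rw [mul_left_comm] at h3
  exact le_of_mul_le_mul_left h3 hrn0

lemma core_both (lam : ℝ) (hlam : 1 ≤ lam) (n : ℕ) (p : Polynomial ℝ) (hp : p.natDegree ≤ n) (M : ℝ)
    (hM : ∀ t : ℝ, |t| ≤ 1 → |p.eval t| ≤ M * Real.exp (n * lam * (|t| ^ lam * KK lam)))
    (x : ℝ) : |p.eval x| ≤ M * Real.exp (n * lam * (|x| ^ lam * KK lam)) := by
  by_cases h : |x| ≤ 1
  · exact hM x h
  push Not at h
  rcases le_total 0 x with hx | hx
  · rw [abs_of_nonneg hx] at h ⊢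
    exact core lam hlam n p hp M hM x h
  · rw [abs_of_nonpos hx] at h ⊢
    have := core lam hlam n (p.comp (-Polynomial.X)) (by
      rw [Polynomial.natDegree_comp, Polynomial.natDegree_neg, Polynomial.natDegree_X, mul_one]
      exact hp) M (fun t ht => by
      have := hM (-t) (by rwa [abs_neg])
      rw [abs_neg] at this
      simpa using this) (-x) h
    simpa using this

lemma general (lam : ℝ) (hlam : 1 ≤ lam) (n : ℕ) (hn : 1 ≤ n) (p : Polynomial ℝ)
    (hp : p.degree ≤ n) (a : ℝ) (ha : a = ((n : ℝ) * (Real.sqrt Real.pi * Real.Gamma (lam/2) /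
      (2 * Real.Gamma ((lam + 1)/2)))) ^ (1/lam)) :
    (⨆ x : ℝ, |p.eval x * Real.exp (-(|x| ^ lam))|) =
        ⨆ x : Set.Icc (-a) a, |p.eval (x : ℝ) * Real.exp (-(|(x : ℝ)| ^ lam))| := by
  have hlam0 : 0 < lam := by linarith
  rw [← KK_eq lam hlam] at ha
  have hK : 0 < lam * KK lam := by
    rw [KK_eq lam hlam]
    have h1 := Real.Gamma_pos_of_pos (show 0 < lam / 2 by linarith)
    have h2 := Real.Gamma_pos_of_pos (show 0 < (lam + 1) / 2 by linarith)
    have := Real.pi_pos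
    positivity
  have hn0 : (0:ℝ) < n := by exact_mod_cast hn
  have ha0 : 0 < a := by rw [ha]; positivity
  have hal : a ^ lam = n * (lam * KK lam) := by
    rw [ha, ← Real.rpow_mul (by positivity), one_div_mul_cancel hlam0.ne', Real.rpow_one]
  have hcont : Continuous (fun x : ℝ => |p.eval x * Real.exp (-(|x| ^ lam))|) := by
    have : Continuous (fun x : ℝ => |x| ^ lam) := continuous_abs.rpow_const (fun _ => Or.inr hlam0.le)
    fun_prop
  have hbdd : BddAbove (range fun x : Set.Icc (-a) a =>
      |p.eval (x : ℝ) * Real.exp (-(|(x : ℝ)| ^ lam))|) := by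
    have := (isCompact_Icc (a := -a) (b := a)).bddAbove_image hcont.continuousOn
    rwa [image_eq_range] at this
  set M := ⨆ x : Set.Icc (-a) a, |p.eval (x : ℝ) * Real.exp (-(|(x : ℝ)| ^ lam))| with hMdef
  have hIcc : ∀ x : ℝ, |x| ≤ a → |p.eval x * Real.exp (-(|x| ^ lam))| ≤ M := fun x hx =>
    le_ciSup hbdd ⟨x, abs_le.mp hx⟩
  have hscale : ∀ t : ℝ, |a * t| ^ lam = n * lam * (|t| ^ lam * KK lam) := by
    intro t
    rw [abs_mul, abs_of_pos ha0, Real.mul_rpow ha0.le (abs_nonneg _), hal]; ring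
  have hdeg : (p.comp (Polynomial.C a * Polynomial.X)).natDegree ≤ n := by
    refine Polynomial.natDegree_comp_le.trans ?_
    have h1 := Polynomial.natDegree_le_of_degree_le hp
    have h2 := (Polynomial.natDegree_C_mul_le a Polynomial.X).trans Polynomial.natDegree_X_le
    nlinarith
  have hall : ∀ x : ℝ, |p.eval x * Real.exp (-(|x| ^ lam))| ≤ M := by
    intro x
    have key := core_both lam hlam n (p.comp (Polynomial.C a * Polynomial.X)) hdeg M (fun t ht => by
      have h1 := hIcc (a * t) (by rw [abs_mul, abs_of_pos ha0]; nlinarith)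
      rw [hscale, abs_mul, Real.abs_exp, Real.exp_neg, ← div_eq_mul_inv,
        div_le_iff₀ (Real.exp_pos _)] at h1
      simpa using h1) (x / a)
    rw [← hscale, mul_div_cancel₀ _ ha0.ne'] at key
    rw [abs_mul, Real.abs_exp, Real.exp_neg, ← div_eq_mul_inv, div_le_iff₀ (Real.exp_pos _)]
    simpa [mul_div_cancel₀ x ha0.ne'] using key
  apply le_antisymm
  · exact ciSup_le hall
  · have : Nonempty (Set.Icc (-a) a) := ⟨⟨0, by constructor <;> linarith⟩⟩
    exact ciSup_le fun x => le_ciSup (f := fun x : ℝ => |p.eval x * Real.exp (-(|x| ^ lam))|)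
      ⟨M, by rintro _ ⟨y, rfl⟩; exact hall y⟩ (x : ℝ)

/-- **Restricted range equality for Freud weights.**
Let `λ ≥ 1`, `w_λ(x) = exp(−|x|^λ)`, `γ_λ = √π Γ(λ/2)/(2 Γ((λ+1)/2))` and
`a_n = (n γ_λ)^{1/λ}`. Then for `n ≥ 1` and every real polynomial `p` of
degree at most `n`,
`sup_{x∈ℝ} |p(x) w_λ(x)| = sup_{x∈[−a_n,a_n]} |p(x) w_λ(x)|`.
In particular `sup_{x∈ℝ} |p(x) e^{−x²}| = sup_{x∈[−√n,√n]} |p(x) e^{−x²}|`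
and `sup_{x∈ℝ} |p(x) e^{−|x|}| = sup_{x∈[−πn/2,πn/2]} |p(x) e^{−|x|}|`. -/
theorem freud_restricted_range (lam : ℝ) (hlam : 1 ≤ lam) (n : ℕ)
    (hn : 1 ≤ n) (p : Polynomial ℝ) (hp : p.degree ≤ n) :
    let γ : ℝ := Real.sqrt Real.pi * Real.Gamma (lam/2) /
      (2 * Real.Gamma ((lam + 1)/2))
    let a : ℝ := ((n : ℝ) * γ) ^ (1/lam)
    ((⨆ x : ℝ, |p.eval x * Real.exp (-(|x| ^ lam))|) =
        ⨆ x : Set.Icc (-a) a,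
          |p.eval (x : ℝ) * Real.exp (-(|(x : ℝ)| ^ lam))|) ∧
      ((⨆ x : ℝ, |p.eval x * Real.exp (-(x ^ 2))|) =
        ⨆ x : Set.Icc (-(Real.sqrt n)) (Real.sqrt n),
          |p.eval (x : ℝ) * Real.exp (-((x : ℝ) ^ 2))|) ∧
      (⨆ x : ℝ, |p.eval x * Real.exp (-|x|)|) =
        ⨆ x : Set.Icc (-(Real.pi * n / 2)) (Real.pi * n / 2),
          |p.eval (x : ℝ) * Real.exp (-|(x : ℝ)|)| := by
  intro γ a
  refine ⟨general lam hlam n hn p hp a rfl, ?_, ?_⟩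
  · have h := general 2 one_le_two n hn p hp (Real.sqrt n) (by
      rw [show ((2:ℝ) + 1) / 2 = 1 / 2 + 1 by norm_num, Real.Gamma_add_one (by norm_num),
        Real.Gamma_one_half_eq, div_self two_ne_zero, Real.Gamma_one, Real.sqrt_eq_rpow (n:ℝ)]
      congr 1
      have : Real.sqrt Real.pi ≠ 0 := (Real.sqrt_pos.mpr Real.pi_pos).ne'
      field_simp)
    simpa only [Real.rpow_two, sq_abs] using h
  · have h := general 1 le_rfl n hn p hp (Real.pi * n / 2) (by
      rw [show ((1:ℝ) + 1) / 2 = 1 by norm_num, Real.Gamma_one_half_eq, Real.Gamma_one,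
        Real.mul_self_sqrt Real.pi_pos.le, div_one, Real.rpow_one]
      ring)
    simpa only [Real.rpow_one] using h
end

section
/- Let w : ℝ → (0, 1] be a continuous even weight with x ↦ log(1/w(eˣ)) convex on ℝ and lim_{|x|→∞} xⁿ w(x) = 0 for every nonnegative integer n. Then Bernstein's approximation problem for w has a positive answer — i.e., for every continuous f : ℝ → ℝ with lim_{|x|→∞} f(x) w(x) = 0 there exists a sequence of real polynomials (S_n) with lim_{n→∞} sup_{x∈ℝ} |(f(x) − S_n(x)) w(x)| = 0 — if and only if ∫₀^∞ log(1/w(t)) / (1 + t²) dt = ∞. -/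
namespace Bern

open Filter Topology MeasureTheory


/-- The Bang propagation step. -/
lemma bang_step {E : Type*} [NormedAddCommGroup E] [NormedSpace ℝ E]
    (f : ℕ → ℝ → E) (hf : ∀ n x, HasDerivAt (f n) (f (n+1) x) x)
    (M : ℕ → ℝ) (hM : ∀ n, 0 < M n) (hmono : Monotone fun n => M (n+1) / M n)
    (hb : ∀ n x, ‖f n x‖ ≤ M n) (N : ℕ) (x : ℝ)
    (hx : ∀ n ≤ N + 1, ‖f n x‖ ≤ Real.exp ((n:ℝ) - (N + 1)) * M n)
    (h : ℝ) (h0 : 0 ≤ h) (h1 : h ≤ Real.exp (-1) * (M N / M (N+1))) :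
    ∀ n ≤ N, ‖f n (x + h)‖ ≤ Real.exp ((n:ℝ) - N) * M n := by
  set m := M (N+1) / M N with hm
  have hmpos : 0 < m := div_pos (hM _) (hM _)
  have key : ∀ k n, n + k = N + 1 → ∀ s, 0 ≤ s →
      ‖f n (x + s)‖ ≤ Real.exp ((n:ℝ) - (N + 1)) * M n * Real.exp (Real.exp 1 * m * s) := by
    intro k
    induction k with
    | zero =>
      intro n hn s hs
      have hn' : n = N + 1 := by omega
      subst hn'
      have e1 : Real.exp (((N+1:ℕ):ℝ) - (N + 1)) = 1 := by push_cast; simp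
      rw [e1, one_mul]
      refine (hb _ _).trans ?_
      have : 1 ≤ Real.exp (Real.exp 1 * m * s) := Real.one_le_exp (by positivity)
      nlinarith [hM (N+1)]
    | succ k ih =>
      intro n hn s hs
      have ih' := ih (n+1) (by omega)
      have hder : ∀ y, HasDerivAt (fun s => f n (x + s)) (f (n+1) (x + y)) y := by
        intro y
        exact (hf n (x+y)).comp_const_add x y
      have hmn : M (n+1) ≤ m * M n := by
        have := hmono (show n ≤ N by omega)
        simp only at this
        rwa [div_le_iff₀ (hM n)] at this
      refine image_norm_le_of_norm_deriv_right_le_deriv_boundary (a := 0) (b := s)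
        (f := fun s => f n (x + s)) (f' := fun s => f (n+1) (x + s))
        (B := fun s => Real.exp ((n:ℝ) - (N + 1)) * M n * Real.exp (Real.exp 1 * m * s))
        (B' := fun s => Real.exp ((n:ℝ) - (N + 1)) * M n *
          (Real.exp (Real.exp 1 * m * s) * (Real.exp 1 * m)))
        (fun y _ => (hder y).continuousAt.continuousWithinAt)
        (fun y _ => (hder y).hasDerivWithinAt) ?_ ?_ ?_ ⟨hs, le_rfl⟩
      · simpa using hx n (by omega)
      · intro y
        have : HasDerivAt (fun s : ℝ => Real.exp 1 * m * s) (Real.exp 1 * m) y := by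
          simpa using (hasDerivAt_id y).const_mul (Real.exp 1 * m)
        exact (this.exp).const_mul _
      · intro y hy
        refine (ih' y hy.1).trans ?_
        have e1 : Real.exp (((n+1:ℕ):ℝ) - (N + 1)) = Real.exp ((n:ℝ) - (N + 1)) * Real.exp 1 := by
          rw [← Real.exp_add]; push_cast; ring_nf
        rw [e1]
        calc _ ≤ Real.exp ((n:ℝ) - (N + 1)) * Real.exp 1 * (m * M n)
              * Real.exp (Real.exp 1 * m * y) := by gcongr
          _ = _ := by ring
  intro n hn
  refine (key (N + 1 - n) n (by omega) h h0).trans ?_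
  have h2 : Real.exp 1 * m * h ≤ 1 := by
    calc _ ≤ Real.exp 1 * m * (Real.exp (-1) * (M N / M (N+1))) := by gcongr
      _ = (Real.exp 1 * Real.exp (-1)) * (m * (M N / M (N+1))) := by ring
      _ = 1 := by
        rw [← Real.exp_add, hm]
        have := (hM N).ne'
        have := (hM (N+1)).ne'
        simp; field_simp
  calc _ ≤ Real.exp ((n:ℝ) - (N + 1)) * M n * Real.exp 1 := by
        have := hM n
        gcongr
    _ = _ := by
      rw [mul_right_comm, ← Real.exp_add]; ring_nf

/-- Denjoy–Carleman via Bang. -/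
lemma bang {E : Type*} [NormedAddCommGroup E] [NormedSpace ℝ E]
    (f : ℕ → ℝ → E) (hf : ∀ n x, HasDerivAt (f n) (f (n+1) x) x)
    (M : ℕ → ℝ) (hM : ∀ n, 0 < M n) (hmono : Monotone fun n => M (n+1) / M n)
    (hb : ∀ n x, ‖f n x‖ ≤ M n) (hdiv : ¬ Summable fun n => M n / M (n+1))
    (h0 : ∀ n, f n 0 = 0) (x : ℝ) (hx : 0 ≤ x) : f 0 x = 0 := by
  have hr : ∀ n, 0 ≤ Real.exp (-1) * (M n / M (n+1)) := fun n =>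
    mul_nonneg (Real.exp_pos _).le (div_pos (hM _) (hM _)).le
  have key : ∀ j k, ∀ y, 0 ≤ y →
      y ≤ ∑ i ∈ Finset.range j, Real.exp (-1) * (M (k+i) / M (k+i+1)) →
      ∀ n ≤ k, ‖f n y‖ ≤ Real.exp ((n:ℝ) - k) * M n := by
    intro j
    induction j with
    | zero =>
      intro k y hy0 hy1 n hn
      have : y = 0 := le_antisymm (by simpa using hy1) hy0
      rw [this, h0]; simp only [norm_zero]
      exact mul_nonneg (Real.exp_pos _).le (hM n).le
    | succ j ih =>
      intro k y hy0 hy1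
      rw [Finset.sum_range_succ'] at hy1
      set r := Real.exp (-1) * (M k / M (k+1)) with hrdef
      have h2 := ih (k+1) (max 0 (y - r)) (le_max_left _ _) (by
        apply max_le
        · exact Finset.sum_nonneg fun i _ => hr _
        · have : ∑ i ∈ Finset.range j, Real.exp (-1) * (M (k+1+i) / M (k+1+i+1)) =
            ∑ i ∈ Finset.range j, Real.exp (-1) * (M (k+(i+1)) / M (k+(i+1)+1)) := by
            refine Finset.sum_congr rfl fun i _ => ?_
            rw [show k + 1 + i = k + (i+1) by ring]
          rw [this]; simp only [add_zero] at hy1; linarith)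
      have h3 := bang_step f hf M hM hmono hb k (max 0 (y - r)) (by
        intro n hn; have := h2 n hn; push_cast at this; exact this) (y - max 0 (y - r))
        (by have := hr k; simp only [sub_nonneg]; apply max_le hy0; linarith)
        (by have := le_max_right 0 (y - r); linarith)
      simpa using h3
  have key2 : ∀ k : ℕ, ‖f 0 x‖ ≤ Real.exp (-(k:ℝ)) * M 0 := by
    intro k
    have hd : ¬ Summable fun i => Real.exp (-1) * (M (k+i) / M (k+i+1)) := by
      intro hs
      apply hdiv
      have h1 := (summable_mul_left_iff (Real.exp_pos (-1)).ne').1 hs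
      rw [← summable_nat_add_iff k]
      simpa [add_comm, add_left_comm] using h1
    rw [not_summable_iff_tendsto_nat_atTop_of_nonneg (fun i => hr _)] at hd
    obtain ⟨j, hj⟩ := (hd.eventually_ge_atTop x).exists
    simpa using key j k x hx hj 0 (Nat.zero_le _)
  have : Tendsto (fun k : ℕ => Real.exp (-(k:ℝ)) * M 0) atTop (𝓝 (0 * M 0)) :=
    (Real.tendsto_exp_neg_atTop_nhds_zero.comp tendsto_natCast_atTop_atTop).mul_const _
  rw [zero_mul] at this
  exact norm_le_zero_iff.1 (ge_of_tendsto' this key2)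


lemma exists_moments (w : ℝ → ℝ)
    (hw_pos : ∀ x, 0 < w x) 
    (hw_cont : Continuous w) 
    (hdecay : ∀ n : ℕ,
      Tendsto (fun x => x ^ n * w x) (cocompact ℝ) (nhds 0)) :
    ∃ M : ℕ → ℝ, (∀ n, 0 < M n) ∧ (Monotone fun n => M (n+1) / M n) ∧
      (∀ n t, |t| ^ n * w t ≤ M n) ∧ (∀ n C, (∀ t, |t| ^ n * w t ≤ C) → M n ≤ C) := by
  have hbdd : ∀ n, ∃ C, ∀ t, |t| ^ n * w t ≤ C := by
    intro n
    let F : BoundedContinuousFunction ℝ ℝ := (⟨⟨fun x => x ^ n * w x, by fun_prop⟩, hdecay n⟩ :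
      ZeroAtInftyContinuousMap ℝ ℝ).toBCF
    refine ⟨‖F‖, fun t => ?_⟩
    have : ‖t ^ n * w t‖ ≤ ‖F‖ := F.norm_coe_le_norm t
    rwa [Real.norm_eq_abs, abs_mul, abs_pow, abs_of_pos (hw_pos t)] at this
  have hb : ∀ n, BddAbove (Set.range fun t => |t| ^ n * w t) := by
    intro n
    obtain ⟨C, hC⟩ := hbdd n
    exact ⟨C, by rintro _ ⟨t, rfl⟩; exact hC t⟩
  have hle : ∀ n t, |t| ^ n * w t ≤ ⨆ t, |t| ^ n * w t := fun n t => le_ciSup (hb n) t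
  have hpos : ∀ n, 0 < ⨆ t, |t| ^ n * w t := by
    intro n
    refine lt_of_lt_of_le ?_ (hle n 1)
    simpa using hw_pos 1
  refine ⟨fun n => ⨆ t, |t| ^ n * w t, hpos, ?_, hle, fun n C h => ciSup_le h⟩
  apply monotone_nat_of_le_succ
  intro n
  simp only
  rw [div_le_div_iff₀ (hpos _) (hpos _)]
  set A := ⨆ t, |t| ^ (n+1) * w t with hA
  set B := ⨆ t, |t| ^ n * w t with hB
  set D := ⨆ t, |t| ^ (n+1+1) * w t with hD
  have h0 : A ≤ Real.sqrt (D * B) := by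
    refine ciSup_le fun t => ?_
    apply Real.le_sqrt_of_sq_le
    have h1 := hle n t
    have h2 := hle (n+2) t
    have hw := (hw_pos t).le
    calc (|t| ^ (n+1) * w t) ^ 2 = (|t| ^ (n+2) * w t) * (|t| ^ n * w t) := by ring
      _ ≤ D * B := by
        apply mul_le_mul h2 h1 (by positivity) (hpos _).le
  calc A * A = A ^ 2 := by ring
    _ ≤ Real.sqrt (D * B) ^ 2 := by
      gcongr
      exact (hpos _).le
    _ = D * B := Real.sq_sqrt (mul_pos (hpos _) (hpos _)).le

lemma exists_subgrad (φ : ℝ → ℝ) (h : ConvexOn ℝ Set.univ φ) (x : ℝ) :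
    ∃ s, ∀ y, φ x + s * (y - x) ≤ φ y := by
  have hx : x ∈ interior (Set.univ : Set ℝ) := by simp
  refine ⟨derivWithin φ (Set.Ioi x) x, fun y => ?_⟩
  rcases lt_trichotomy y x with hy | rfl | hy
  · have h1 := h.leftDeriv_le_rightDeriv_of_mem_interior hx
    have h2 := h.slope_le_leftDeriv_of_mem_interior (Set.mem_univ y) hx hy
    have h3 := h2.trans h1
    rw [slope_def_field, div_le_iff₀ (by linarith)] at h3
    nlinarith
  · simp
  · have h2 := h.rightDeriv_le_slope_of_mem_interior hx (Set.mem_univ y) hy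
    rw [slope_def_field, le_div_iff₀ (by linarith)] at h2
    nlinarith

lemma moment_le (w : ℝ → ℝ)
    (hw_pos : ∀ x, 0 < w x) (hw_le : ∀ x, w x ≤ 1)
    (hw_cont : Continuous w) (hw_even : ∀ x, w (-x) = w x)
    (hconv : ConvexOn ℝ Set.univ (fun x => Real.log (1 / w (Real.exp x))))
    (M : ℕ → ℝ) (hM2 : ∀ n C, (∀ t, |t| ^ n * w t ≤ C) → M n ≤ C) (x0 : ℝ) (hx0 : 0 ≤ x0) :
    ∃ n, M n ≤ 1 / w 1 * (w (Real.exp x0) * Real.exp ((n + 1) * x0)) := by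
  obtain ⟨s, hs⟩ := exists_subgrad _ hconv x0
  simp only [one_div, Real.log_inv] at hs
  have hs0 : 0 ≤ s := by
    by_contra hneg
    push Not at hneg
    obtain ⟨z, -, hz⟩ := (isCompact_Icc (a := (0:ℝ)) (b := 1)).exists_isMinOn
      ⟨0, by simp⟩ hw_cont.continuousOn
    have hB : ∀ y ≤ 0, -Real.log (w (Real.exp y)) ≤ -Real.log (w z) := by
      intro y hy
      have : w z ≤ w (Real.exp y) := hz ⟨(Real.exp_pos y).le, Real.exp_le_one_iff.2 hy⟩
      have := Real.log_le_log (hw_pos _) this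
      linarith
    set B := -Real.log (w z)
    have hB0 : 0 ≤ B := by
      have := Real.log_nonpos (hw_pos z).le (hw_le z)
      simp only [B]; linarith
    have h1 := hs (-|x0| + (B+1) / s)
    have h2 := hB (-|x0| + (B+1) / s) (by
      have : (B+1)/s ≤ 0 := div_nonpos_of_nonneg_of_nonpos (by linarith) hneg.le
      have := abs_nonneg x0
      linarith)
    have h3 := Real.log_nonpos (hw_pos (Real.exp x0)).le (hw_le _)
    have h4 : s * (-|x0| + (B+1) / s - x0) = s * (-|x0| - x0) + (B + 1) := by
      field_simp [hneg.ne]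
      ring
    have h5 : 0 ≤ s * (-|x0| - x0) := mul_nonneg_of_nonpos_of_nonpos hneg.le (by
      have := neg_abs_le x0; linarith)
    linarith
  refine ⟨⌊s⌋₊, hM2 _ _ ?_⟩
  set n := ⌊s⌋₊
  have hn1 : (n:ℝ) ≤ s := Nat.floor_le hs0
  have hn2 : s < n + 1 := Nat.lt_floor_add_one s
  have key : ∀ τ : ℝ, 1 ≤ τ → τ ^ n * w τ ≤ w (Real.exp x0) * Real.exp ((n + 1) * x0) := by
    intro τ hτ
    have hτ0 : 0 < τ := by linarith
    have h1 := hs (Real.log τ)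
    rw [Real.exp_log hτ0] at h1
    have hy := Real.log_nonneg hτ
    have e1 : τ ^ n * w τ = Real.exp (n * Real.log τ + Real.log (w τ)) := by
      rw [Real.exp_add, Real.exp_log (hw_pos _), Real.exp_nat_mul, Real.exp_log hτ0]
    have e2 : w (Real.exp x0) * Real.exp ((n + 1) * x0) =
        Real.exp (Real.log (w (Real.exp x0)) + (n + 1) * x0) := by
      rw [Real.exp_add, Real.exp_log (hw_pos _)]
    rw [e1, e2]
    apply Real.exp_le_exp.2
    nlinarith
  have hC : 1 ≤ 1 / w 1 := by rw [le_div_iff₀ (hw_pos 1)]; simpa using hw_le 1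
  have hR : 0 < w (Real.exp x0) * Real.exp ((n + 1) * x0) := mul_pos (hw_pos _) (Real.exp_pos _)
  intro t
  have hwt : w t = w |t| := by
    rcases abs_choice t with h | h <;> rw [h]
    rw [hw_even]
  rw [hwt]
  rcases le_total 1 |t| with h | h
  · refine (key _ h).trans ?_
    nlinarith
  · have h1 : |t| ^ n * w |t| ≤ 1 := 
      mul_le_one₀ (pow_le_one₀ (abs_nonneg _) h) (hw_pos _).le (hw_le _)
    have h2 := key 1 le_rfl
    rw [one_pow, one_mul] at h2
    refine h1.trans ?_
    rw [div_mul_eq_mul_div, le_div_iff₀ (hw_pos 1)]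
    linarith

noncomputable def gg (u : ℝ) : ℝ := if 1 ≤ u then 2 * u ^ (1/2:ℝ) else 0

lemma gg_nonneg (u : ℝ) : 0 ≤ gg u := by
  unfold gg; split_ifs with h
  · positivity
  · rfl

lemma log_le_gg (u : ℝ) (hu : 0 < u) : Real.log u ≤ gg u := by
  unfold gg; split_ifs with h
  · have := Real.log_le_rpow_div hu.le (show (0:ℝ) < 1/2 by norm_num)
    linarith
  · exact Real.log_nonpos hu.le (by linarith)

lemma gg_meas : Measurable gg := by
  unfold gg
  refine Measurable.ite measurableSet_Ici (by fun_prop) measurable_const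

lemma lint_gg (r : ℝ) (hr : 0 < r) :
    ∫⁻ t in Set.Ioi (1:ℝ), ENNReal.ofReal (gg (t * r) / t ^ 2) ≤ ENNReal.ofReal (4 * r) := by
  have hr' : 0 < 1 / r := by positivity
  calc _ ≤ ∫⁻ t, (Set.Ici (1/r)).indicator 
        (fun t => ENNReal.ofReal (2 * r ^ (1/2:ℝ) * t ^ (-3/2:ℝ))) t := by
        rw [← lintegral_indicator measurableSet_Ioi]
        refine lintegral_mono fun t => ?_
        by_cases h : 1/r ≤ t
        · have ht : 0 < t := hr'.trans_le h
          rw [Set.indicator_of_mem (show t ∈ Set.Ici (1/r) from h)]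
          refine (Set.indicator_le_self' (by simp) _).trans ?_
          apply ENNReal.ofReal_le_ofReal
          have : 1 ≤ t * r := by rwa [div_le_iff₀ hr] at h
          unfold gg
          rw [if_pos this, Real.mul_rpow ht.le hr.le, div_eq_mul_inv, ← Real.rpow_natCast,
            ← Real.rpow_neg ht.le]
          have : t ^ (-3/2:ℝ) = t ^ (1/2:ℝ) * t ^ (-((2:ℕ):ℝ)) := by
            rw [← Real.rpow_add ht]; norm_num
          rw [this]; apply le_of_eq; ring
        · rw [Set.indicator_of_notMem (show t ∉ Set.Ici (1/r) from h)]
          by_cases h1 : t ∈ Set.Ioi (1:ℝ)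
          · rw [Set.indicator_of_mem h1]
            have : ¬ 1 ≤ t * r := by rwa [div_le_iff₀ hr] at h
            simp [gg, this]
          · rw [Set.indicator_of_notMem h1]
    _ = ∫⁻ t in Set.Ioi (1/r), ENNReal.ofReal (2 * r ^ (1/2:ℝ) * t ^ (-3/2:ℝ)) := by
        rw [lintegral_indicator measurableSet_Ici, setLIntegral_congr Ioi_ae_eq_Ici.symm]
    _ = ENNReal.ofReal (∫ t in Set.Ioi (1/r), 2 * r ^ (1/2:ℝ) * t ^ (-3/2:ℝ)) := by
        rw [ofReal_integral_eq_lintegral_ofReal]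
        · exact (integrableOn_Ioi_rpow_of_lt (by norm_num) hr').const_mul _
        · filter_upwards [ae_restrict_mem measurableSet_Ioi] with t ht
          have : 0 < t := hr'.trans ht
          simp only [Pi.zero_apply]
          positivity
    _ = ENNReal.ofReal (4 * r) := by
        rw [integral_const_mul, integral_Ioi_rpow_of_lt (by norm_num) hr']
        congr 1
        have h1 : (1 / r) ^ (-3/2 + 1 : ℝ) = r ^ (1/2:ℝ) := by
          rw [one_div, Real.inv_rpow hr.le, ← Real.rpow_neg hr.le]; norm_num
        have h2 : r ^ (1/2:ℝ) * r ^ (1/2:ℝ) = r := by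
          rw [← Real.rpow_add hr]; norm_num
        rw [h1]
        linear_combination 4 * h2

lemma diverges (w : ℝ → ℝ)
    (hw_pos : ∀ x, 0 < w x) (hw_le : ∀ x, w x ≤ 1)
    (hw_cont : Continuous w) (hw_even : ∀ x, w (-x) = w x)
    (hconv : ConvexOn ℝ Set.univ (fun x => Real.log (1 / w (Real.exp x))))
    (M : ℕ → ℝ) (hM : ∀ n, 0 < M n) (hM2 : ∀ n C, (∀ t, |t| ^ n * w t ≤ C) → M n ≤ C)
    (hIntTop : ∫⁻ t in Set.Ioi (0:ℝ),
        ENNReal.ofReal (Real.log (1 / w t) / (1 + t ^ 2)) = ⊤) :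
    ¬ Summable fun n => M n / M (n+1) := by
  intro hsum
  have hr : ∀ n, 0 < M n / M (n+1) := fun n => div_pos (hM _) (hM _)
  have hprod : ∀ n, Real.log (M n) = Real.log (M 0) - 
      ∑ j ∈ Finset.range n, Real.log (M j / M (j+1)) := by
    intro n
    induction n with
    | zero => simp
    | succ n ih =>
      rw [Finset.sum_range_succ, Real.log_div (hM _).ne' (hM _).ne']
      linarith
  set K := |Real.log (1 / w 1) - Real.log (M 0)| with hK
  have hpt : ∀ t ∈ Set.Ioi (1:ℝ), ENNReal.ofReal (Real.log (1 / w t) / (1 + t ^ 2)) ≤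
      ENNReal.ofReal (K * t ^ (-2:ℝ)) + ENNReal.ofReal (gg (t * 1) / t ^ 2) +
       ∑' j, ENNReal.ofReal (gg (t * (M j / M (j+1))) / t ^ 2) := by
    intro t ht
    have ht1 : 1 < t := ht
    have ht0 : 0 < t := by linarith
    obtain ⟨n, hn⟩ := moment_le w hw_pos hw_le hw_cont hw_even hconv M hM2 (Real.log t)
      (Real.log_nonneg ht1.le)
    rw [Real.exp_log ht0] at hn
    have h1 := Real.log_le_log (hM n) hn
    rw [Real.log_mul (by have := hw_pos 1; positivity) (by have := hw_pos t; positivity),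
      Real.log_mul (hw_pos t).ne' (Real.exp_pos _).ne', Real.log_exp, hprod] at h1
    have h2 : Real.log (1 / w t) ≤ K + gg (t * 1) +
        ∑ j ∈ Finset.range n, gg (t * (M j / M (j+1))) := by
      have h3 : ∑ j ∈ Finset.range n, Real.log (t * (M j / M (j+1))) ≤
          ∑ j ∈ Finset.range n, gg (t * (M j / M (j+1))) :=
        Finset.sum_le_sum fun j _ => log_le_gg _ (mul_pos ht0 (hr j))
      have h4 : ∑ j ∈ Finset.range n, Real.log (t * (M j / M (j+1))) =
          n * Real.log t + ∑ j ∈ Finset.range n, Real.log (M j / M (j+1)) := by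
        rw [Finset.sum_congr rfl fun j _ => Real.log_mul ht0.ne' (hr j).ne',
          Finset.sum_add_distrib]
        simp
      have h5 := log_le_gg (t * 1) (by linarith)
      rw [mul_one] at h5 ⊢
      have h6 := le_abs_self (Real.log (1 / w 1) - Real.log (M 0))
      rw [show Real.log (1 / w t) = - Real.log (w t) by rw [one_div, Real.log_inv]]
      linarith
    have hg : ∀ j, 0 ≤ gg (t * (M j / M (j+1))) / t ^ 2 := fun j =>
      div_nonneg (gg_nonneg _) (by positivity)
    have hg1 : 0 ≤ gg (t * 1) / t ^ 2 := div_nonneg (gg_nonneg _) (by positivity)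
    have hK0 : 0 ≤ K * t ^ (-2:ℝ) := by positivity
    calc _ ≤ ENNReal.ofReal (K * t ^ (-2:ℝ) + gg (t * 1) / t ^ 2 +
          ∑ j ∈ Finset.range n, gg (t * (M j / M (j+1))) / t ^ 2) := by
          apply ENNReal.ofReal_le_ofReal
          have e1 : t ^ (-2:ℝ) = 1 / t ^ 2 := by
            rw [Real.rpow_neg ht0.le, one_div]; norm_cast
          rw [e1, ← Finset.sum_div, mul_one_div, ← add_div, ← add_div]
          have : 0 ≤ Real.log (1 / w t) := Real.log_nonneg (by
            rw [le_div_iff₀ (hw_pos t)]; simpa using hw_le t)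
          apply div_le_div₀ (this.trans h2) h2 (by positivity) (by linarith)
      _ ≤ _ := by
          rw [ENNReal.ofReal_add (by positivity) (Finset.sum_nonneg fun j _ => hg j),
            ENNReal.ofReal_add hK0 hg1, ENNReal.ofReal_sum_of_nonneg fun j _ => hg j]
          gcongr
          exact ENNReal.sum_le_tsum _
  have hI1 : ∫⁻ t in Set.Ioi (1:ℝ), ENNReal.ofReal (Real.log (1 / w t) / (1 + t ^ 2)) < ⊤ := by
    refine (setLIntegral_mono' measurableSet_Ioi hpt).trans_lt ?_
    have hgm : ∀ r : ℝ, Measurable fun t : ℝ => ENNReal.ofReal (gg (t * r) / t ^ 2) := by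
      intro r
      have := gg_meas
      fun_prop
    rw [lintegral_add_right _ (Measurable.tsum fun j => hgm _), 
      lintegral_add_right _ (hgm 1),
      lintegral_tsum fun j => (hgm _).aemeasurable]
    refine ENNReal.add_lt_top.2 ⟨ENNReal.add_lt_top.2 ⟨?_, ?_⟩, ?_⟩
    · have : IntegrableOn (fun t : ℝ => K * t ^ (-2:ℝ)) (Set.Ioi 1) :=
        (integrableOn_Ioi_rpow_of_lt (by norm_num) one_pos).const_mul _
      exact this.lintegral_lt_top
    · exact (lint_gg 1 one_pos).trans_lt ENNReal.ofReal_lt_top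
    · refine (ENNReal.tsum_le_tsum fun j => lint_gg _ (hr j)).trans_lt ?_
      have := (hsum.mul_left 4).tsum_ofReal_lt_top
      exact this
  have hI0 : ∫⁻ t in Set.Ioc (0:ℝ) 1, ENNReal.ofReal (Real.log (1 / w t) / (1 + t ^ 2)) < ⊤ := by
    have : ContinuousOn (fun t => Real.log (1 / w t) / (1 + t ^ 2)) (Set.Icc 0 1) := by
      apply ContinuousOn.div
      · apply ContinuousOn.log
        · exact (continuous_const.div hw_cont fun x => (hw_pos x).ne').continuousOn
        · intro x _; have := hw_pos x; positivity
      · fun_prop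
      · intro x _; positivity
    exact ((this.integrableOn_Icc).mono_set Set.Ioc_subset_Icc_self).lintegral_lt_top
  rw [← Set.Ioc_union_Ioi_eq_Ioi (zero_le_one (α := ℝ))] at hIntTop
  have := lintegral_union_le (μ := volume) 
    (fun t => ENNReal.ofReal (Real.log (1 / w t) / (1 + t ^ 2))) (Set.Ioc (0:ℝ) 1) (Set.Ioi 1)
  rw [hIntTop] at this
  exact absurd this (not_le.2 (ENNReal.add_lt_top.2 ⟨hI0, hI1⟩))

open scoped ZeroAtInfty

lemma c0_le (u : C₀(ℝ, ℝ)) (x : ℝ) : |u x| ≤ ‖u‖ := u.toBCF.norm_coe_le_norm x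

lemma c0_norm_le (u : C₀(ℝ, ℝ)) (C : ℝ) (hC : 0 ≤ C) (h : ∀ x, |u x| ≤ C) : ‖u‖ ≤ C :=
  (u.toBCF.norm_le hC).2 h

/-- product of a bounded continuous function and a `C₀` function -/
def bm (g : ℝ → ℝ) (hg : Continuous g) (B : ℝ) (hB : ∀ x, |g x| ≤ B) (u : C₀(ℝ, ℝ)) :
    C₀(ℝ, ℝ) where
  toFun x := g x * u x
  continuous_toFun := hg.mul u.continuous
  zero_at_infty' := by
    have h := (zero_at_infty u).norm.const_mul B
    simp only [norm_zero, mul_zero] at h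
    refine squeeze_zero_norm (fun x => ?_) h
    rw [norm_mul]
    exact mul_le_mul_of_nonneg_right (hB x) (norm_nonneg _)

/-- the trigonometric elements -/
noncomputable def el (u : ℕ → C₀(ℝ, ℝ)) (n : ℕ) (θ l : ℝ) : C₀(ℝ, ℝ) :=
  bm (fun t => Real.cos (l * t + θ)) (by fun_prop) 1 (fun _ => Real.abs_cos_le_one _) (u n)

lemma el_apply (u : ℕ → C₀(ℝ, ℝ)) (n : ℕ) (θ l t : ℝ) :
    el u n θ l t = Real.cos (l * t + θ) * u n t := rfl

lemma cos_taylor (a u : ℝ) :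
    |Real.cos (a + u) - Real.cos a - u * Real.cos (a + Real.pi / 2)| ≤ u ^ 2 := by
  rw [Real.cos_add_pi_div_two]
  have hd : ∀ x : ℝ, HasDerivAt (fun x => Real.cos (a + x) + x * Real.sin a)
      (-Real.sin (a + x) + Real.sin a) x := by
    intro x
    have h1 : HasDerivAt (fun x => a + x) 1 x := (hasDerivAt_id x).const_add a
    have h2 := h1.cos
    have h3 := (hasDerivAt_id x).mul_const (Real.sin a)
    exact (h2.add h3).congr_deriv (by simp)
  have := (convex_uIcc 0 u).norm_image_sub_le_of_norm_hasDerivWithin_le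
    (f := fun x => Real.cos (a + x) + x * Real.sin a)
    (f' := fun x => -Real.sin (a + x) + Real.sin a) (C := |u|)
    (fun x _ => (hd x).hasDerivWithinAt) (fun x hx => by
      have h1 : |Real.sin a - Real.sin (a + x)| ≤ |x| := by
        have := Real.lipschitzWith_sin.dist_le_mul a (a + x)
        simpa [Real.dist_eq] using this
      have h2 : |x| ≤ |u| := by
        have := Set.abs_sub_left_of_mem_uIcc hx
        simpa using this
      rw [Real.norm_eq_abs, neg_add_eq_sub]
      exact h1.trans h2) Set.left_mem_uIcc Set.right_mem_uIcc
  simp only [Real.norm_eq_abs, add_zero, zero_mul, sub_zero] at this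
  rw [abs_mul_abs_self] at this
  calc _ = |Real.cos (a + u) + u * Real.sin a - Real.cos a| := by congr 1; ring
    _ ≤ _ := by rw [sq]; exact this

lemma el_hasDerivAt (u : ℕ → C₀(ℝ, ℝ)) (hu : ∀ n t, u (n+1) t = t * u n t) (n : ℕ) (θ l : ℝ) :
    HasDerivAt (fun l => el u n θ l) (el u (n+1) (θ + Real.pi / 2) l) l := by
  rw [hasDerivAt_iff_isLittleO_nhds_zero]
  refine Asymptotics.IsBigO.trans_isLittleO (g := fun h : ℝ => h ^ 2) ?_
    (Asymptotics.isLittleO_pow_id one_lt_two)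
  refine Asymptotics.IsBigO.of_bound ‖u (n+2)‖ (Eventually.of_forall fun h => ?_)
  refine c0_norm_le _ _ (by positivity) fun t => ?_
  simp only [ZeroAtInftyContinuousMap.sub_apply, ZeroAtInftyContinuousMap.smul_apply, el_apply,
    smul_eq_mul]
  have h1 := cos_taylor (l * t + θ) (h * t)
  have h2 := c0_le (u (n+2)) t
  rw [show n + 2 = n + 1 + 1 from rfl, hu, hu] at h2
  rw [hu]
  calc _ = |(Real.cos (l * t + θ + h * t) - Real.cos (l * t + θ) -
        h * t * Real.cos (l * t + θ + Real.pi / 2)) * u n t| := by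
        congr 1; ring_nf
    _ ≤ (h * t) ^ 2 * |u n t| := by rw [abs_mul]; gcongr
    _ = |t * (t * u n t)| * |h ^ 2| := by
        rw [abs_mul, abs_mul, abs_pow, mul_pow, ← sq_abs h, ← sq_abs t]; ring
    _ ≤ _ := by rw [Real.norm_eq_abs]; gcongr

lemma el_zero {E : Type*} [NormedAddCommGroup E] [NormedSpace ℝ E] (L : C₀(ℝ, ℝ) →L[ℝ] E)
    (u : ℕ → C₀(ℝ, ℝ)) (hu : ∀ n t, u (n+1) t = t * u n t)
    (M : ℕ → ℝ) (hM : ∀ n, 0 < M n) (hmono : Monotone fun n => M (n+1) / M n)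
    (hdiv : ¬ Summable fun n => M n / M (n+1)) (hb : ∀ n, ‖u n‖ ≤ M n)
    (h0 : ∀ n, L (u n) = 0) (θ l : ℝ) : L (el u 0 θ l) = 0 := by
  have pos : ∀ θ l, 0 ≤ l → L (el u 0 θ l) = 0 := by
    intro θ l hl
    have e : ∀ n, (‖L‖ + 1) * M (n+1) / ((‖L‖ + 1) * M n) = M (n+1) / M n := fun n =>
      mul_div_mul_left _ _ (by positivity)
    have e' : ∀ n, (‖L‖ + 1) * M n / ((‖L‖ + 1) * M (n+1)) = M n / M (n+1) := fun n =>
      mul_div_mul_left _ _ (by positivity)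
    have := bang (fun n l => L (el u n (θ + n * (Real.pi / 2)) l)) (fun n x => by
        have h1 := el_hasDerivAt u hu n (θ + n * (Real.pi / 2)) x
        have h2 := L.hasFDerivAt.comp_hasDerivAt x h1
        have e3 : θ + ((n+1:ℕ):ℝ) * (Real.pi / 2) = θ + n * (Real.pi / 2) + Real.pi / 2 := by
          push_cast; ring
        simp only [e3]
        exact h2)
      (fun n => (‖L‖ + 1) * M n) (fun n => mul_pos (by positivity) (hM n))
      (by simpa only [e] using hmono) (fun n x => by
        refine (L.le_opNorm _).trans ?_
        gcongr
        · linarith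
        refine c0_norm_le _ _ (hM n).le fun t => ?_
        rw [el_apply, abs_mul]
        have h1 := Real.abs_cos_le_one (x * t + (θ + n * (Real.pi / 2)))
        have h2 := (c0_le (u n) t).trans (hb n)
        calc _ ≤ 1 * |u n t| := by gcongr
          _ ≤ _ := by rwa [one_mul])
      (by simpa only [e'] using hdiv) (fun n => by
        have : el u n (θ + n * (Real.pi / 2)) 0 = Real.cos (θ + n * (Real.pi / 2)) • u n := by
          ext t; simp [el_apply]
        rw [this, map_smul, h0, smul_zero]) l hl
    simpa using this
  rcases le_total 0 l with hl | hl
  · exact pos θ l hl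
  · have := pos (-θ) (-l) (by linarith)
    have e : el u 0 θ l = el u 0 (-θ) (-l) := by
      ext t
      rw [el_apply, el_apply, ← Real.cos_neg]; ring_nf
    rw [e, this]

/-- real part of a periodic function times `u` -/
noncomputable def ph {T : ℝ} [Fact (0 < T)] (u : C₀(ℝ, ℝ)) (G : C(AddCircle T, ℂ)) : C₀(ℝ, ℝ) :=
  bm (fun t => (G (t : AddCircle T)).re) (by
    have : Continuous fun t : ℝ => (t : AddCircle T) := AddCircle.continuous_mk' T
    fun_prop) ‖G‖
    (fun t => (Complex.abs_re_le_norm _).trans (G.norm_coe_le_norm _)) u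

lemma ph_apply {T : ℝ} [Fact (0 < T)] (u : C₀(ℝ, ℝ)) (G : C(AddCircle T, ℂ)) (t : ℝ) :
    ph u G t = (G (t : AddCircle T)).re * u t := rfl

lemma ph_zero {E : Type*} [NormedAddCommGroup E] [NormedSpace ℝ E] (L : C₀(ℝ, ℝ) →L[ℝ] E)
    (u : ℕ → C₀(ℝ, ℝ)) (h0 : ∀ θ l, L (el u 0 θ l) = 0) {T : ℝ} [hT : Fact (0 < T)]
    (G : C(AddCircle T, ℂ)) : L (ph (u 0) G) = 0 := by
  have hadd : ∀ G H : C(AddCircle T, ℂ), ph (u 0) (G + H) = ph (u 0) G + ph (u 0) H := by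
    intro G H; ext t; simp [ph_apply, add_mul]
  have hspan : ∀ G ∈ Submodule.span ℂ (Set.range (@fourier T)), 
      ∀ c : ℂ, L (ph (u 0) (c • G)) = 0 := by
    intro G hG
    induction hG using Submodule.span_induction with
    | mem x hx =>
      obtain ⟨n, rfl⟩ := hx
      intro c
      have : ph (u 0) (c • (fourier n : C(AddCircle T, ℂ))) = c.re • el u 0 0 (2 * Real.pi * n / T) +
          c.im • el u 0 (Real.pi / 2) (2 * Real.pi * n / T) := by
        ext t
        have e : (2 * Real.pi * Complex.I * n * t / T : ℂ) =
            ((2 * Real.pi * n / T * t : ℝ) : ℂ) * Complex.I := by push_cast; ring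
        rw [ph_apply, ContinuousMap.smul_apply, fourier_coe_apply, e, smul_eq_mul, Complex.mul_re,
          Complex.exp_ofReal_mul_I_re, Complex.exp_ofReal_mul_I_im]
        simp only [ZeroAtInftyContinuousMap.add_apply, ZeroAtInftyContinuousMap.smul_apply,
          el_apply, smul_eq_mul, Real.cos_add_pi_div_two, add_zero]
        ring
      rw [this, map_add, map_smul, map_smul, h0, h0]; simp
    | zero =>
      intro c
      have : ph (u 0) (c • (0 : C(AddCircle T, ℂ))) = 0 := by ext t; simp [ph_apply]
      rw [this, map_zero]
    | add x y _ _ hx hy => intro c; rw [smul_add, hadd, map_add, hx, hy, add_zero]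
    | smul a x _ hx => intro c; rw [smul_smul]; exact hx _
  have hG : G ∈ (Submodule.span ℂ (Set.range (@fourier T))).topologicalClosure := by
    rw [span_fourier_closure_eq_top]; trivial
  have hcl : IsClosed {G : C(AddCircle T, ℂ) | L (ph (u 0) G) = 0} := by
    refine isClosed_eq ?_ continuous_const
    refine L.continuous.comp ?_
    refine LipschitzWith.continuous (K := ‖u 0‖₊) (LipschitzWith.of_dist_le_mul fun G H => ?_)
    rw [dist_eq_norm, dist_eq_norm]
    refine c0_norm_le _ _ (by positivity) fun t => ?_
    rw [ZeroAtInftyContinuousMap.sub_apply, ph_apply, ph_apply, ← sub_mul, ← Complex.sub_re,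
      abs_mul, mul_comm]
    have h1 := (Complex.abs_re_le_norm ((G - H) (t : AddCircle T))).trans
      ((G - H).norm_coe_le_norm _)
    exact mul_le_mul (c0_le _ _) h1 (abs_nonneg _) (norm_nonneg _)
  have : closure (Submodule.span ℂ (Set.range (@fourier T)) : Set C(AddCircle T, ℂ)) ⊆
      {G : C(AddCircle T, ℂ) | L (ph (u 0) G) = 0} := by
    refine closure_minimal (fun G hG => ?_) hcl
    have := hspan G hG 1
    rwa [one_smul] at this
  exact this hG

lemma all_zero {E : Type*} [NormedAddCommGroup E] [NormedSpace ℝ E] (L : C₀(ℝ, ℝ) →L[ℝ] E)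
    (u : ℕ → C₀(ℝ, ℝ)) (h0 : ∀ θ l, L (el u 0 θ l) = 0) (hpos : ∀ t, 0 < u 0 t)
    (v : C₀(ℝ, ℝ)) : L v = 0 := by
  have key : ∀ ε > 0, ‖L v‖ ≤ ‖L‖ * (2 * ε) := by
    intro ε hε
    have hlarge : ∀ (p : C₀(ℝ, ℝ)) (δ : ℝ), 0 < δ → ∃ A, 0 < A ∧ ∀ t, A ≤ |t| → |p t| ≤ δ := by
      intro p δ hδ
      have h1 := (zero_at_infty p).eventually (Metric.closedBall_mem_nhds 0 hδ)
      have h2 := (Metric.hasBasis_cobounded_compl_closedBall (0:ℝ)).eventually_iff.1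
        (by rw [Metric.cobounded_eq_cocompact]; exact h1)
      obtain ⟨A, -, hA⟩ := h2
      refine ⟨|A| + 1, by positivity, fun t ht => ?_⟩
      have := @hA t (by
        simp only [Set.mem_compl_iff, Metric.mem_closedBall, dist_zero_right, Real.norm_eq_abs]
        have := le_abs_self A
        linarith)
      simpa [dist_eq_norm] using this
    obtain ⟨A, hA0, hA⟩ := hlarge v ε hε
    set χ : ℝ → ℝ := fun t => max 0 (min 1 (A + 1 - |t|)) with hχ
    have hχ0 : ∀ t, 0 ≤ χ t := fun t => le_max_left _ _
    have hχ1 : ∀ t, χ t ≤ 1 := fun t => max_le zero_le_one (min_le_left _ _)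
    have hχA : ∀ t, |t| ≤ A → χ t = 1 := by
      intro t ht
      simp only [hχ]
      rw [min_eq_left (by linarith), max_eq_right zero_le_one]
    have hχB : ∀ t, A + 1 ≤ |t| → χ t = 0 := by
      intro t ht
      simp only [hχ]
      exact max_eq_left ((min_le_right _ _).trans (by linarith))
    set h : ℝ → ℝ := fun t => χ t * (v t / u 0 t) with hh
    have hvcont : Continuous fun t => v t / u 0 t :=
      v.continuous.div (u 0).continuous fun t => (hpos t).ne'
    have hχcont : Continuous χ := by fun_prop
    have hcont : Continuous h := hχcont.mul hvcont
    obtain ⟨B, hB⟩ := (isCompact_Icc (a := -(A+1)) (b := A+1)).exists_bound_of_continuousOn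
      hcont.continuousOn
    have hB' : ∀ t, |h t| ≤ |B| := by
      intro t
      by_cases ht : A + 1 ≤ |t|
      · simp [hh, hχB t ht]
      · exact (hB t (abs_le.1 (not_le.1 ht).le)).trans (le_abs_self B)
    obtain ⟨L1, hL10, hL1⟩ := hlarge (u 0) (ε / (|B| + 1)) (by positivity)
    set R := max L1 (A + 1) with hR
    have hRA : A + 1 ≤ R := le_max_right _ _
    have hR0 : 0 < R := by linarith
    have : Fact (0 < 2 * R) := ⟨by linarith⟩
    have hper : (fun t => (h t : ℂ)) (-R) = (fun t => (h t : ℂ)) (-R + 2 * R) := by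
      have h1 : h (-R) = 0 := by
        simp only [hh]; rw [hχB _ (by rw [abs_neg]; exact hRA.trans (le_abs_self R)), zero_mul]
      have h2 : h (-R + 2 * R) = 0 := by
        simp only [hh]
        rw [hχB _ (by rw [show -R + 2 * R = R by ring]; exact hRA.trans (le_abs_self R)), zero_mul]
      simp only [h1, h2]
    let G : C(AddCircle (2 * R), ℂ) := ⟨AddCircle.liftIco (2 * R) (-R) (fun t => (h t : ℂ)),
      AddCircle.liftIco_continuous hper (by fun_prop)⟩
    have hGin : ∀ t, |t| < R → (G (t : AddCircle (2*R))) = h t := by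
      intro t ht
      have := abs_lt.1 ht
      exact AddCircle.liftIco_coe_apply (p := 2 * R) (a := -R) (f := fun t => (h t : ℂ)) ⟨this.1.le, by linarith⟩
    have hGb : ∀ t : AddCircle (2*R), |(G t).re| ≤ |B| := by
      intro t
      have hx := (AddCircle.equivIco (2*R) (-R) t).2
      have e : G t = h (AddCircle.equivIco (2*R) (-R) t) := rfl
      rw [e, Complex.ofReal_re]
      exact hB' _
    have hz := ph_zero L u h0 G
    have hnorm : ‖v - ph (u 0) G‖ ≤ 2 * ε := by
      refine c0_norm_le _ _ (by positivity) fun t => ?_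
      rw [ZeroAtInftyContinuousMap.sub_apply, ph_apply]
      rcases lt_or_ge |t| R with ht | ht
      · rw [hGin t ht, Complex.ofReal_re]
        have e : v t - h t * u 0 t = (1 - χ t) * v t := by
          simp only [hh]
          have := (hpos t).ne'
          field_simp
        rw [e]
        rcases le_total |t| A with h3 | h3
        · rw [hχA t h3]; simp; positivity
        · rw [abs_mul, abs_of_nonneg (by linarith [hχ1 t])]
          have := hA t h3
          have := hχ0 t
          nlinarith [abs_nonneg (v t)]
      · have h1 := hA t (by linarith)
        have h2 := hL1 t ((le_max_left _ _).trans ht)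
        have h3 : |(G (t : AddCircle (2*R))).re * u 0 t| ≤ ε := by
          rw [abs_mul]
          calc _ ≤ |B| * (ε / (|B| + 1)) := mul_le_mul (hGb _) h2 (abs_nonneg _) (abs_nonneg _)
            _ = ε * (|B| / (|B| + 1)) := by ring
            _ ≤ ε * 1 := by
              gcongr
              rw [div_le_one (by positivity)]; linarith
            _ = ε := mul_one _
        have := abs_sub (v t) ((G (t : AddCircle (2*R))).re * u 0 t)
        linarith
    calc ‖L v‖ = ‖L (v - ph (u 0) G)‖ := by rw [map_sub, hz, sub_zero]
      _ ≤ ‖L‖ * ‖v - ph (u 0) G‖ := L.le_opNorm _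
      _ ≤ _ := by gcongr
  have hlim : Tendsto (fun ε : ℝ => ‖L‖ * (2 * ε)) (𝓝[>] 0) (𝓝 0) := by
    have : Tendsto (fun ε : ℝ => ‖L‖ * (2 * ε)) (𝓝 0) (𝓝 (‖L‖ * (2 * 0))) :=
      Continuous.tendsto (by fun_prop) 0
    simp only [mul_zero] at this
    exact this.mono_left nhdsWithin_le_nhds
  exact norm_le_zero_iff.1 (ge_of_tendsto hlim (by
    filter_upwards [self_mem_nhdsWithin] with ε hε using key ε hε))

lemma sufficiency (w : ℝ → ℝ)
    (hw_pos : ∀ x, 0 < w x) (hw_cont : Continuous w)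
    (hdecay : ∀ n : ℕ,
      Tendsto (fun x => x ^ n * w x) (cocompact ℝ) (nhds 0))
    (M : ℕ → ℝ) (hM : ∀ n, 0 < M n) (hmono : Monotone fun n => M (n+1) / M n)
    (hb : ∀ n t, |t| ^ n * w t ≤ M n)
    (hdiv : ¬ Summable fun n => M n / M (n+1)) 
    (f : ℝ → ℝ) (hf : Continuous f)
    (hf0 : Tendsto (fun x => f x * w x) (cocompact ℝ) (nhds 0)) :
        ∃ S : ℕ → Polynomial ℝ,
          Tendsto
            (fun k => ⨆ x : ℝ, ENNReal.ofReal |(f x - (S k).eval x) * w x|)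
            atTop (nhds 0) := by
  let u : ℕ → C₀(ℝ, ℝ) := fun n => ⟨⟨fun x => x ^ n * w x, by fun_prop⟩, hdecay n⟩
  have hu_apply : ∀ n t, u n t = t ^ n * w t := fun _ _ => rfl
  let V : Submodule ℝ C₀(ℝ, ℝ) := Submodule.span ℝ (Set.range u)
  have hVpoly : ∀ p ∈ V, ∃ S : Polynomial ℝ, ∀ t, p t = S.eval t * w t := by
    intro p hp
    induction hp using Submodule.span_induction with
    | mem x hx =>
      obtain ⟨n, rfl⟩ := hx
      exact ⟨Polynomial.X ^ n, fun t => by simp [hu_apply]⟩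
    | zero => exact ⟨0, fun t => by simp⟩
    | add x y _ _ hx hy =>
      obtain ⟨S, hS⟩ := hx
      obtain ⟨S', hS'⟩ := hy
      exact ⟨S + S', fun t => by simp [hS, hS', add_mul]⟩
    | smul a x _ hx =>
      obtain ⟨S, hS⟩ := hx
      exact ⟨Polynomial.C a * S, fun t => by simp [hS, mul_assoc]⟩
  let W := V.topologicalClosure
  have : IsClosed (W : Set C₀(ℝ, ℝ)) := V.isClosed_topologicalClosure
  let v : C₀(ℝ, ℝ) := ⟨⟨fun x => f x * w x, by fun_prop⟩, hf0⟩
  let L : C₀(ℝ, ℝ) →L[ℝ] (C₀(ℝ, ℝ) ⧸ W) := W.mkQL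
  have hL : ∀ p, L p = W.mkQ p := fun p => rfl
  have hv : L v = 0 := by
    refine all_zero (E := C₀(ℝ, ℝ) ⧸ W) L u (el_zero (E := C₀(ℝ, ℝ) ⧸ W) L u ?_ M hM hmono hdiv ?_ ?_) ?_ v
    · intro n t; rw [hu_apply, hu_apply]; ring
    · intro n
      refine c0_norm_le _ _ (hM n).le fun t => ?_
      rw [hu_apply, abs_mul, abs_pow, abs_of_pos (hw_pos t)]
      exact hb n t
    · intro n
      rw [hL]
      simp only [Submodule.mkQ_apply, Submodule.Quotient.mk_eq_zero]
      exact V.le_topologicalClosure (Submodule.subset_span ⟨n, rfl⟩)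
    · intro t; rw [hu_apply]; simpa using hw_pos t
  have hvW : v ∈ closure (V : Set C₀(ℝ, ℝ)) := by
    rw [hL] at hv
    simp only [Submodule.mkQ_apply, Submodule.Quotient.mk_eq_zero] at hv
    exact hv
  have hex : ∀ k : ℕ, ∃ S : Polynomial ℝ, ∀ x, |(f x - S.eval x) * w x| ≤ 1 / ((k:ℝ) + 1) := by
    intro k
    obtain ⟨p, hp, hpd⟩ := Metric.mem_closure_iff.1 hvW (1 / ((k:ℝ) + 1)) (by positivity)
    obtain ⟨S, hS⟩ := hVpoly p hp
    refine ⟨S, fun x => ?_⟩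
    have h1 := c0_le (v - p) x
    rw [dist_eq_norm] at hpd
    have e : (v - p) x = (f x - S.eval x) * w x := by
      rw [ZeroAtInftyContinuousMap.sub_apply, hS]
      show f x * w x - _ = _
      ring
    rw [e] at h1
    exact h1.trans hpd.le
  choose S hS using hex
  refine ⟨S, ?_⟩
  have hlim : Tendsto (fun k : ℕ => ENNReal.ofReal (1 / ((k:ℝ) + 1))) atTop (𝓝 0) := by
    rw [← ENNReal.ofReal_zero]
    exact ENNReal.tendsto_ofReal tendsto_one_div_add_atTop_nhds_zero_nat
  exact tendsto_of_tendsto_of_tendsto_of_le_of_le tendsto_const_nhds hlim (fun _ => zero_le)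
    (fun k => iSup_le fun x => ENNReal.ofReal_le_ofReal (hS k x))

open Real in
lemma image_arctan : (fun t : ℝ => π + 2 * arctan t) '' Set.univ = Set.Ioo 0 (2 * π) := by
  ext y
  constructor
  · rintro ⟨t, -, rfl⟩
    have h1 := neg_pi_div_two_lt_arctan t
    have h2 := arctan_lt_pi_div_two t
    constructor <;> simp only <;> linarith
  · rintro ⟨h1, h2⟩
    refine ⟨tan ((y - π) / 2), trivial, ?_⟩
    simp only
    rw [arctan_tan (by linarith) (by linarith)]
    ring

open Real in
lemma inj_arctan : Set.InjOn (fun t : ℝ => π + 2 * arctan t) Set.univ := by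
  intro a _ b _ h
  simp only at h
  exact arctan_injective (by linarith)

open Real in
lemma deriv_arctan' (t : ℝ) :
    HasDerivAt (fun t : ℝ => π + 2 * arctan t) (2 * (1 / (1 + t ^ 2))) t :=
  ((hasDerivAt_arctan t).const_mul 2).const_add π

/-- the point of the circle corresponding to `t` -/
noncomputable def zt (t : ℝ) : ℂ := circleMap 0 1 (Real.pi + 2 * Real.arctan t)

open Real in
lemma cov_int (g : ℂ → ℝ) (hg : CircleIntegrable g 0 1) :
    Integrable (fun t => g (zt t) / (1 + t ^ 2)) := by
  have h1 : IntegrableOn (fun θ : ℝ => g (circleMap 0 1 θ)) (Set.Ioo 0 (2 * π)) := by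
    have := hg
    rw [circleIntegrable_def, intervalIntegrable_iff_integrableOn_Ioo_of_le (by positivity)] at this
    exact this
  rw [← image_arctan, integrableOn_image_iff_integrableOn_abs_deriv_smul MeasurableSet.univ
    (fun t _ => (deriv_arctan' t).hasDerivWithinAt) inj_arctan, integrableOn_univ] at h1
  have h2 := h1.const_mul (1/2)
  refine h2.congr (Eventually.of_forall fun t => ?_)
  simp only [smul_eq_mul, zt]
  rw [abs_of_pos (by positivity)]
  ring

open Real in
lemma cov (g : ℂ → ℝ) :
    circleAverage g 0 1 = π⁻¹ * ∫ t, g (zt t) / (1 + t ^ 2) := by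
  rw [circleAverage_def, intervalIntegral.integral_of_le (by positivity),
    ← setIntegral_congr_set (μ := volume) Ioo_ae_eq_Ioc,
    ← image_arctan, integral_image_eq_integral_abs_deriv_smul MeasurableSet.univ
    (fun t _ => (deriv_arctan' t).hasDerivWithinAt) inj_arctan, setIntegral_univ]
  have : ∀ t : ℝ, |2 * (1 / (1 + t ^ 2))| • g (circleMap 0 1 (π + 2 * arctan t)) =
      2 * (g (zt t) / (1 + t ^ 2)) := by
    intro t
    simp only [smul_eq_mul, zt]
    rw [abs_of_pos (by positivity)]
    ring
  simp only [this]
  rw [integral_const_mul, smul_eq_mul]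
  field_simp

lemma zt_eq (t : ℝ) : zt t = -((1 - t ^ 2 : ℝ) + (2 * t : ℝ) * Complex.I) / (1 + t ^ 2 : ℝ) := by
  have hpos : (1 + t ^ 2 : ℝ) ≠ 0 := by positivity
  have hc : Real.cos (Real.pi + 2 * Real.arctan t) = -(1 - t ^ 2) / (1 + t ^ 2) := by
    rw [add_comm, Real.cos_add_pi, Real.cos_two_mul, Real.cos_sq_arctan]
    field_simp; ring
  have hs : Real.sin (Real.pi + 2 * Real.arctan t) = -(2 * t) / (1 + t ^ 2) := by
    rw [add_comm, Real.sin_add_pi, Real.sin_two_mul, Real.sin_arctan, Real.cos_arctan]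
    have h := Real.mul_self_sqrt (show (0:ℝ) ≤ 1 + t ^ 2 by positivity)
    have h2 : √(1 + t ^ 2) ≠ 0 := by positivity
    rw [neg_div]
    congr 1
    rw [mul_assoc, div_mul_div_comm, mul_one, h, mul_div_assoc]
  have hpos' : ((1 + t ^ 2 : ℝ) : ℂ) ≠ 0 := by exact_mod_cast hpos
  rw [zt, circleMap, zero_add, Complex.ofReal_one, one_mul, Complex.exp_mul_I,
    ← Complex.ofReal_cos, ← Complex.ofReal_sin, hc, hs]
  rw [Complex.ofReal_div, Complex.ofReal_div]
  field_simp
  push_cast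
  ring

lemma zt_rel (t : ℝ) : -Complex.I * (1 + zt t) = t * (zt t - 1) := by
  have hpos' : ((1 + t ^ 2 : ℝ) : ℂ) ≠ 0 := by
    have : (1 + t ^ 2 : ℝ) ≠ 0 := by positivity
    exact_mod_cast this
  rw [zt_eq]
  field_simp
  push_cast
  linear_combination (2 * (t:ℂ)) * Complex.I_sq

lemma zt_ne (t : ℝ) : zt t - 1 ≠ 0 := by
  intro h
  have h1 := zt_rel t
  rw [h, mul_zero] at h1
  have h2 : zt t = 1 := by linear_combination h
  rw [h2] at h1
  simp at h1

/-- transformed polynomial -/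
noncomputable def tr (p : Polynomial ℝ) : Polynomial ℂ :=
  ∑ k ∈ Finset.range (p.natDegree + 1), Polynomial.C (p.coeff k : ℂ) *
    (Polynomial.C (-Complex.I) * (1 + Polynomial.X)) ^ k *
      (Polynomial.X - Polynomial.C 1) ^ (p.natDegree - k)

lemma tr_eval (p : Polynomial ℝ) (z s : ℂ) (h : -Complex.I * (1 + z) = s * (z - 1)) :
    (tr p).eval z = (z - 1) ^ p.natDegree * Polynomial.aeval s p := by
  rw [tr, Polynomial.eval_finsetSum, Polynomial.aeval_eq_sum_range, Finset.mul_sum]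
  refine Finset.sum_congr rfl fun k hk => ?_
  have hk' : k ≤ p.natDegree := by simpa [Nat.lt_succ_iff] using hk
  simp only [Polynomial.eval_mul, Polynomial.eval_pow, Polynomial.eval_C, Polynomial.eval_add,
    Polynomial.eval_one, Polynomial.eval_X, Polynomial.eval_sub, h, Complex.real_smul]
  rw [mul_pow]
  have : (z - 1) ^ p.natDegree = (z - 1) ^ k * (z - 1) ^ (p.natDegree - k) := by
    rw [← pow_add]; congr 1; omega
  rw [this]; ring

lemma jensen (p : Polynomial ℝ) (hp : p ≠ 0) :
    Integrable (fun t : ℝ => Real.log |p.eval t| / (1 + t ^ 2)) ∧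
    (Polynomial.aeval Complex.I p ≠ 0 →
      Real.pi * Real.log ‖Polynomial.aeval Complex.I p‖ ≤
        ∫ t : ℝ, Real.log |p.eval t| / (1 + t ^ 2)) := by
  have i1 := cov_int (fun z => Real.log ‖(tr p).eval z‖)
    ((circleIntegrable_def _ _ _).2 (tr p).intervalIntegrable_mahlerMeasure)
  have i2 := cov_int (fun z => Real.log ‖(Polynomial.X - Polynomial.C (1:ℂ)).eval z‖)
    ((circleIntegrable_def _ _ _).2
    (Polynomial.X - Polynomial.C (1:ℂ)).intervalIntegrable_mahlerMeasure)
  have i3 := i1.sub (i2.const_mul (p.natDegree : ℝ))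
  have hae : (fun t : ℝ => Real.log |p.eval t| / (1 + t ^ 2)) =ᵐ[volume]
      ((fun t => Real.log ‖(tr p).eval (zt t)‖ / (1 + t ^ 2)) - fun t => (p.natDegree : ℝ) *
        (Real.log ‖(Polynomial.X - Polynomial.C (1:ℂ)).eval (zt t)‖ / (1 + t ^ 2))) := by
    have hfin : {t : ℝ | p.IsRoot t}.Finite := Polynomial.finite_setOfPred_isRoot hp
    have := hfin.measure_zero volume
    rw [measure_eq_zero_iff_ae_notMem] at this
    filter_upwards [this] with t ht
    have ht' : p.eval t ≠ 0 := ht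
    simp only [Pi.sub_apply]
    rw [tr_eval p (zt t) t (zt_rel t)]
    have e : Polynomial.aeval (t : ℂ) p = ((p.eval t : ℝ) : ℂ) := by
      have := Polynomial.aeval_algebraMap_apply ℂ t p
      simpa using this
    have hz : ‖zt t - 1‖ ≠ 0 := norm_ne_zero_iff.2 (zt_ne t)
    rw [e, norm_mul, norm_pow, Complex.norm_real, Real.norm_eq_abs,
      Real.log_mul (pow_ne_zero _ hz) (abs_ne_zero.2 ht'), Real.log_pow]
    simp only [Polynomial.eval_sub, Polynomial.eval_X, Polynomial.eval_C]
    ring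
  refine ⟨i3.congr hae.symm, fun hI => ?_⟩
  rw [integral_congr_ae hae]
  simp only [Pi.sub_apply]
  rw [integral_sub i1 (i2.const_mul _), integral_const_mul]
  have c1 := cov fun z => Real.log ‖(tr p).eval z‖
  have c2 := cov fun z => Real.log ‖(Polynomial.X - Polynomial.C (1:ℂ)).eval z‖
  rw [← Polynomial.logMahlerMeasure_def] at c1 c2
  rw [Polynomial.logMahlerMeasure_X_sub_C] at c2
  have hpi := Real.pi_pos
  have c2' : ∫ t : ℝ, Real.log ‖(Polynomial.X - Polynomial.C (1:ℂ)).eval (zt t)‖ / (1 + t ^ 2) = 0 := by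
    simp only [norm_one, Real.posLog_one] at c2
    have := mul_eq_zero.1 c2.symm
    exact this.resolve_left (by positivity)
  rw [c2', mul_zero, sub_zero]
  have h0 : (tr p).coeff 0 = (-1) ^ p.natDegree * Polynomial.aeval Complex.I p := by
    rw [Polynomial.coeff_zero_eq_eval_zero, tr_eval p 0 Complex.I (by ring)]
    simp
  have hn := Polynomial.norm_coeff_le_choose_mul_mahlerMeasure 0 (tr p)
  rw [h0] at hn
  simp only [norm_mul, norm_pow, norm_neg, norm_one, one_pow, one_mul, Nat.choose_zero_right,
    Nat.cast_one] at hn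
  have hlog := Real.log_le_log (norm_pos_iff.2 hI) hn
  rw [← Polynomial.logMahlerMeasure_eq_log_MahlerMeasure, c1] at hlog
  rw [inv_mul_eq_div, le_div_iff₀ hpi] at hlog
  linarith

lemma necessity (w : ℝ → ℝ)
    (hw_pos : ∀ x, 0 < w x) (hw_le : ∀ x, w x ≤ 1)
    (hw_cont : Continuous w) (hw_even : ∀ x, w (-x) = w x)
    (hdecay : ∀ n : ℕ,
      Tendsto (fun x => x ^ n * w x) (cocompact ℝ) (nhds 0))
    (H : ∀ f : ℝ → ℝ, Continuous f →
        Tendsto (fun x => f x * w x) (cocompact ℝ) (nhds 0) →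
        ∃ S : ℕ → Polynomial ℝ,
          Tendsto
            (fun k => ⨆ x : ℝ, ENNReal.ofReal |(f x - (S k).eval x) * w x|)
            atTop (nhds 0)) :
      ∫⁻ t in Set.Ioi (0:ℝ),
        ENNReal.ofReal (Real.log (1 / w t) / (1 + t ^ 2)) = ⊤ := by
  by_contra hfin
  set q : ℝ → ℝ := fun t => Real.log (1 / w t) / (1 + t ^ 2) with hq
  have hqcont : Continuous q := by
    apply Continuous.div
    · exact Continuous.log (continuous_const.div hw_cont fun x => (hw_pos x).ne') fun x => by
        have := hw_pos x; positivity
    · fun_prop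
    · intro x; positivity
  have hq0 : ∀ t, 0 ≤ q t := by
    intro t
    refine div_nonneg (Real.log_nonneg ?_) (by positivity)
    rw [le_div_iff₀ (hw_pos t)]; simpa using hw_le t
  have hi : IntegrableOn q (Set.Ioi 0) :=
    (lintegral_ofReal_ne_top_iff_integrable hqcont.aestronglyMeasurable
      (Eventually.of_forall hq0)).1 hfin
  have hqe : ∀ t, q (-t) = q t := by intro t; simp [hq, hw_even]
  have hi2 : IntegrableOn q (Set.Iio 0) := by
    have hqe' : (fun t => q (-t)) = q := funext hqe
    have hi' : IntegrableOn q (Set.Ioi (-0)) := by rw [neg_zero]; exact hi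
    have h3 : IntegrableOn (fun t => q (-t)) (Set.Iio 0) := IntegrableOn.comp_neg_Iio hi'
    rw [hqe'] at h3
    exact h3
  have hI : Integrable q := by
    rw [← integrableOn_univ, ← Set.Iic_union_Ioi (a := (0:ℝ))]
    exact ((integrableOn_Iic_iff_integrableOn_Iio (by simp)).2 hi2).union hi
  have hI2 := (jensen (1 + Polynomial.X ^ 2) (by
    intro h
    have := congrArg (Polynomial.eval 0) h
    simp at this)).1
  simp only [Polynomial.eval_add, Polynomial.eval_one, Polynomial.eval_pow, Polynomial.eval_X] at hI2
  set K := (∫ t : ℝ, Real.log |1 + t ^ 2| / (1 + t ^ 2)) + ∫ t, q t with hK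
  set ε := Real.exp (-(K + 1) / Real.pi) with hε
  obtain ⟨S, hS⟩ := H (fun x => 1 / (1 + x ^ 2)) (by
      refine continuous_const.div (by fun_prop) fun x => by positivity) (by
      have h0 := (hdecay 0)
      simp only [pow_zero, one_mul] at h0
      refine squeeze_zero_norm (fun x => ?_) h0
      rw [Real.norm_eq_abs, abs_of_pos (by have := hw_pos x; positivity)]
      have : 1 / (1 + x ^ 2) ≤ 1 := by
        rw [div_le_one (by positivity)]; nlinarith [sq_nonneg x]
      nlinarith [hw_pos x])
  obtain ⟨k, hk⟩ := (hS.eventually (gt_mem_nhds (show (0 : ENNReal) < ENNReal.ofReal ε from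
    ENNReal.ofReal_pos.2 (Real.exp_pos _)))).exists
  have hk' : ∀ x, |(1 / (1 + x ^ 2) - (S k).eval x) * w x| ≤ ε := by
    intro x
    have h1 := (le_iSup (fun x : ℝ => ENNReal.ofReal
      |(1 / (1 + x ^ 2) - (S k).eval x) * w x|) x).trans hk.le
    exact (ENNReal.ofReal_le_ofReal_iff (Real.exp_pos _).le).1 h1
  set p : Polynomial ℝ := 1 - (1 + Polynomial.X ^ 2) * S k with hp
  have hpI : Polynomial.aeval Complex.I p = 1 := by simp [hp]
  have hp0 : p ≠ 0 := by
    intro h; rw [h] at hpI; simp at hpI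
  obtain ⟨j1, j2⟩ := jensen p hp0
  have j3 := j2 (by rw [hpI]; exact one_ne_zero)
  rw [hpI] at j3
  simp only [norm_one, Real.log_one, mul_zero] at j3
  have hc : Integrable fun t : ℝ => Real.log ε * (1 + t ^ 2)⁻¹ :=
    integrable_inv_one_add_sq.const_mul _
  have hle : ∫ t : ℝ, Real.log |p.eval t| / (1 + t ^ 2) ≤
      ∫ t : ℝ, (Real.log ε * (1 + t ^ 2)⁻¹ + Real.log |1 + t ^ 2| / (1 + t ^ 2) + q t) := by
    refine integral_mono_ae j1 ((hc.add hI2).add hI) ?_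
    have hfin : {t : ℝ | p.IsRoot t}.Finite := Polynomial.finite_setOfPred_isRoot hp0
    have := hfin.measure_zero volume
    rw [measure_eq_zero_iff_ae_notMem] at this
    filter_upwards [this] with t ht
    have ht' : p.eval t ≠ 0 := ht
    have hw := hw_pos t
    have hpos : 0 < 1 + t ^ 2 := by positivity
    have h1 := hk' t
    have e : p.eval t * w t = (1 + t ^ 2) * ((1 / (1 + t ^ 2) - (S k).eval t) * w t) := by
      simp only [hp, Polynomial.eval_sub, Polynomial.eval_mul, Polynomial.eval_add,
        Polynomial.eval_one, Polynomial.eval_pow, Polynomial.eval_X]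
      field_simp
    have h2 : |p.eval t| * w t ≤ (1 + t ^ 2) * ε := by
      calc _ = |p.eval t * w t| := by rw [abs_mul, abs_of_pos hw]
        _ = (1 + t ^ 2) * |(1 / (1 + t ^ 2) - (S k).eval t) * w t| := by
          rw [e, abs_mul, abs_of_pos hpos]
        _ ≤ _ := by gcongr
    have h3 := Real.log_le_log (mul_pos (abs_pos.2 ht') hw) h2
    rw [Real.log_mul (abs_ne_zero.2 ht') hw.ne', Real.log_mul hpos.ne' (Real.exp_pos _).ne'] at h3
    simp only [hq]
    rw [abs_of_pos hpos, ← div_eq_mul_inv, ← add_div, ← add_div, one_div, Real.log_inv]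
    gcongr
    linarith
  have hcI : Integrable fun t : ℝ =>
      Real.log ε * (1 + t ^ 2)⁻¹ + Real.log |1 + t ^ 2| / (1 + t ^ 2) := hc.add hI2
  rw [integral_add hcI hI, integral_add hc hI2, integral_const_mul,
    integral_univ_inv_one_add_sq] at hle
  have : Real.log ε * Real.pi = -(K + 1) := by
    rw [hε, Real.log_exp]; field_simp
  rw [this] at hle
  linarith


end Bern

open Filter in
/-- **Solution of Bernstein's approximation problem (even, log-convex
weights).** Let `w : ℝ → (0,1]` be a continuous even weight with
`x ↦ log(1/w(eˣ))` convex on `ℝ` and `xⁿ w(x) → 0` as `|x| → ∞` for every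
`n : ℕ`. Then every continuous `f : ℝ → ℝ` with `f(x) w(x) → 0` as
`|x| → ∞` can be approximated by polynomials in the weighted sup norm
(i.e. Bernstein's problem for `w` has a positive answer) if and only if
`∫₀^∞ log(1/w(t))/(1 + t²) dt = ∞`. -/
theorem bernstein_problem_solution (w : ℝ → ℝ)
    (hw_pos : ∀ x, 0 < w x) (hw_le : ∀ x, w x ≤ 1)
    (hw_cont : Continuous w) (hw_even : ∀ x, w (-x) = w x)
    (hconv : ConvexOn ℝ Set.univ (fun x => Real.log (1 / w (Real.exp x))))
    (hdecay : ∀ n : ℕ,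
      Tendsto (fun x => x ^ n * w x) (cocompact ℝ) (nhds 0)) :
    (∀ f : ℝ → ℝ, Continuous f →
        Tendsto (fun x => f x * w x) (cocompact ℝ) (nhds 0) →
        ∃ S : ℕ → Polynomial ℝ,
          Tendsto
            (fun k => ⨆ x : ℝ, ENNReal.ofReal |(f x - (S k).eval x) * w x|)
            atTop (nhds 0)) ↔
      ∫⁻ t in Set.Ioi (0:ℝ),
        ENNReal.ofReal (Real.log (1 / w t) / (1 + t ^ 2)) = ⊤ := by
  constructor
  · intro H
    exact Bern.necessity w hw_pos hw_le hw_cont hw_even hdecay H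
  · intro hIntTop f hf hf0
    obtain ⟨M, hM, hmono, hb, hM2⟩ := Bern.exists_moments w hw_pos hw_cont hdecay
    exact Bern.sufficiency w hw_pos hw_cont hdecay M hM hmono hb
      (Bern.diverges w hw_pos hw_le hw_cont hw_even hconv M hM hM2 hIntTop) f hf hf0
end
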